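/- Let K be a quadratic field and σ the nontrivial ℚ-algebra automorphism of K. Let (x1, …, x8) ∈ K^8, not all zero, satisfy the 15 quadratic equations defining the model of X_ns(13) in ℙ^7 (listed in the context), and suppose the tuple (σ(x1), …, σ(x8)) is not a K-scalar multiple of (x1, …, x8) (i.e. the corresponding projective point is a genuine quadratic point). Then there exists a nonzero λ ∈ K such that σ(x_i) = λ·x_i for i = 1, 2, 3 and σ(x_i) = -λ·x_i for i = 4, 5, 6, 7, 8. (Equivalently: the Galois conjugate of every quadratic point on X_ns(13) equals its image under the modular involution w_13, so X_ns(13) has no exceptional quadratic points — the main theorem for p = 13.) -/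

import Mathlib

open NumberField Module
open scoped Matrix

section
variable {L : Type*} [Field L] [NumberField L]

/-- The quartic field data: `w² = w+3`, `ρ² = (1+w)ρ - 2(1+w)`, and `1, w, ρ, wρ` is a basis. -/
structure QD (L : Type*) [Field L] [NumberField L] where
  b : Basis (Fin 4) ℚ L
  w : L
  r : L
  hw : w ^ 2 = w + 3
  hr : r ^ 2 = (1 + w) * r - 2 * (1 + w)
  h0 : b 0 = 1
  h1 : b 1 = w
  h2 : b 2 = r
  h3 : b 3 = w * r

namespace QD
variable (Q : QD L)

/-- element with given coordinates -/
noncomputable def el (a b c d : ℚ) : L := a • Q.b 0 + b • Q.b 1 + c • Q.b 2 + d • Q.b 3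

theorem el_eq (a b c d : ℚ) : Q.el a b c d = a + b * Q.w + c * Q.r + d * (Q.w * Q.r) := by
  simp [el, Q.h0, Q.h1, Q.h2, Q.h3, Rat.smul_def]

theorem repr_el (a b c d : ℚ) : ∀ i, Q.b.repr (Q.el a b c d) i = ![a, b, c, d] i := by
  intro i
  fin_cases i <;> simp [el]

theorem trace_of (y : L) (m : Fin 4 → Fin 4 → ℚ)
    (h : ∀ j, y * Q.b j = Q.el (m j 0) (m j 1) (m j 2) (m j 3)) :
    Algebra.trace ℚ L y = m 0 0 + m 1 1 + m 2 2 + m 3 3 := by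
  rw [Algebra.trace_eq_matrix_trace Q.b, Matrix.trace, Fin.sum_univ_four]
  simp only [Matrix.diag, Algebra.leftMulMatrix_eq_repr_mul, h, repr_el]
  simp

theorem tr1 : Algebra.trace ℚ L (Q.b 0) = 4 := by
  rw [Q.trace_of (Q.b 0) ![![1,0,0,0],![0,1,0,0],![0,0,1,0],![0,0,0,1]]]
  · change (1:ℚ)+1+1+1 = 4; norm_num
  · intro j; fin_cases j <;> simp [Q.el_eq, Q.h0, Q.h1, Q.h2, Q.h3]
theorem trw : Algebra.trace ℚ L (Q.b 1) = 2 := by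
  rw [Q.trace_of (Q.b 1) ![![0,1,0,0],![3,1,0,0],![0,0,0,1],![0,0,3,1]]]
  · change (0:ℚ)+1+0+1 = 2; norm_num
  · have := Q.hw
    intro j; fin_cases j <;> simp [Q.el_eq, Q.h0, Q.h1, Q.h2, Q.h3] <;> grind
theorem trr : Algebra.trace ℚ L (Q.b 2) = 3 := by
  rw [Q.trace_of (Q.b 2) ![![0,0,1,0],![0,0,0,1],![-2,-2,1,1],![-6,-4,3,2]]]
  · change (0:ℚ)+0+1+2 = 3; norm_num
  · have := Q.hw
    have := Q.hr
    intro j; fin_cases j <;> simp [Q.el_eq, Q.h0, Q.h1, Q.h2, Q.h3] <;> grind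
theorem trwr : Algebra.trace ℚ L (Q.b 3) = 8 := by
  rw [Q.trace_of (Q.b 3) ![![0,0,0,1],![0,0,3,1],![-6,-4,3,2],![-12,-10,6,5]]]
  · change (0:ℚ)+0+3+5 = 8; norm_num
  · have := Q.hw
    have := Q.hr
    intro j; fin_cases j <;> simp [Q.el_eq, Q.h0, Q.h1, Q.h2, Q.h3] <;> grind

theorem tr_el (a b c d : ℚ) : Algebra.trace ℚ L (Q.el a b c d) = 4*a+2*b+3*c+8*d := by
  simp only [el, map_add, map_smul, tr1, trw, trr, trwr, smul_eq_mul]; ring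

theorem discr_b : Algebra.discr ℚ Q.b = -6591 := by
  have hw := Q.hw
  have hr := Q.hr
  have key : Algebra.traceMatrix ℚ Q.b = !![4,2,3,8;2,14,8,17;3,8,-1,-7;8,17,-7,-10] := by
    ext i j
    rw [Algebra.traceMatrix_apply, Algebra.traceForm_apply]
    have e : Q.b i * Q.b j = Q.el
      (![![1,0,0,0],![0,3,0,0],![0,0,-2,-6],![0,0,-6,-12]] i j)
      (![![0,1,0,0],![1,1,0,0],![0,0,-2,-4],![0,0,-4,-10]] i j)
      (![![0,0,1,0],![0,0,0,3],![1,0,1,3],![0,3,3,6]] i j)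
      (![![0,0,0,1],![0,0,1,1],![0,1,1,2],![1,1,2,5]] i j) := by
      fin_cases i <;> fin_cases j <;> simp [Q.el_eq, Q.h0, Q.h1, Q.h2, Q.h3] <;> grind
    rw [e, tr_el]
    fin_cases i <;> fin_cases j <;> norm_num
  rw [Algebra.discr_def, key]
  simp [Matrix.det_succ_row_zero, Fin.sum_univ_succ, Fin.succAbove]
  norm_num

theorem int_w : IsIntegral ℤ Q.w := by
  refine ⟨Polynomial.X ^ 2 - Polynomial.X - 3, by monicity!, ?_⟩
  have := Q.hw
  simp [Polynomial.eval₂_sub, Polynomial.eval₂_pow, Q.hw]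

theorem int_r : IsIntegral ℤ Q.r := by
  have h : IsIntegral (𝓞 L) Q.r := by
    let W : 𝓞 L := ⟨Q.w, Q.int_w⟩
    refine ⟨Polynomial.X ^ 2 - Polynomial.C (1 + W) * Polynomial.X + Polynomial.C (2 * (1 + W)),
      by monicity!, ?_⟩
    have hW : algebraMap (𝓞 L) L W = Q.w := rfl
    simp [Polynomial.eval₂_sub, Polynomial.eval₂_pow, Polynomial.eval₂_add, Polynomial.eval₂_mul, hW]
    have h2 : algebraMap (𝓞 L) L 2 = 2 := map_ofNat _ 2
    rw [h2]
    linear_combination Q.hr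
  exact isIntegral_trans (R := ℤ) (A := 𝓞 L) _ h

theorem finrank (Q : QD L) : Module.finrank ℚ L = 4 := by
  rw [Module.finrank_eq_card_basis Q.b]; simp

theorem int_b (i : Fin 4) : IsIntegral ℤ (Q.b i) := by
  have a1 := Q.int_w
  have a2 := Q.int_r
  fin_cases i <;> simp [Q.h0, Q.h1, Q.h2, Q.h3, a1, a2, a1.mul a2, isIntegral_one]

theorem discr_le (Q : QD L) : |discr L| ≤ 6591 := by
  have hc : Fintype.card (Free.ChooseBasisIndex ℤ (𝓞 L)) = 4 := by
    rw [← Module.finrank_eq_card_chooseBasisIndex, RingOfIntegers.rank, Q.finrank]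
  let e : Free.ChooseBasisIndex ℤ (𝓞 L) ≃ Fin 4 := Fintype.equivFinOfCardEq hc
  let B : Basis (Fin 4) ℤ (𝓞 L) := (RingOfIntegers.basis L).reindex e
  let B' : Basis (Fin 4) ℚ L := (integralBasis L).reindex e
  have hB : Algebra.discr ℚ B' = discr L := by
    rw [coe_discr]
    rw [← Algebra.discr_reindex ℚ (integralBasis L) e]
    congr 1
    ext i; simp [B']
  let P : Matrix (Fin 4) (Fin 4) ℤ := fun i j => B.repr ⟨Q.b j, Q.int_b j⟩ i
  have hP : (Q.b : Fin 4 → L) = (fun i => (B' i)) ᵥ* (P.map (Int.cast : ℤ → ℚ)).map (algebraMap ℚ L) := by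
    ext j
    have h1 := congrArg (algebraMap (𝓞 L) L) (B.sum_repr ⟨Q.b j, Q.int_b j⟩)
    have h2 : algebraMap (𝓞 L) L ⟨Q.b j, Q.int_b j⟩ = Q.b j := rfl
    rw [h2] at h1
    rw [← h1, map_sum]
    simp only [Matrix.vecMul, dotProduct]
    refine Finset.sum_congr rfl fun i _ => ?_
    have e1 : B' i = algebraMap (𝓞 L) L (B i) := by simp [B, B', integralBasis_apply]
    have e2 : ((P.map (Int.cast : ℤ → ℚ)).map (algebraMap ℚ L)) i j
        = ((B.repr ⟨Q.b j, Q.int_b j⟩ i : ℤ) : L) := by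
      change algebraMap ℚ L ((B.repr ⟨Q.b j, Q.int_b j⟩ i : ℤ) : ℚ) = _
      exact map_intCast _ _
    rw [e1, e2, zsmul_eq_mul, map_mul, map_intCast, mul_comm]
  have h := Algebra.discr_of_matrix_vecMul (fun i => (B' i)) (P.map (Int.cast : ℤ → ℚ))
  rw [← hP, Q.discr_b] at h
  have h3 : (P.map (Int.cast : ℤ → ℚ)).det = (P.det : ℚ) := by
    have := (Int.castRingHom ℚ).map_det P
    simpa using this.symm
  have h4 : Algebra.discr ℚ (fun i => B' i) = discr L := hB
  rw [h3, h4] at h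
  have h5 : (-6591 : ℤ) = P.det ^ 2 * discr L := by exact_mod_cast h
  have h6 : P.det ≠ 0 := by rintro h0; rw [h0] at h5; norm_num at h5
  have h7 : 1 ≤ P.det ^ 2 := by have := sq_pos_of_ne_zero h6; omega
  have h8 : |discr L| * P.det ^ 2 = 6591 := by
    have := congrArg abs h5
    rw [abs_mul, abs_pow, sq_abs] at this
    rw [mul_comm, ← this]; norm_num
  nlinarith [abs_nonneg (discr L)]
end QD
end

open NumberField Module
open scoped Matrix
section
variable {L : Type*} [Field L] [NumberField L]
namespace QD
variable (Q : QD L)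

/-- `w` as an algebraic integer -/
def W : 𝓞 L := ⟨Q.w, Q.int_w⟩
/-- `ρ` as an algebraic integer -/
def R : 𝓞 L := ⟨Q.r, Q.int_r⟩

theorem hW : Q.W ^ 2 = Q.W + 3 := by
  apply RingOfIntegers.coe_injective
  have h3 : algebraMap (𝓞 L) L 3 = 3 := map_ofNat _ 3
  rw [map_pow, map_add, h3]
  exact Q.hw

theorem hR : Q.R ^ 2 = (1 + Q.W) * Q.R - 2 * (1 + Q.W) := by
  apply RingOfIntegers.coe_injective
  have h3 : algebraMap (𝓞 L) L 2 = 2 := map_ofNat _ 2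
  rw [map_pow, map_sub, map_mul, map_mul, map_add, h3, map_one]
  exact Q.hr

theorem norm_of (y : L) (m : Fin 4 → Fin 4 → ℚ)
    (h : ∀ j, y * Q.b j = Q.el (m j 0) (m j 1) (m j 2) (m j 3)) :
    Algebra.norm ℚ y = Matrix.det (Matrix.of m) := by
  rw [Algebra.norm_eq_matrix_det Q.b, ← Matrix.det_transpose]
  congr 1
  ext i j
  rw [Matrix.transpose_apply, Algebra.leftMulMatrix_eq_repr_mul, h, repr_el]
  fin_cases j <;> rfl

theorem normZ (y : 𝓞 L) (k : ℤ) (h : Algebra.norm ℚ (y : L) = k) : Algebra.norm ℤ y = k := by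
  have := Algebra.coe_norm_int y
  rw [h] at this
  exact_mod_cast this

theorem absN (y : 𝓞 L) (k : ℕ) (h : Algebra.norm ℚ (y : L) = (k : ℚ)) :
    Ideal.absNorm (Ideal.span {y}) = k := by
  rw [Ideal.absNorm_span_singleton, normZ y k (by simpa using h)]
  simp

theorem absN' (y : 𝓞 L) (k : ℕ) (h : Algebra.norm ℚ (y : L) = -(k : ℚ)) :
    Ideal.absNorm (Ideal.span {y}) = k := by
  rw [Ideal.absNorm_span_singleton, normZ y (-k) (by simpa using h)]
  simp

theorem nR : Ideal.absNorm (Ideal.span {Q.R}) = 4 := by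
  apply absN'
  have hw := Q.hw
  have hr := Q.hr
  rw [show ((Q.R : 𝓞 L) : L) = Q.r from rfl,
    Q.norm_of _ ![![0,0,1,0],![0,0,0,1],![-2,-2,1,1],![-6,-4,3,2]]]
  · simp [Matrix.det_succ_row_zero, Fin.sum_univ_succ, Fin.succAbove]; norm_num
  · intro j; fin_cases j <;> simp [Q.el_eq, Q.h0, Q.h1, Q.h2, Q.h3] <;> grind

theorem nR' : Ideal.absNorm (Ideal.span {1 + Q.W - Q.R}) = 4 := by
  apply absN'
  have hw := Q.hw
  have hr := Q.hr
  rw [show ((1 + Q.W - Q.R : 𝓞 L) : L) = 1 + Q.w - Q.r from rfl,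
    Q.norm_of _ ![![1,1,-1,0],![3,2,0,-1],![2,2,0,0],![6,4,0,0]]]
  · simp [Matrix.det_succ_row_zero, Fin.sum_univ_succ, Fin.succAbove]; norm_num
  · intro j; fin_cases j <;> simp [Q.el_eq, Q.h0, Q.h1, Q.h2, Q.h3] <;> grind

theorem nW : Ideal.absNorm (Ideal.span {Q.W}) = 9 := by
  apply absN
  have hw := Q.hw
  rw [show ((Q.W : 𝓞 L) : L) = Q.w from rfl,
    Q.norm_of _ ![![0,1,0,0],![3,1,0,0],![0,0,0,1],![0,0,3,1]]]
  · simp [Matrix.det_succ_row_zero, Fin.sum_univ_succ, Fin.succAbove]; norm_num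
  · intro j; fin_cases j <;> simp [Q.el_eq, Q.h0, Q.h1, Q.h2, Q.h3] <;> grind

theorem n1R : Ideal.absNorm (Ideal.span {1 - Q.R}) = 3 := by
  apply absN
  have hw := Q.hw
  have hr := Q.hr
  rw [show ((1 - Q.R : 𝓞 L) : L) = 1 - Q.r from rfl,
    Q.norm_of _ ![![1,0,-1,0],![0,1,0,-1],![2,2,0,-1],![6,4,-3,-1]]]
  · simp [Matrix.det_succ_row_zero, Fin.sum_univ_succ, Fin.succAbove]; norm_num
  · intro j; fin_cases j <;> simp [Q.el_eq, Q.h0, Q.h1, Q.h2, Q.h3] <;> grind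

theorem nRW : Ideal.absNorm (Ideal.span {Q.R - Q.W}) = 3 := by
  apply absN
  have hw := Q.hw
  have hr := Q.hr
  rw [show ((Q.R - Q.W : 𝓞 L) : L) = Q.r - Q.w from rfl,
    Q.norm_of _ ![![0,-1,1,0],![-3,-1,0,1],![-2,-2,1,0],![-6,-4,0,1]]]
  · simp [Matrix.det_succ_row_zero, Fin.sum_univ_succ, Fin.succAbove]; norm_num
  · intro j; fin_cases j <;> simp [Q.el_eq, Q.h0, Q.h1, Q.h2, Q.h3] <;> grind

theorem eq_span_of (I : Ideal (𝓞 L)) (y : 𝓞 L) (hy : y ∈ I) (k : ℕ) (hk : k ≠ 0)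
    (h1 : Ideal.absNorm (Ideal.span {y}) = k) (h2 : Ideal.absNorm I = k) :
    Submodule.IsPrincipal I := by
  have hle : Ideal.span {y} ≤ I := (Ideal.span_singleton_le_iff_mem I).mpr hy
  obtain ⟨J, hJ⟩ := Ideal.dvd_iff_le.mpr hle
  have h3 := congrArg Ideal.absNorm hJ
  rw [map_mul, h1, h2] at h3
  have h4 : Ideal.absNorm J = 1 := by
    have := Nat.pos_of_ne_zero hk
    nlinarith
  rw [Ideal.absNorm_eq_one_iff] at h4
  rw [h4, Ideal.mul_top] at hJ
  exact ⟨y, by rw [← hJ]⟩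

theorem resHom (I : Ideal (𝓞 L)) (p : ℕ) (hp : p.Prime) (h : Ideal.absNorm I = p) :
    ∃ f : 𝓞 L →+* ZMod p, ∀ y ∈ I, f y = 0 := by
  have hc : Nat.card (𝓞 L ⧸ I) = p := by
    rw [← h]; rfl
  have : Finite (𝓞 L ⧸ I) := Nat.finite_of_card_ne_zero (by rw [hc]; exact hp.ne_zero)
  have : Fintype (𝓞 L ⧸ I) := Fintype.ofFinite _
  have hc' : Fintype.card (𝓞 L ⧸ I) = p := by rw [← hc, Nat.card_eq_fintype_card]
  let e := ZMod.ringEquivOfPrime (𝓞 L ⧸ I) hp hc'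
  refine ⟨(e.symm : (𝓞 L ⧸ I) →+* ZMod p).comp (Ideal.Quotient.mk I), fun y hy => ?_⟩
  simp [Ideal.Quotient.eq_zero_iff_mem.mpr hy]

theorem noRes (I : Ideal (𝓞 L)) (p : ℕ) (hp : p.Prime) (h : Ideal.absNorm I = p)
    (hd : ∀ x : ZMod p, x ^ 2 ≠ x + 3) (Q : QD L) : False := by
  obtain ⟨f, -⟩ := resHom I p hp h
  apply hd (f Q.W)
  rw [← map_pow, Q.hW, map_add, map_ofNat]

theorem mink (Q : QD L) : (4 / Real.pi) ^ InfinitePlace.nrComplexPlaces L *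
    ((Module.finrank ℚ L).factorial / (Module.finrank ℚ L : ℝ) ^ (Module.finrank ℚ L) *
      √|(discr L : ℝ)|) < 13 := by
  have hr : InfinitePlace.nrComplexPlaces L ≤ 2 := by
    have := InfinitePlace.card_add_two_mul_card_eq_rank L
    rw [Q.finrank] at this
    omega
  have hpi : 4 / Real.pi ≤ 4 / 3.14 := by
    apply div_le_div_of_nonneg_left <;> linarith [Real.pi_gt_d2]
  have hpi1 : 1 ≤ 4 / Real.pi := by
    rw [le_div_iff₀ Real.pi_pos]; linarith [Real.pi_le_four]
  have h1 : (4 / Real.pi) ^ InfinitePlace.nrComplexPlaces L ≤ (4 / 3.14) ^ 2 :=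
    (pow_le_pow_right₀ hpi1 hr).trans (pow_le_pow_left₀ (by positivity) hpi 2)
  have h2 : √|(discr L : ℝ)| ≤ 82 := by
    rw [Real.sqrt_le_left (by norm_num)]
    have := Q.discr_le
    have h : ((|discr L| : ℤ) : ℝ) ≤ 6591 := by exact_mod_cast this
    rw [Int.cast_abs] at h
    linarith
  rw [Q.finrank]
  have h3 : ((Nat.factorial 4 : ℕ) / ((4 : ℕ) : ℝ) ^ 4 * √|(discr L : ℝ)|) ≤ 7.6875 := by
    norm_num [Nat.factorial]
    linarith
  calc _ ≤ (4 / 3.14 : ℝ) ^ 2 * 7.6875 := by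
        apply mul_le_mul h1 h3 (by positivity) (by positivity)
    _ < 13 := by norm_num

theorem pid (Q : QD L) : IsPrincipalIdealRing (𝓞 L) := by
  apply RingOfIntegers.isPrincipalIdealRing_of_isPrincipal_of_norm_le_of_isPrime
  rintro ⟨I, hI0⟩ hp hn
  simp only at hp hn ⊢
  have hn13 : Ideal.absNorm I < 13 := by
    have := lt_of_le_of_lt hn Q.mink
    exact_mod_cast this
  have hne1 : Ideal.absNorm I ≠ 1 := by
    rw [Ne, Ideal.absNorm_eq_one_iff]; exact hp.ne_top
  have hmem : ((Ideal.absNorm I : ℕ) : 𝓞 L) ∈ I := Ideal.absNorm_mem I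
  have hpow : ∀ p : ℕ, (p : 𝓞 L) ∈ I → Ideal.absNorm I ∣ p ^ 4 := by
    intro p hpI
    have h1 := Ideal.absNorm_dvd_absNorm_of_le ((Ideal.span_singleton_le_iff_mem I).mpr hpI)
    rwa [Ideal.absNorm_span_natCast, RingOfIntegers.rank, Q.finrank] at h1
  have hprime : ∃ p : ℕ, p.Prime ∧ p < 13 ∧ (p : 𝓞 L) ∈ I := by
    have h0 : Ideal.absNorm I ≠ 0 := by
      have := Ideal.absNorm_pos_of_nonZeroDivisors ⟨I, hI0⟩
      exact this.ne'
    have key : ∀ m : ℕ, m ≠ 0 → m < 13 → (m : 𝓞 L) ∈ I →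
        ∃ p : ℕ, p.Prime ∧ p < 13 ∧ (p : 𝓞 L) ∈ I := by
      intro m
      induction m using Nat.recOnMul with
      | zero => intro h; exact absurd rfl h
      | one => intro _ _ h; exact absurd (I.eq_top_of_isUnit_mem h (by simp)) hp.ne_top
      | prime p hpp => intro _ h1 h2; exact ⟨p, hpp, h1, h2⟩
      | mul a b iha ihb =>
        intro h1 h2 h3
        push_cast at h3
        have ha : a ≠ 0 := left_ne_zero_of_mul h1
        have hb : b ≠ 0 := right_ne_zero_of_mul h1
        rcases hp.mem_or_mem h3 with h | h
        · exact iha ha (lt_of_le_of_lt (Nat.le_mul_of_pos_right a (Nat.pos_of_ne_zero hb)) h2) h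
        · exact ihb hb (lt_of_le_of_lt (Nat.le_mul_of_pos_left b (Nat.pos_of_ne_zero ha)) h2) h
    exact key _ h0 hn13 hmem
  obtain ⟨p, hpp, hlt, hpI⟩ := hprime
  have hd := hpow p hpI
  obtain ⟨k, hk4, hk⟩ := (Nat.dvd_prime_pow hpp).mp hd
  have hW := Q.hW
  have hR := Q.hR
  interval_cases p <;> try (exfalso; revert hpp; norm_num; done)
  · have hk2 : k = 1 ∨ k = 2 ∨ k = 3 := by interval_cases k <;> omega
    have h2 : Q.R * (1 + Q.W - Q.R) ∈ I := by
      have : Q.R * (1 + Q.W - Q.R) = (1 + Q.W) * ((2 : ℕ) : 𝓞 L) := by push_cast; linear_combination -hR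
      rw [this]; exact I.mul_mem_left _ hpI
    have hk1 : k ≠ 1 := by
      rintro rfl
      exact noRes I 2 Nat.prime_two (by simpa using hk) (by decide) Q
    rcases hp.mem_or_mem h2 with h | h
    · refine eq_span_of I _ h 4 (by norm_num) Q.nR ?_
      have := Ideal.absNorm_dvd_absNorm_of_le ((Ideal.span_singleton_le_iff_mem I).mpr h)
      rw [Q.nR] at this
      rcases hk2 with rfl | rfl | rfl
      · exact absurd rfl hk1
      · exact hk
      · rw [hk] at this; norm_num at this
    · refine eq_span_of I _ h 4 (by norm_num) Q.nR' ?_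
      have := Ideal.absNorm_dvd_absNorm_of_le ((Ideal.span_singleton_le_iff_mem I).mpr h)
      rw [Q.nR'] at this
      rcases hk2 with rfl | rfl | rfl
      · exact absurd rfl hk1
      · exact hk
      · rw [hk] at this; norm_num at this
  · have hk2 : k = 1 ∨ k = 2 := by interval_cases k <;> omega
    have h2 : Q.W * (1 - Q.W) ∈ I := by
      have : Q.W * (1 - Q.W) = (-1) * ((3 : ℕ) : 𝓞 L) := by push_cast; linear_combination -hW
      rw [this]; exact I.mul_mem_left _ hpI
    rcases hp.mem_or_mem h2 with h | h
    · rcases hk2 with rfl | rfl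
      · exfalso
        obtain ⟨f, hf⟩ := resHom I 3 Nat.prime_three (by simpa using hk)
        have h0 := hf _ h
        have h1 := congrArg f hR
        simp only [map_pow, map_sub, map_mul, map_add, map_one, map_ofNat, h0] at h1
        revert h1
        generalize f Q.R = x
        revert x
        decide
      · exact eq_span_of I _ h 9 (by norm_num) Q.nW hk
    · have h3 : (1 - Q.R) * (Q.R - Q.W) ∈ I := by
        have : (1 - Q.R) * (Q.R - Q.W) = -(1 + Q.W) * (1 - Q.W) := by linear_combination -hR - hW
        rw [this]; exact I.mul_mem_left _ h
      rcases hp.mem_or_mem h3 with h | h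
      · refine eq_span_of I _ h 3 (by norm_num) Q.n1R ?_
        have := Ideal.absNorm_dvd_absNorm_of_le ((Ideal.span_singleton_le_iff_mem I).mpr h)
        rw [Q.n1R] at this
        rcases hk2 with rfl | rfl
        · simpa using hk
        · rw [hk] at this; norm_num at this
      · refine eq_span_of I _ h 3 (by norm_num) Q.nRW ?_
        have := Ideal.absNorm_dvd_absNorm_of_le ((Ideal.span_singleton_le_iff_mem I).mpr h)
        rw [Q.nRW] at this
        rcases hk2 with rfl | rfl
        · simpa using hk
        · rw [hk] at this; norm_num at this
  · exfalso
    have hk2 : k = 1 := by interval_cases k <;> omega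
    subst hk2
    exact noRes I 5 Nat.prime_five (by simpa using hk) (by decide) Q
  · exfalso
    have hk2 : k = 1 := by interval_cases k <;> omega
    subst hk2
    exact noRes I 7 (by norm_num) (by simpa using hk) (by decide) Q
  · exfalso
    have hk2 : k = 1 := by interval_cases k <;> omega
    subst hk2
    exact noRes I 11 (by norm_num) (by simpa using hk) (by decide) Q
end QD
end

open NumberField Module
open scoped Matrix
section
variable {L : Type*} [Field L] [NumberField L]
namespace QD
variable (Q : QD L)

theorem n127a : Ideal.absNorm (Ideal.span {-Q.W - Q.R - 2 * (Q.W * Q.R)}) = 127 := by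
  apply absN'
  have hw := Q.hw
  have hr := Q.hr
  have h2 : algebraMap (𝓞 L) L 2 = 2 := map_ofNat _ 2
  rw [show ((-Q.W - Q.R - 2 * (Q.W * Q.R) : 𝓞 L) : L) = -Q.w - Q.r - 2 * (Q.w * Q.r) by
      simp only [map_sub, map_mul, map_neg, h2]; rfl,
    Q.norm_of _ ![![0,-1,-1,-2],![-3,-1,-6,-3],![14,10,-7,-6],![30,24,-18,-13]]]
  · simp [Matrix.det_succ_row_zero, Fin.sum_univ_succ, Fin.succAbove]; norm_num
  · intro j; fin_cases j <;> simp [Q.el_eq, Q.h0, Q.h1, Q.h2, Q.h3] <;> grind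

theorem n127b : Ideal.absNorm (Ideal.span {-1 - Q.W - 2 * Q.R}) = 127 := by
  apply absN'
  have hw := Q.hw
  have hr := Q.hr
  have h2 : algebraMap (𝓞 L) L 2 = 2 := map_ofNat _ 2
  rw [show ((-1 - Q.W - 2 * Q.R : 𝓞 L) : L) = -1 - Q.w - 2 * Q.r by
      simp only [map_sub, map_mul, map_neg, h2, map_one]; rfl,
    Q.norm_of _ ![![-1,-1,-2,0],![-3,-2,0,-2],![4,4,-3,-3],![12,8,-9,-6]]]
  · simp [Matrix.det_succ_row_zero, Fin.sum_univ_succ, Fin.succAbove]; norm_num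
  · intro j; fin_cases j <;> simp [Q.el_eq, Q.h0, Q.h1, Q.h2, Q.h3] <;> grind

/-- the fundamental unit of the quadratic subfield -/
def e : (𝓞 L)ˣ where
  val := 1 + Q.W
  inv := Q.W - 2
  val_inv := by linear_combination Q.hW
  inv_val := by linear_combination Q.hW

/-- the relative unit -/
def h : (𝓞 L)ˣ where
  val := (1 + Q.R) * (Q.W - 2)
  inv := (2 + Q.W - Q.R) * (Q.W - 2)
  val_inv := by
    have h1 := Q.hW
    have h2 := Q.hR
    linear_combination (exp := 1) (-(Q.W-2)^2) * h2 + (3 * Q.W - 5) * h1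
  inv_val := by
    have h1 := Q.hW
    have h2 := Q.hR
    linear_combination (exp := 1) (-(Q.W-2)^2) * h2 + (3 * Q.W - 5) * h1

set_option maxRecDepth 20000 in
theorem w127 : ∀ w : ZMod 127, w ^ 2 = w + 3 → w = 47 ∨ w = 81 := by decide
set_option maxRecDepth 20000 in
theorem r127a : ∀ r : ZMod 127, -47 - r - 2 * (47 * r) = 0 → r = 61 := by decide
set_option maxRecDepth 20000 in
theorem r127a' : ∀ r : ZMod 127, -81 - r - 2 * (81 * r) = 0 → r ^ 2 ≠ (1 + 81) * r - 2 * (1 + 81) := by decide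
set_option maxRecDepth 20000 in
theorem r127b : ∀ r : ZMod 127, -1 - 81 - 2 * r = 0 → r = 86 := by decide
set_option maxRecDepth 20000 in
theorem r127b' : ∀ r : ZMod 127, -1 - 47 - 2 * r = 0 → r ^ 2 ≠ (1 + 47) * r - 2 * (1 + 47) := by decide

theorem hom_a (Q : QD L) : ∃ f : 𝓞 L →+* ZMod 127, f Q.W = 47 ∧ f Q.R = 61 := by
  obtain ⟨f, hf⟩ := resHom _ 127 (by norm_num) Q.n127a
  have h := hf _ (Ideal.mem_span_singleton_self _)
  have h1 := congrArg f Q.hW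
  have h2 := congrArg f Q.hR
  simp only [map_pow, map_sub, map_mul, map_add, map_one, map_ofNat, map_neg] at h h1 h2
  refine ⟨f, ?_⟩
  rcases w127 _ h1 with hw | hw
  · rw [hw] at h
    exact ⟨hw, r127a _ h⟩
  · rw [hw] at h h2
    exact absurd h2 (r127a' _ h)

theorem hom_b (Q : QD L) : ∃ f : 𝓞 L →+* ZMod 127, f Q.W = 81 ∧ f Q.R = 86 := by
  obtain ⟨f, hf⟩ := resHom _ 127 (by norm_num) Q.n127b
  have h := hf _ (Ideal.mem_span_singleton_self _)
  have h1 := congrArg f Q.hW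
  have h2 := congrArg f Q.hR
  simp only [map_pow, map_sub, map_mul, map_add, map_one, map_ofNat, map_neg] at h h1 h2
  refine ⟨f, ?_⟩
  rcases w127 _ h1 with hw | hw
  · rw [hw] at h h2
    exact absurd h2 (r127b' _ h)
  · rw [hw] at h
    exact ⟨hw, r127b _ h⟩

theorem chi (f : 𝓞 L →+* ZMod 127) (a b c : (𝓞 L)ˣ) (i j : ℤ) (h : a ^ i * b ^ j = c ^ 3) :
    ((Units.map f.toMonoidHom a) ^ 42) ^ i * ((Units.map f.toMonoidHom b) ^ 42) ^ j = 1 := by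
  have : Fact (Nat.Prime 127) := ⟨by norm_num⟩
  have h1 := congrArg (fun u => (Units.map f.toMonoidHom u) ^ 42) h
  simp only [map_mul, map_zpow, map_pow, mul_pow] at h1
  rw [← pow_mul, ZMod.units_pow_card_sub_one_eq_one] at h1
  rw [← h1]
  congr 1 <;> rw [← zpow_natCast, ← zpow_natCast, ← zpow_mul, ← zpow_mul, mul_comm]

theorem ord3 (u : (ZMod 127)ˣ) (h1 : u ^ 42 ≠ 1) (i : ℤ) (h : (u ^ 42) ^ i = 1) : 3 ∣ i := by
  have : Fact (Nat.Prime 127) := ⟨by norm_num⟩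
  have : Fact (Nat.Prime 3) := ⟨by norm_num⟩
  have h3 : orderOf (u ^ 42) = 3 := by
    apply orderOf_eq_prime _ h1
    rw [← pow_mul, ZMod.units_pow_card_sub_one_eq_one]
  have := orderOf_dvd_iff_zpow_eq_one.mpr h
  rw [h3] at this
  exact_mod_cast this

theorem indep (c : (𝓞 L)ˣ) (i j : ℤ) (hc : Q.e ^ i * Q.h ^ j = c ^ 3) : 3 ∣ i ∧ 3 ∣ j := by
  obtain ⟨f, fw, fr⟩ := Q.hom_a
  have h1 := chi f _ _ _ _ _ hc
  have hH : (Units.map f.toMonoidHom Q.h) ^ 42 = 1 := by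
    ext
    simp only [Units.val_pow_eq_pow_val, Units.coe_map, h]
    simp only [RingHom.toMonoidHom_eq_coe, MonoidHom.coe_coe, map_mul, map_add, map_one, map_sub, map_ofNat, fw, fr]
    decide
  rw [hH, one_zpow, mul_one] at h1
  have hi : 3 ∣ i := by
    refine ord3 _ ?_ _ h1
    intro hh
    have := congrArg Units.val hh
    simp only [Units.val_pow_eq_pow_val, Units.coe_map, e] at this
    simp only [RingHom.toMonoidHom_eq_coe, MonoidHom.coe_coe, map_mul, map_add, map_one, map_sub, map_ofNat, fw, fr] at this
    revert this
    decide
  refine ⟨hi, ?_⟩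
  obtain ⟨k, rfl⟩ := hi
  obtain ⟨f, fw, fr⟩ := Q.hom_b
  have h1 := chi f _ _ _ _ _ hc
  have h3 : ∀ u : (ZMod 127)ˣ, (u ^ 42) ^ (3 * k) = 1 := by
    intro u
    have hF : Fact (Nat.Prime 127) := ⟨by norm_num⟩
    rw [zpow_mul, show (3 : ℤ) = ((3 : ℕ) : ℤ) by norm_num, zpow_natCast, ← pow_mul,
      ZMod.units_pow_card_sub_one_eq_one, one_zpow]
  rw [h3, one_mul] at h1
  refine ord3 _ ?_ _ h1
  intro hh
  have := congrArg Units.val hh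
  simp only [Units.val_pow_eq_pow_val, Units.coe_map, h] at this
  simp only [RingHom.toMonoidHom_eq_coe, MonoidHom.coe_coe, map_mul, map_add, map_one, map_sub, map_ofNat, fw, fr] at this
  revert this
  decide

theorem rank_le (Q : QD L) (g : L →+* ℂ) (hg : ¬ ComplexEmbedding.IsReal g) : Units.rank L ≤ 2 := by
  have h1 := InfinitePlace.card_add_two_mul_card_eq_rank L
  rw [Q.finrank] at h1
  classical
  have h2 : 0 < InfinitePlace.nrComplexPlaces L := by
    rw [InfinitePlace.nrComplexPlaces, Fintype.card_pos_iff]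
    exact ⟨⟨InfinitePlace.mk g, InfinitePlace.isComplex_mk_iff.mpr hg⟩⟩
  have h3 := InfinitePlace.card_eq_nrRealPlaces_add_nrComplexPlaces L
  rw [Units.rank, h3]
  omega

theorem tors (f : L →+* ℝ) (t : (𝓞 L)ˣ) (ht : t ∈ Units.torsion L) : ∃ c, t = c ^ 3 := by
  have h1 : t = 1 ∨ t = -1 := by
    obtain ⟨n, hn, hp⟩ := (isOfFinOrder_iff_pow_eq_one).mp ((CommGroup.mem_torsion _).mp ht)
    have h2 : (f ((t : 𝓞 L) : L)) ^ n = 1 := by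
      rw [← map_pow, ← map_pow]
      have := congrArg Units.val hp
      rw [Units.val_pow_eq_pow_val] at this
      rw [this]; simp
    have h3 : |f ((t : 𝓞 L) : L)| = 1 := by
      have := congrArg abs h2
      rw [abs_pow, abs_one] at this
      exact (pow_eq_one_iff_of_nonneg (abs_nonneg _) hn.ne').mp this
    rcases (abs_eq (by norm_num)).mp h3 with h | h
    · left
      ext
      apply f.injective
      rw [h]; simp
    · right
      ext
      apply f.injective
      rw [h]; simp
  rcases h1 with rfl | rfl
  · exact ⟨1, by simp⟩
  · exact ⟨-1, by ext; simp; ring⟩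

theorem units (f : L →+* ℝ) (g : L →+* ℂ) (hg : ¬ ComplexEmbedding.IsReal g) (u : (𝓞 L)ˣ) :
    ∃ i j : ℤ, ∃ c, u = Q.e ^ i * Q.h ^ j * c ^ 3 := by
  have hex := NumberField.Units.exist_unique_eq_mul_prod L
  choose z hz huz using hex
  simp only at hz huz
  let φ : (𝓞 L)ˣ → (Fin (Units.rank L) → ZMod 3) := fun u k => (((z u).2 k : ℤ) : ZMod 3)
  have φm : ∀ a b, φ (a * b) = φ a + φ b := by
    intro a b
    have h1 := huz (a * b) ((z a).1 * (z b).1, (z a).2 + (z b).2) (by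
      conv_lhs => rw [hz a, hz b]
      simp only [Pi.add_apply, zpow_add, Finset.prod_mul_distrib, Subgroup.coe_mul]
      exact mul_mul_mul_comm _ _ _ _)
    ext k; simp only [φ, ← h1, Pi.add_apply, Int.cast_add]
  have φz : ∀ a (i : ℤ), φ (a ^ i) = i • φ a := by
    intro a i
    have h1 := huz (a ^ i) ((z a).1 ^ i, i • (z a).2) (by
      conv_lhs => rw [hz a]
      rw [mul_zpow, ← Finset.prod_zpow, Subgroup.coe_zpow]
      congr 1
      refine Finset.prod_congr rfl fun k _ => ?_
      change _ = _ ^ (i * _)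
      rw [mul_comm i, zpow_mul])
    ext k; simp only [φ, ← h1, Pi.smul_apply, zsmul_eq_mul]
          ; simp
  have φk : ∀ a, φ a = 0 → ∃ c, a = c ^ 3 := by
    intro a ha
    have hk : ∀ k, ∃ m : ℤ, (z a).2 k = m * ((3 : ℕ) : ℤ) := by
      intro k
      have := congrFun ha k
      simp only [φ, Pi.zero_apply] at this
      obtain ⟨m, hm⟩ := (ZMod.intCast_zmod_eq_zero_iff_dvd _ 3).mp this
      exact ⟨m, by rw [hm]; ring⟩
    choose m hm using hk
    obtain ⟨c, hc⟩ := tors f _ (z a).1.2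
    refine ⟨c * ∏ k, Units.fundSystem L k ^ m k, ?_⟩
    rw [mul_pow, ← hc, ← Finset.prod_pow]
    conv_lhs => rw [hz a]
    congr 1
    refine Finset.prod_congr rfl fun k _ => ?_
    rw [hm, zpow_mul, zpow_natCast]
  let ψ : ZMod 3 × ZMod 3 → (Fin (Units.rank L) → ZMod 3) := fun p => p.1 • φ Q.e + p.2 • φ Q.h
  have cast : ∀ (i : ℤ) (v : Fin (Units.rank L) → ZMod 3), (i : ZMod 3) • v = i • v := by
    intro i v; ext k; simp
  have hinj : Function.Injective ψ := by
    rintro ⟨a, b⟩ ⟨c, d⟩ hh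
    obtain ⟨a, rfl⟩ := ZMod.intCast_surjective a
    obtain ⟨b, rfl⟩ := ZMod.intCast_surjective b
    obtain ⟨c, rfl⟩ := ZMod.intCast_surjective c
    obtain ⟨d, rfl⟩ := ZMod.intCast_surjective d
    simp only [ψ] at hh
    have h0 : φ (Q.e ^ (a - c) * Q.h ^ (b - d)) = 0 := by
      rw [φm, φz, φz, sub_smul, sub_smul, ← cast, ← cast, ← cast, ← cast]
      have := sub_eq_zero.mpr hh
      rw [← this]; abel
    obtain ⟨y, hy⟩ := φk _ h0
    obtain ⟨h1, h2⟩ := Q.indep y _ _ hy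
    ext
    · have := (ZMod.intCast_zmod_eq_zero_iff_dvd _ 3).mpr h1
      push_cast at this
      exact sub_eq_zero.mp this
    · have := (ZMod.intCast_zmod_eq_zero_iff_dvd _ 3).mpr h2
      push_cast at this
      exact sub_eq_zero.mp this
  have hr := rank_le Q g hg
  have hb : Function.Bijective ψ := by
    apply hinj.bijective_of_nat_card_le
    simp only [Nat.card_eq_fintype_card, Fintype.card_prod, ZMod.card, Fintype.card_pi, Finset.prod_const,
      Finset.card_univ, Fintype.card_fin]
    exact Nat.pow_le_pow_right (by norm_num) hr
  obtain ⟨⟨a, b⟩, hab⟩ := hb.2 (φ u)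
  obtain ⟨a, rfl⟩ := ZMod.intCast_surjective a
  obtain ⟨b, rfl⟩ := ZMod.intCast_surjective b
  have h0 : φ (u * Q.e ^ (-a) * Q.h ^ (-b)) = 0 := by
    rw [φm, φm, φz, φz, ← hab]
    simp only [ψ, cast, neg_smul]
    abel
  obtain ⟨c, hc⟩ := φk _ h0
  refine ⟨a, b, c, ?_⟩
  rw [← hc, zpow_neg, zpow_neg]
  simp [mul_comm, mul_left_comm, mul_assoc]
end QD
end

open NumberField Module
open scoped Matrix
section

theorem cube_of_val {R : Type*} [CommRing R] [IsDomain R] [UniqueFactorizationMonoid R] (a : R) :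
    a ≠ 0 → (∀ p : R, Prime p → ∃ k : ℕ, emultiplicity p a = ((3 * k : ℕ) : ℕ∞)) →
    ∃ (u : Rˣ) (b : R), a = u * b ^ 3 := by
  induction a using (IsWellFounded.wf (α := R) (r := DvdNotUnit)).induction with
  | h a ih =>
  intro ha hv
  by_cases hu : IsUnit a
  · obtain ⟨u, rfl⟩ := hu
    exact ⟨u, 1, by simp⟩
  obtain ⟨p, hp, hpa⟩ := WfDvdMonoid.exists_irreducible_factor hu ha
  have hp' : Prime p := UniqueFactorizationMonoid.irreducible_iff_prime.mp hp
  obtain ⟨k, hk⟩ := hv p hp'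
  have hk0 : k ≠ 0 := by
    rintro rfl
    simp only [mul_zero, Nat.cast_zero] at hk
    exact emultiplicity_eq_zero.mp hk hpa
  have h3 : p ^ 3 ∣ a := by
    apply pow_dvd_of_le_emultiplicity
    rw [hk]
    exact_mod_cast (by omega : 3 ≤ 3 * k)
  obtain ⟨b, rfl⟩ := h3
  have hb : b ≠ 0 := right_ne_zero_of_mul ha
  obtain ⟨u, d, hd⟩ := ih b ⟨hb, p ^ 3, fun hu => hp.not_isUnit (isUnit_of_dvd_unit (dvd_pow_self p (by norm_num)) hu),
    mul_comm _ _⟩ hb (by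
    intro q hq
    obtain ⟨m, hm⟩ := hv q hq
    rw [emultiplicity_mul hq, emultiplicity_pow hq] at hm
    have f1 := (FiniteMultiplicity.of_prime_left hq hp.ne_zero).emultiplicity_eq_multiplicity
    have f2 := (FiniteMultiplicity.of_prime_left hq hb).emultiplicity_eq_multiplicity
    rw [f1, f2] at hm
    have hm' : 3 * multiplicity q p + multiplicity q b = 3 * m := by exact_mod_cast hm
    exact ⟨m - multiplicity q p, by rw [f2]; congr 1; omega⟩)
  exact ⟨u, p * d, by rw [hd]; ring⟩

theorem val_lt {R : Type*} [CommRing R] [IsDomain R] [UniqueFactorizationMonoid R] (P A A' X n D : R)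
    (hP : Prime P) (hA : A ≠ 0) (hA' : A' ≠ 0) (hX : X ≠ 0) (hn : n ≠ 0) (h1 : A * A' = X ^ 3)
    (h2 : A - A' = D * n * (X + n ^ 2)) (hD : ¬ P ∣ D) (hlt : emultiplicity P A < emultiplicity P A') :
    emultiplicity P A = ((3 * multiplicity P n : ℕ) : ℕ∞) := by
  have fA := (FiniteMultiplicity.of_prime_left hP hA).emultiplicity_eq_multiplicity
  have fA' := (FiniteMultiplicity.of_prime_left hP hA').emultiplicity_eq_multiplicity
  have fX := (FiniteMultiplicity.of_prime_left hP hX).emultiplicity_eq_multiplicity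
  have fn := (FiniteMultiplicity.of_prime_left hP hn).emultiplicity_eq_multiplicity
  have fD := emultiplicity_eq_zero.mpr hD
  have hs := congrArg (emultiplicity P) h1
  rw [emultiplicity_mul hP, emultiplicity_pow hP, fA, fA', fX] at hs
  have hd := congrArg (emultiplicity P) h2
  rw [← neg_sub, emultiplicity_neg, emultiplicity_sub_of_gt hlt, emultiplicity_mul hP, emultiplicity_mul hP, fD, zero_add, fA, fn] at hd
  have hsq : emultiplicity P (n ^ 2) = ((2 * multiplicity P n : ℕ) : ℕ∞) := by
    rw [emultiplicity_pow hP, fn]; push_cast; rfl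
  rw [fA, fA'] at hlt
  rw [fA]
  have hlt' : multiplicity P A < multiplicity P A' := by exact_mod_cast hlt
  have hs' : multiplicity P A + multiplicity P A' = 3 * multiplicity P X := by exact_mod_cast hs
  rcases lt_trichotomy (multiplicity P X) (2 * multiplicity P n) with h | h | h
  · have : emultiplicity P (X + n ^ 2) = multiplicity P X := by
      rw [add_comm, emultiplicity_add_of_gt, fX]
      rw [hsq, fX]; exact_mod_cast h
    rw [this] at hd
    have hd' : multiplicity P A = multiplicity P n + multiplicity P X := by exact_mod_cast hd
    omega
  · have := min_le_emultiplicity_add (p := P) (a := X) (b := n ^ 2)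
    rw [hsq, fX, h, min_self] at this
    have h4 : ((multiplicity P n + 2 * multiplicity P n : ℕ) : ℕ∞) ≤ multiplicity P A := by
      rw [hd, Nat.cast_add]; gcongr
    have h5 : multiplicity P n + 2 * multiplicity P n ≤ multiplicity P A := by exact_mod_cast h4
    omega
  · have : emultiplicity P (X + n ^ 2) = ((2 * multiplicity P n : ℕ) : ℕ∞) := by
      rw [emultiplicity_add_of_gt, hsq]
      rw [hsq, fX]; exact_mod_cast h
    rw [this] at hd
    rw [hd]
    norm_cast
    ring

theorem val_div {R : Type*} [CommRing R] [IsDomain R] [UniqueFactorizationMonoid R] (P A A' X n D : R)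
    (hP : Prime P) (hA : A ≠ 0) (hA' : A' ≠ 0) (hX : X ≠ 0) (hn : n ≠ 0) (h1 : A * A' = X ^ 3)
    (h2 : A - A' = D * n * (X + n ^ 2)) (hD : P ∣ D → emultiplicity P A = emultiplicity P A') :
    ∃ k : ℕ, emultiplicity P A = ((3 * k : ℕ) : ℕ∞) := by
  have fA := (FiniteMultiplicity.of_prime_left hP hA).emultiplicity_eq_multiplicity
  have fA' := (FiniteMultiplicity.of_prime_left hP hA').emultiplicity_eq_multiplicity
  have fX := (FiniteMultiplicity.of_prime_left hP hX).emultiplicity_eq_multiplicity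
  have hs := congrArg (emultiplicity P) h1
  rw [emultiplicity_mul hP, emultiplicity_pow hP, fA, fA', fX] at hs
  have hs' : multiplicity P A + multiplicity P A' = 3 * multiplicity P X := by exact_mod_cast hs
  rcases lt_trichotomy (emultiplicity P A) (emultiplicity P A') with h | h | h
  · have hD' : ¬ P ∣ D := fun hh => by rw [hD hh] at h; exact lt_irrefl _ h
    exact ⟨_, val_lt P A A' X n D hP hA hA' hX hn h1 h2 hD' h⟩
  · rw [fA, fA'] at h
    have h' : multiplicity P A = multiplicity P A' := by exact_mod_cast h
    exact ⟨multiplicity P A - multiplicity P X, by rw [fA]; congr 1; omega⟩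
  · have hD' : ¬ P ∣ -D := fun hh => by rw [hD ((dvd_neg).mp hh)] at h; exact lt_irrefl _ h
    have := val_lt P A' A X n (-D) hP hA' hA hX hn (by rw [← h1]; ring) (by linear_combination -h2) hD' h
    rw [fA'] at this
    have h' : multiplicity P A' = 3 * multiplicity P n := by exact_mod_cast this
    exact ⟨multiplicity P X - multiplicity P n, by rw [fA]; congr 1; omega⟩

variable {L : Type*} [Field L] [NumberField L]
namespace QD
variable (Q : QD L)

theorem n13 : Ideal.absNorm (Ideal.span {2 + Q.W + Q.R}) = 13 := by
  apply absN'
  have hw := Q.hw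
  have hr := Q.hr
  have h2 : algebraMap (𝓞 L) L 2 = 2 := map_ofNat _ 2
  rw [show ((2 + Q.W + Q.R : 𝓞 L) : L) = 2 + Q.w + Q.r by
      simp only [map_add, h2]; rfl,
    Q.norm_of _ ![![2,1,1,0],![3,3,0,1],![-2,-2,3,2],![-6,-4,6,5]]]
  · simp [Matrix.det_succ_row_zero, Fin.sum_univ_succ, Fin.succAbove]; norm_num
  · intro j; fin_cases j <;> simp [Q.el_eq, Q.h0, Q.h1, Q.h2, Q.h3] <;> grind

theorem prime_of_norm (y : 𝓞 L) (p : ℕ) (hp : p.Prime) (h : Ideal.absNorm (Ideal.span {y}) = p) : Prime y := by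
  refine Ideal.prime_of_irreducible_absNorm_span ?_ ?_
  · rintro rfl
    simp at h
    exact hp.ne_zero h.symm
  · rw [h]; exact hp

theorem cube (Q : QD L) (c : L ≃+* L) (cw : c Q.w = Q.w) (cr : c Q.r = 1 + Q.w - Q.r)
    (f : L →+* ℝ) (g : L →+* ℂ) (hg : ¬ ComplexEmbedding.IsReal g) (x α : L)
    (hα : α * c α = x ^ 3) (hx0 : x ≠ 0)
    (hd : α - c α = (1 - Q.w) * (x + 1) * (2 * Q.r - (1 + Q.w))) :
    ∃ (j : ℤ) (β : L), α = ((1 + Q.r) * (Q.w - 2)) ^ j * β ^ 3 := by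
  have := Q.pid
  let C : 𝓞 L ≃+* 𝓞 L := RingOfIntegers.mapRingEquiv c
  have hC : ∀ y : 𝓞 L, algebraMap (𝓞 L) L (C y) = c (algebraMap (𝓞 L) L y) := fun y => rfl
  have CW : C Q.W = Q.W := by apply RingOfIntegers.coe_injective; exact cw
  have CR : C Q.R = 1 + Q.W - Q.R := by apply RingOfIntegers.coe_injective; exact cr
  have hα0 : α ≠ 0 := by rintro rfl; rw [zero_mul] at hα; exact hx0 (pow_eq_zero_iff (by norm_num) |>.mp hα.symm)
  classical
  have hal : Algebra.IsAlgebraic ℤ L := (IsFractionRing.comap_isAlgebraic_iff (A := ℤ) (K := ℚ) (C := L)).mpr inferInstance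
  obtain ⟨n, hn, hint⟩ := Algebra.IsAlgebraic.exists_integral_multiples ℤ ({x, α} : Finset L)
  have ix := hint x (by simp)
  have iα := hint α (by simp)
  rw [zsmul_eq_mul] at ix iα
  have inn : IsIntegral ℤ (n : L) := isIntegral_algebraMap (R := ℤ) (A := L) (x := n)
  let X : 𝓞 L := ⟨n ^ 2 * x, by have := inn.mul ix; rwa [← mul_assoc, ← sq] at this⟩
  let A : 𝓞 L := ⟨n ^ 3 * α, by
    have := (inn.mul inn).mul iα
    have e : (n : L) * n * (n * α) = n ^ 3 * α := by ring
    rwa [e] at this⟩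
  have hnL : (n : L) ≠ 0 := by exact_mod_cast hn
  have eX : algebraMap (𝓞 L) L (X) = n ^ 2 * x := rfl
  have eA : algebraMap (𝓞 L) L (A) = n ^ 3 * α := rfl
  have eCA : algebraMap (𝓞 L) L (C A) = n ^ 3 * c α := by rw [hC, eA, map_mul, map_pow, map_intCast]
  have A0 : A ≠ 0 := by
    intro h; have := congrArg (algebraMap (𝓞 L) L) h; rw [eA, map_zero] at this
    exact mul_ne_zero (pow_ne_zero _ hnL) hα0 this
  have X0 : X ≠ 0 := by
    intro h; have := congrArg (algebraMap (𝓞 L) L) h; rw [eX, map_zero] at this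
    exact mul_ne_zero (pow_ne_zero _ hnL) hx0 this
  have n0 : (n : 𝓞 L) ≠ 0 := by exact_mod_cast hn
  have CA0 : C A ≠ 0 := (map_ne_zero_iff C C.injective).mpr A0
  have m1 : A * C A = X ^ 3 := by
    apply RingOfIntegers.coe_injective
    rw [map_mul, map_pow, eX, eCA, eA]
    linear_combination ((n:L)^6) * hα
  have l2 : algebraMap (𝓞 L) L 2 = 2 := map_ofNat _ 2
  have m2 : A - C A = ((1 - Q.W) * (2 * Q.R - (1 + Q.W))) * (n : 𝓞 L) * (X + (n : 𝓞 L) ^ 2) := by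
    apply RingOfIntegers.coe_injective
    simp only [map_mul, map_sub, map_add, map_pow, map_one, l2, eX, eCA, eA, map_intCast]
    change _ = ((1 - Q.w) * (2 * Q.r - (1 + Q.w))) * _ * _
    linear_combination ((n:L)^3) * hd
  have hW := Q.hW
  have hR := Q.hR
  have p3 := prime_of_norm _ 3 Nat.prime_three Q.n1R
  have p13 := prime_of_norm _ 13 (by norm_num) Q.n13
  -- the primes dividing the different are stable
  have st : ∀ P : 𝓞 L, Prime P → P ∣ ((1 - Q.W) * (2 * Q.R - (1 + Q.W))) →
      Associated P (C P) := by
    intro P hP hdv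
    have s3 : Associated (1 - Q.R) (C (1 - Q.R)) := by
      refine ⟨-Q.h, ?_⟩
      rw [map_sub, map_one, CR]
      simp only [Units.val_neg, h]
      grind
    have s13 : Associated (2 + Q.W + Q.R) (C (2 + Q.W + Q.R)) := by
      refine ⟨Q.h⁻¹, ?_⟩
      rw [map_add, map_add, CR, CW, map_ofNat]
      change (2 + Q.W + Q.R) * ((2 + Q.W - Q.R) * (Q.W - 2)) = _
      grind
    have e1 : ((1 - Q.W) * (2 * Q.R - (1 + Q.W))) =
        -(Q.W - 2) ^ 2 * ((1 + Q.R) * (Q.W - 2)) * ((1 - Q.R) ^ 3 * (2 + Q.W + Q.R)) := by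
      have hh : (1 - Q.W) = (Q.W - 2) * ((1 + Q.R) * (Q.W - 2)) * (1 - Q.R) ^ 2 := by
        grind
      have hh2 : (2 * Q.R - (1 + Q.W)) = -(Q.W - 2) * ((1 - Q.R) * (2 + Q.W + Q.R)) := by
        grind
      rw [hh2]
      conv_lhs => rw [hh]
      ring
    rw [e1] at hdv
    have hun : IsUnit (-(Q.W - 2) ^ 2 * ((1 + Q.R) * (Q.W - 2))) := by
      apply IsUnit.mul
      · exact ((Q.e⁻¹).isUnit.pow 2).neg
      · exact Q.h.isUnit
    rcases hP.dvd_or_dvd hdv with h1 | h1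
    · exact absurd (isUnit_of_dvd_unit h1 hun) hP.not_isUnit
    rcases hP.dvd_or_dvd h1 with h2 | h2
    · have as := hP.associated_of_dvd p3 (hP.dvd_of_dvd_pow h2)
      exact as.trans (s3.trans ((as.symm).map C))
    · have as := hP.associated_of_dvd p13 h2
      exact as.trans (s13.trans ((as.symm).map C))
  obtain ⟨u, b, hub⟩ := cube_of_val A A0 (by
    intro P hP
    refine val_div P A (C A) X n _ hP A0 CA0 X0 n0 m1 m2 ?_
    intro hdv
    rw [← emultiplicity_map_eq C, emultiplicity_eq_of_associated_left (st P hP hdv)])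
  obtain ⟨i, j, d, hu⟩ := Q.units f g hg u
  have ee : ∀ (v : (𝓞 L)ˣ) (m : ℤ), algebraMap (𝓞 L) L ((v ^ m : (𝓞 L)ˣ) : 𝓞 L) = (algebraMap (𝓞 L) L (v : 𝓞 L)) ^ m := by
    intro v m
    exact NumberField.Units.coe_zpow v m
  have eE : algebraMap (𝓞 L) L (Q.e : 𝓞 L) = 1 + Q.w := by
    change algebraMap (𝓞 L) L (1 + Q.W) = _
    rw [map_add, map_one]; rfl
  have eH : algebraMap (𝓞 L) L (Q.h : 𝓞 L) = (1 + Q.r) * (Q.w - 2) := by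
    change algebraMap (𝓞 L) L ((1 + Q.R) * (Q.W - 2)) = _
    rw [map_mul, map_add, map_one, map_sub, l2]; rfl
  have hA : α = (1 + Q.w) ^ i * ((1 + Q.r) * (Q.w - 2)) ^ j *
      (algebraMap (𝓞 L) L (d : 𝓞 L) * algebraMap (𝓞 L) L b / n) ^ 3 := by
    have := congrArg (algebraMap (𝓞 L) L) hub
    rw [eA, map_mul, map_pow, hu] at this
    simp only [Units.val_mul, Units.val_pow_eq_pow_val, map_mul, map_pow] at this
    rw [ee, ee, eE, eH] at this
    rw [div_pow, mul_pow]
    field_simp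
    linear_combination this
  generalize hβ : (algebraMap (𝓞 L) L (d : 𝓞 L) * algebraMap (𝓞 L) L b / n) = β at hA
  have hβ0 : β ≠ 0 := by rintro rfl; rw [hA] at hα0; simp at hα0
  have hww := Q.hw
  have hrr := Q.hr
  have he0 : (1 + Q.w) ≠ 0 := by
    intro h0
    have : (1 + Q.w) * (Q.w - 2) = 1 := by linear_combination hww
    rw [h0] at this; simp at this
  have hhi : ((1 + Q.r) * (Q.w - 2)) * ((2 + Q.w - Q.r) * (Q.w - 2)) = 1 := by
    linear_combination (-(Q.w-2)^2) * hrr + (3 * Q.w - 5) * hww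
  have hh0 : ((1 + Q.r) * (Q.w - 2)) ≠ 0 := left_ne_zero_of_mul_eq_one hhi
  have ce : c (1 + Q.w) = 1 + Q.w := by rw [map_add, map_one, cw]
  have ch : c ((1 + Q.r) * (Q.w - 2)) = ((1 + Q.r) * (Q.w - 2))⁻¹ := by
    rw [← eq_inv_of_mul_eq_one_right hhi, map_mul, map_sub, map_add, cw, cr, map_one, map_ofNat]
    ring
  have hcβ : c β ≠ 0 := (map_ne_zero_iff c c.injective).mpr hβ0
  have h6 : (1 + Q.w) ^ (2 * i) = (x / (β * c β)) ^ 3 := by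
    rw [hA, map_mul, map_mul, map_zpow₀, map_zpow₀, map_pow, ce, ch] at hα
    rw [div_pow, ← hα, two_mul, zpow_add₀ he0, inv_zpow, mul_pow]
    have := zpow_ne_zero j hh0
    generalize ((1 + Q.r) * (Q.w - 2)) ^ j = t at *
    generalize (1 + Q.w) ^ i = t at *
    field_simp
  have iy : IsIntegral ℤ (x / (β * c β)) := by
    apply IsIntegral.of_pow (n := 3) (by norm_num)
    rw [← h6, ← eE, ← ee]
    exact RingOfIntegers.isIntegral_coe _
  let y : 𝓞 L := ⟨_, iy⟩
  have hy : y ^ 3 = ((Q.e ^ (2 * i) : (𝓞 L)ˣ) : 𝓞 L) := by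
    apply RingOfIntegers.coe_injective
    rw [map_pow]
    change (x / (β * c β)) ^ 3 = _
    rw [← h6, ee, eE]
  have hyu : IsUnit y := by
    have : IsUnit (y ^ 3) := by rw [hy]; exact Units.isUnit _
    exact (isUnit_pow_iff (by norm_num)).mp this
  obtain ⟨yu, hyu⟩ := hyu
  have h7 := (Q.indep yu (2 * i) 0 (by ext1; rw [zpow_zero, mul_one, Units.val_pow_eq_pow_val, hyu, hy])).1
  obtain ⟨k, hk⟩ : (3 : ℤ) ∣ i := by omega
  refine ⟨j, (1 + Q.w) ^ k * β, ?_⟩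
  rw [hA, hk, mul_pow, mul_comm 3 k, zpow_mul]
  norm_cast
  ring
end QD
end

open Polynomial
instance fact3 : Fact (Nat.Prime 3) := ⟨by norm_num⟩
instance fact17 : Fact (Nat.Prime 17) := ⟨by norm_num⟩
section

theorem ae3 {p : ℕ} [Fact p.Prime] (z : ℤ_[p]) : aeval z (3 : ℤ[X]) = 3 := map_ofNat (aeval z) 3
theorem ae2 {p : ℕ} [Fact p.Prime] (z : ℤ_[p]) : aeval z (2 : ℤ[X]) = 2 := map_ofNat (aeval z) 2

theorem hens3 : ∃ t : ℤ_[3], 3 * t ^ 2 = t + 1 := by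
  have h := hensels_lemma (p := 3) (R := ℤ) (F := (X ^ 2 - X - C 3 : ℤ[X])) (a := (0 : ℤ_[3])) (by
    have e1 : aeval (0 : ℤ_[3]) (derivative (X ^ 2 - X - C 3 : ℤ[X])) = -1 := by simp
    have e2 : aeval (0 : ℤ_[3]) (X ^ 2 - X - C 3 : ℤ[X]) = -3 := by simp [ae3]
    rw [e1, e2]
    simp
    have := PadicInt.norm_p (p := 3)
    push_cast at this
    rw [this]
    norm_num)
  obtain ⟨z, hz, hz2, -⟩ := h
  have e3 : z ^ 2 - z - 3 = 0 := by simpa [ae3] using hz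
  have e4 : ‖z‖ < 1 := by simpa using hz2
  rw [PadicInt.norm_lt_one_iff_dvd] at e4
  obtain ⟨t, rfl⟩ := e4
  refine ⟨t, ?_⟩
  push_cast at e3
  have h0 : (3 : ℤ_[3]) * (3 * t ^ 2 - t - 1) = 0 := by linear_combination e3
  rcases mul_eq_zero.mp h0 with h | h
  · exact absurd h (by norm_num)
  · linear_combination h

theorem hens17 : ∃ z : ℤ_[17], z ^ 2 = z + 3 ∧ PadicInt.toZMod z = 5 := by
  have h := hensels_lemma (p := 17) (R := ℤ) (F := (X ^ 2 - X - C 3 : ℤ[X])) (a := (5 : ℤ_[17])) (by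
    have e1 : aeval (5 : ℤ_[17]) (derivative (X ^ 2 - X - C 3 : ℤ[X])) = 9 := by simp [ae2]; norm_num
    have e2 : aeval (5 : ℤ_[17]) (X ^ 2 - X - C 3 : ℤ[X]) = 17 := by simp [ae3]; norm_num
    rw [e1, e2]
    have h9 : ‖(9 : ℤ_[17])‖ = 1 := by
      have := PadicInt.norm_int_lt_one_iff_dvd (p := 17) 9
      have h1 : ¬ ‖((9 : ℤ) : ℤ_[17])‖ < 1 := by rw [this]; norm_num
      push_cast at h1
      exact le_antisymm (PadicInt.norm_le_one _) (not_lt.mp h1)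
    have := PadicInt.norm_p (p := 17)
    push_cast at this
    rw [this, h9]
    norm_num)
  obtain ⟨z, hz, hz2, -⟩ := h
  have e3 : z ^ 2 - z - 3 = 0 := by simpa [ae3] using hz
  refine ⟨z, by linear_combination e3, ?_⟩
  have e4 : ‖z - 5‖ < 1 := lt_of_lt_of_le hz2 (PadicInt.norm_le_one _)
  have : z - 5 ∈ RingHom.ker (PadicInt.toZMod (p := 17)) := by
    rw [PadicInt.ker_toZMod]
    exact PadicInt.mem_nonunits.mpr e4
  have h2 := (RingHom.mem_ker).mp this
  rw [map_sub, map_ofNat] at h2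
  exact sub_eq_zero.mp h2

theorem n3 : ‖(3 : ℚ_[3])‖ = 1 / 3 := by
  have := Padic.norm_p (p := 3)
  push_cast at this
  rw [this]; norm_num

theorem nun (u : ℤ_[3]) (h : PadicInt.toZMod u ≠ 0) : ‖(u : ℚ_[3])‖ = 1 := by
  by_contra hne
  apply h
  have h1 : ‖u‖ < 1 := lt_of_le_of_ne (PadicInt.norm_le_one u) hne
  have : u ∈ RingHom.ker (PadicInt.toZMod (p := 3)) := by
    rw [PadicInt.ker_toZMod]
    exact PadicInt.mem_nonunits.mpr h1
  exact this

theorem t3 (t : ℤ_[3]) (ht : 3 * t ^ 2 = t + 1) : PadicInt.toZMod t = 2 := by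
  have := congrArg (PadicInt.toZMod (p := 3)) ht
  simp only [map_mul, map_pow, map_add, map_one, map_ofNat] at this
  revert this
  generalize PadicInt.toZMod t = y
  revert y
  decide

theorem nimage (x : ℚ_[3]) (h : x ≠ 0) : ∃ m : ℤ, ‖x‖ = ((3 : ℕ) : ℝ) ^ (-m) :=
  ⟨x.valuation, Padic.norm_eq_zpow_neg_valuation h⟩

theorem gap (x : ℚ_[3]) (m : ℤ) (h : ‖x‖ < (3 : ℝ) ^ m) : ‖x‖ ≤ (3 : ℝ) ^ (m - 1) := by
  have := (Padic.norm_le_pow_iff_norm_lt_pow_add_one x (m - 1)).mpr (by push_cast; simpa using h)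
  exact_mod_cast this

theorem gapxy (x y : ℚ_[3]) (h : ‖x‖ < ‖y‖) : ‖x‖ ≤ ‖y‖ / 3 := by
  have hy : y ≠ 0 := by rintro rfl; simp at h; linarith [norm_nonneg x]
  obtain ⟨m, hm⟩ := nimage _ hy
  rw [hm] at h ⊢
  push_cast at h ⊢
  have := gap x (-m) h
  rwa [zpow_sub_one₀ (by norm_num), ← div_eq_mul_inv] at this

theorem nadd (x y : ℚ_[3]) (h : ‖y‖ < ‖x‖) : ‖x + y‖ = ‖x‖ := by
  rw [Padic.add_eq_max_of_ne h.ne', max_eq_left h.le]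

theorem nadd_le (x y : ℚ_[3]) (m : ℝ) (h1 : ‖x‖ ≤ m) (h2 : ‖y‖ ≤ m) : ‖x + y‖ ≤ m :=
  (Padic.nonarchimedean x y).trans (max_le h1 h2)

/-- an element of norm `≤ 1` is an integer -/
theorem toInt (x : ℚ_[3]) (h : ‖x‖ ≤ 1) : ∃ y : ℤ_[3], (y : ℚ_[3]) = x := ⟨⟨x, h⟩, rfl⟩

theorem sq_norm_ne (x y : ℚ_[3]) (h : ‖x ^ 2‖ = ‖y ^ 2‖ / 3) (hy : y ≠ 0) : False := by
  have hx : x ≠ 0 := by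
    rintro rfl
    have := norm_pos_iff.mpr (pow_ne_zero 2 hy)
    rw [zero_pow (by norm_num), norm_zero] at h
    linarith
  obtain ⟨m, hm⟩ := nimage _ hx
  obtain ⟨n, hn⟩ := nimage _ hy
  rw [norm_pow, norm_pow, hm, hn] at h
  push_cast at h
  rw [← zpow_natCast, ← zpow_natCast, ← zpow_mul, ← zpow_mul, div_eq_mul_inv, ← zpow_sub_one₀ (by norm_num)] at h
  have := zpow_right_injective₀ (by norm_num : (0:ℝ) < 3) (by norm_num) h
  push_cast at this
  omega
end

section
@[simp, norm_cast] theorem cst2 : ((2 : ℤ_[3]) : ℚ_[3]) = 2 := rfl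
@[simp, norm_cast] theorem cst3 : ((3 : ℤ_[3]) : ℚ_[3]) = 3 := rfl
@[simp, norm_cast] theorem cst4 : ((4 : ℤ_[3]) : ℚ_[3]) = 4 := rfl
@[simp, norm_cast] theorem cst5 : ((5 : ℤ_[3]) : ℚ_[3]) = 5 := rfl
@[simp, norm_cast] theorem cst9 : ((9 : ℤ_[3]) : ℚ_[3]) = 9 := rfl
@[simp, norm_cast] theorem cst11 : ((11 : ℤ_[3]) : ℚ_[3]) = 11 := rfl
@[simp, norm_cast] theorem cst12 : ((12 : ℤ_[3]) : ℚ_[3]) = 12 := rfl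
@[simp, norm_cast] theorem cst13 : ((13 : ℤ_[3]) : ℚ_[3]) = 13 := rfl
@[simp, norm_cast] theorem cst27 : ((27 : ℤ_[3]) : ℚ_[3]) = 27 := rfl
@[simp, norm_cast] theorem cst28 : ((28 : ℤ_[3]) : ℚ_[3]) = 28 := rfl
@[simp, norm_cast] theorem cst33 : ((33 : ℤ_[3]) : ℚ_[3]) = 33 := rfl

/-- unit criterion -/
theorem nun' (a : ℚ_[3]) (u : ℤ_[3]) (e : (u : ℚ_[3]) = a) (h : PadicInt.toZMod u ≠ 0) : ‖a‖ = 1 := by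
  rw [← e]; exact nun u h

theorem nint (u : ℤ_[3]) : ‖(u : ℚ_[3])‖ ≤ 1 := u.norm_le_one

theorem n4 : ‖(4 : ℚ_[3])‖ = 1 :=
  nun' 4 4 (by norm_cast) (by rw [map_ofNat]; decide)

theorem n2 : ‖(2 : ℚ_[3])‖ = 1 :=
  nun' 2 2 (by norm_cast) (by rw [map_ofNat]; decide)

theorem zdvd (u : ℤ_[3]) (h : PadicInt.toZMod u = 0) : ∃ v : ℤ_[3], u = 3 * v := by
  have : u ∈ RingHom.ker (PadicInt.toZMod (p := 3)) := h
  rw [PadicInt.ker_toZMod, PadicInt.maximalIdeal_eq_span_p, Ideal.mem_span_singleton] at this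
  obtain ⟨v, hv⟩ := this
  exact ⟨v, by simpa using hv⟩

theorem sqle (V : ℚ_[3]) (h : ‖V ^ 2‖ ≤ 1) : ‖V‖ ≤ 1 := by
  rw [norm_pow] at h
  exact (sq_le_one_iff₀ (norm_nonneg _)).mp h

theorem intpt (t : ℤ_[3]) (ht : 3 * t ^ 2 = t + 1) (x V : ℚ_[3])
    (h : V ^ 2 = 4 * x ^ 3 + (-1 - 33 * (t : ℚ_[3])) * (x + 1) ^ 2) (hx : ‖x‖ ≤ 1) :
    ∃ X Z : ℤ_[3], x = 1 + 3 * (X : ℚ_[3]) ∧ V = 3 * (Z : ℚ_[3]) := by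
  obtain ⟨y, rfl⟩ := toInt x hx
  have hV : ‖V‖ ≤ 1 := by
    apply sqle
    rw [h]
    have := nint (4 * y ^ 3 + (-1 - 33 * t) * (y + 1) ^ 2)
    push_cast at this
    exact this
  obtain ⟨v, rfl⟩ := toInt V hV
  have h' : v ^ 2 = 4 * y ^ 3 + (-1 - 33 * t) * (y + 1) ^ 2 := by
    apply PadicInt.ext
    push_cast
    exact h
  have h3 := congrArg (PadicInt.toZMod (p := 3)) h'
  simp only [map_mul, map_pow, map_add, map_sub, map_neg, map_one, map_ofNat, t3 t ht] at h3
  have key : ∀ a b : ZMod 3, b ^ 2 = 4 * a ^ 3 + (-1 - 33 * 2) * (a + 1) ^ 2 → a = 1 ∧ b = 0 := by decide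
  obtain ⟨ha, hb⟩ := key _ _ h3
  obtain ⟨Z, hZ⟩ := zdvd v hb
  obtain ⟨X, hX⟩ := zdvd (y - 1) (by rw [map_sub, ha, map_one, sub_self])
  refine ⟨X, Z, ?_, ?_⟩
  · have : y = 1 + 3 * X := by linear_combination hX
    rw [this]; push_cast; ring
  · rw [hZ]; push_cast; ring

theorem D1 (t : ℤ_[3]) (ht : 3 * t ^ 2 = t + 1) (x V : ℚ_[3])
    (h : V ^ 2 = 4 * x ^ 3 + (-1 - 33 * (t : ℚ_[3])) * (x + 1) ^ 2) (hx : ‖x‖ ≤ 1) (hV : V ≠ 0) :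
    1 < ‖(((12 * x ^ 2 + 2 * (-1 - 33 * (t : ℚ_[3])) * (x + 1)) / (2 * V)) ^ 2
      - (-1 - 33 * (t : ℚ_[3]))) / 4 - 2 * x‖ := by
  obtain ⟨X, Z, hX, hZ⟩ := intpt t ht x V h hx
  set D : ℚ_[3] := -1 - 33 * (t : ℚ_[3]) with hD
  have hu : ‖12 * x ^ 2 + 2 * D * (x + 1)‖ = 1 := by
    apply nun' _ (12 * (1 + 3 * X) ^ 2 + 2 * (-1 - 33 * t) * (1 + 3 * X + 1))
    · rw [hX, hD]; push_cast; ring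
    · simp only [map_mul, map_pow, map_add, map_sub, map_neg, map_one, map_ofNat, t3 t ht]
      generalize PadicInt.toZMod X = a
      revert a; decide
  have hV3 : ‖V‖ ≤ 1 / 3 := by
    rw [hZ, norm_mul, n3]; nlinarith [nint Z]
  have hVp : 0 < ‖V‖ := norm_pos_iff.mpr hV
  set m := (12 * x ^ 2 + 2 * D * (x + 1)) / (2 * V) with hm
  have hmn : 3 ≤ ‖m‖ := by
    rw [hm, norm_div, norm_mul, hu, n2, one_mul, le_div_iff₀ hVp]; linarith
  have hs : ‖D / 4 + 2 * x‖ ≤ 1 := by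
    apply nadd_le
    · rw [norm_div, n4, div_one, hD]
      have := nint (-1 - 33 * t)
      push_cast at this
      exact this
    · rw [norm_mul, n2, one_mul]; exact hx
  have hbig : 9 ≤ ‖m ^ 2 / 4‖ := by
    rw [norm_div, n4, norm_pow]; nlinarith
  have : (m ^ 2 - D) / 4 - 2 * x = m ^ 2 / 4 + -(D / 4 + 2 * x) := by ring
  rw [this, nadd _ _ (by rw [norm_neg]; linarith)]
  linarith

theorem D2 (t : ℤ_[3]) (ht : 3 * t ^ 2 = t + 1) (x y V : ℚ_[3]) (hy : y ≠ 0)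
    (h : V ^ 2 = 4 * y ^ 3 + (-12 + 33 * (t : ℚ_[3])) * (y + 1) ^ 2)
    (hx : 81 * x * y ^ 2 = 27 * y ^ 3 + (1 + 33 * (t : ℚ_[3])) * (y + 3) ^ 3) (h1 : 1 < ‖x‖) :
    1 ≤ ‖y‖ ∧ ‖x‖ = 81 * ‖y‖ := by
  have hyp : 0 < ‖y‖ := norm_pos_iff.mpr hy
  have hc0 : ‖1 + 33 * (t : ℚ_[3])‖ = 1 := by
    apply nun' _ (1 + 33 * t) (by push_cast; ring)
    simp only [map_mul, map_add, map_one, map_ofNat, t3 t ht]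
    decide
  have n27 : ‖(27 : ℚ_[3])‖ = 1 / 27 := by
    rw [show (27 : ℚ_[3]) = 3 ^ 3 by norm_num, norm_pow, n3]; norm_num
  have n81 : ‖(81 : ℚ_[3])‖ = 1 / 81 := by
    rw [show (81 : ℚ_[3]) = 3 ^ 4 by norm_num, norm_pow, n3]; norm_num
  obtain ⟨s, hs⟩ : ∃ s : ℤ_[3], 9 * s = t - 2 := by
    obtain ⟨a, ha⟩ := zdvd (t - 2) (by rw [map_sub, t3 t ht, map_ofNat, sub_self])
    obtain ⟨b, hb⟩ : ∃ b : ℤ_[3], a = 3 * b := by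
      apply zdvd
      have e : t = 2 + 3 * a := by linear_combination ha
      have e2 : (3 : ℤ_[3]) * (a - 3 * (1 + 4 * a + 3 * a ^ 2)) = 0 := by
        rw [e] at ht; linear_combination -ht
      rcases mul_eq_zero.mp e2 with h | h
      · exact absurd h (by norm_num)
      · have : a = 3 * (1 + 4 * a + 3 * a ^ 2) := by linear_combination h
        rw [this, map_mul, map_ofNat]
        exact zero_mul _
    exact ⟨b, by rw [ha, hb]; ring⟩
  have hs' : (t : ℚ_[3]) = 2 + 9 * s := by
    have : t = 2 + 9 * s := by linear_combination -hs
    rw [this]; push_cast; ring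
  -- D^c = 27 * (2 + 11 s)
  have hd : PadicInt.toZMod (2 + 11 * s) = 1 := by
    have e : t = 2 + 9 * s := by linear_combination -hs
    have e2 : (9 : ℤ_[3]) * (1 + 11 * s + 27 * s ^ 2) = 0 := by
      rw [e] at ht; linear_combination ht
    rcases mul_eq_zero.mp e2 with h | h
    · exact absurd h (by norm_num)
    · have h3 := congrArg (PadicInt.toZMod (p := 3)) h
      simp only [map_mul, map_pow, map_add, map_one, map_ofNat, map_zero] at h3 ⊢
      revert h3
      generalize PadicInt.toZMod s = a
      revert a; decide
  have hdn : ‖(2 + 11 * s : ℚ_[3])‖ = 1 := by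
    apply nun' _ (2 + 11 * s) (by push_cast; ring)
    rw [hd]; decide
  have hVV : V ^ 2 = 4 * y ^ 3 + 27 * (2 + 11 * s) * (y + 1) ^ 2 := by
    rw [h, hs']; ring
  rcases le_or_gt 1 ‖y‖ with hy1 | hy1
  · refine ⟨hy1, ?_⟩
    have e1 : ‖y + 3‖ = ‖y‖ := nadd _ _ (by rw [n3]; linarith)
    have e2 : ‖(1 + 33 * (t : ℚ_[3])) * (y + 3) ^ 3‖ = ‖y‖ ^ 3 := by
      rw [norm_mul, hc0, norm_pow, e1, one_mul]
    have e3 : ‖27 * y ^ 3 + (1 + 33 * (t : ℚ_[3])) * (y + 3) ^ 3‖ = ‖y‖ ^ 3 := by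
      rw [add_comm, nadd, e2]
      rw [e2, norm_mul, n27, norm_pow]
      have : 0 < ‖y‖ ^ 3 := by positivity
      linarith
    rw [← hx, norm_mul, norm_mul, n81, norm_pow] at e3
    have : ‖y‖ ^ 2 * (‖x‖ - 81 * ‖y‖) = 0 := by linear_combination 81 * e3
    rcases mul_eq_zero.mp this with h | h
    · exact absurd h (by positivity)
    · linarith
  · exfalso
    have hy3 : ‖y‖ ≤ 1 / 3 := by
      have := gapxy y 1 (by rwa [norm_one])
      rwa [norm_one] at this
    have hbad : ‖V ^ 2‖ ≠ 1 / 27 := fun hh => sq_norm_ne V 3 (by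
      rw [hh, norm_pow, n3]; norm_num) (by norm_num)
    rcases eq_or_lt_of_le hy3 with h3 | h3
    · obtain ⟨z, hz⟩ := toInt (y / 3) (by rw [norm_div, n3, h3]; norm_num)
      have hyz : y = 3 * z := by rw [hz]; ring
      have hzn : ‖(z : ℚ_[3])‖ = 1 := by rw [hz, norm_div, n3, h3]; norm_num
      have hin : V ^ 2 = 27 * ((4 * z ^ 3 + (2 + 11 * s) * (3 * z + 1) ^ 2 : ℤ_[3]) : ℚ_[3]) := by
        rw [hVV, hyz]; push_cast; ring
      have hz0 : PadicInt.toZMod (4 * z ^ 3 + (2 + 11 * s) * (3 * z + 1) ^ 2) = 0 := by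
        by_contra hne
        apply hbad
        rw [hin, norm_mul, n27, nun _ hne, mul_one]
      simp only [map_mul, map_pow, map_add, map_one, map_ofNat] at hz0 hd
      rw [hd] at hz0
      obtain ⟨k, hk⟩ := zdvd (z + 1) (by
        rw [map_add, map_one]
        revert hz0
        generalize PadicInt.toZMod z = a
        revert a; decide)
      have hkz : (z : ℚ_[3]) = 3 * k - 1 := by
        have : z = 3 * k - 1 := by linear_combination hk
        rw [this]; push_cast; ring
      have hxz : x * (z : ℚ_[3]) ^ 2 = ((z ^ 3 + (1 + 33 * t) * k ^ 3 : ℤ_[3]) : ℚ_[3]) := by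
        have e : (z : ℚ_[3]) + 1 = 3 * k := by rw [hkz]; ring
        have : (729 : ℚ_[3]) * (x * (z : ℚ_[3]) ^ 2 - ((z ^ 3 + (1 + 33 * t) * k ^ 3 : ℤ_[3]) : ℚ_[3])) = 0 := by
          push_cast
          rw [hyz] at hx
          have e3 : ((z : ℚ_[3]) + 1) ^ 3 = 27 * k ^ 3 := by rw [e]; ring
          linear_combination hx + 27 * (1 + 33 * (t : ℚ_[3])) * e3
        rcases mul_eq_zero.mp this with h | h
        · exact absurd h (by norm_num)
        · exact sub_eq_zero.mp h
      have := congrArg norm hxz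
      rw [norm_mul, norm_pow, hzn] at this
      have h5 := nint (z ^ 3 + (1 + 33 * t) * k ^ 3)
      rw [← this] at h5
      linarith
    · have hy9 : ‖y‖ ≤ 1 / 9 := by
        have := gapxy y 3 (by rwa [n3])
        rw [n3] at this; linarith
      apply hbad
      have e1 : ‖y + 1‖ = 1 := by
        rw [add_comm, nadd, norm_one]; rw [norm_one]; linarith
      have e2 : ‖27 * (2 + 11 * (s : ℚ_[3])) * (y + 1) ^ 2‖ = 1 / 27 := by
        rw [norm_mul, norm_mul, norm_pow, e1, hdn, n27]; norm_num
      rw [hVV, add_comm, nadd, e2]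
      rw [e2, norm_mul, n4, norm_pow, one_mul]
      calc ‖y‖ ^ 3 ≤ (1 / 9) ^ 3 := by gcongr
        _ < 1 / 27 := by norm_num

theorem D3 (t : ℤ_[3]) (ht : 3 * t ^ 2 = t + 1) (x y V C : ℚ_[3])
    (hC : C * (-1 - 33 * (t : ℚ_[3])) = 13) (hC1 : (C + 1) * (28 + 33 * (t : ℚ_[3])) = 27)
    (h : V ^ 2 = 4 * y ^ 3 + (-1 - 33 * (t : ℚ_[3])) * (y + 1) ^ 2) (hy : y ≠ 0)
    (hx : 3 * x * y ^ 2 = (C + 1) * y ^ 3 + 9 * C * y ^ 2 + 27 * C * y + 27 * C) (h1 : 1 ≤ ‖x‖) :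
    1 < ‖y‖ ∧ ‖x‖ = ‖y‖ / 9 := by
  have hyp : 0 < ‖y‖ := norm_pos_iff.mpr hy
  have n27 : ‖(27 : ℚ_[3])‖ = 1 / 27 := by
    rw [show (27 : ℚ_[3]) = 3 ^ 3 by norm_num, norm_pow, n3]; norm_num
  have n9 : ‖(9 : ℚ_[3])‖ = 1 / 9 := by
    rw [show (9 : ℚ_[3]) = 3 ^ 2 by norm_num, norm_pow, n3]; norm_num
  have hDn : ‖-1 - 33 * (t : ℚ_[3])‖ = 1 := by
    apply nun' _ (-1 - 33 * t) (by push_cast; ring)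
    simp only [map_mul, map_sub, map_neg, map_one, map_ofNat, t3 t ht]
    decide
  have hCn : ‖C‖ = 1 := by
    have := congrArg norm hC
    rw [norm_mul, hDn, mul_one] at this
    rw [this]
    exact nun' _ 13 (by norm_cast) (by rw [map_ofNat]; decide)
  have hC1n : ‖C + 1‖ = 1 / 27 := by
    have := congrArg norm hC1
    rw [norm_mul, n27, show ‖28 + 33 * (t : ℚ_[3])‖ = 1 from by
      apply nun' _ (28 + 33 * t) (by push_cast; ring)
      simp only [map_mul, map_add, map_ofNat, t3 t ht]
      decide] at this
    linarith
  rcases le_or_gt ‖y‖ 1 with hy1 | hy1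
  · exfalso
    obtain ⟨X, Z, hX, -⟩ := intpt t ht y V h hy1
    have hyn : ‖y‖ = 1 := by
      apply nun' _ (1 + 3 * X) (by rw [hX]; push_cast; ring)
      simp only [map_mul, map_add, map_ofNat, map_one]
      generalize PadicInt.toZMod X = a
      revert a; decide
    have e1 : ‖(C + 1) * y ^ 3 + 9 * C * y ^ 2 + 27 * C * y + 27 * C‖ ≤ 1 / 9 := by
      apply nadd_le
      · apply nadd_le
        · apply nadd_le
          · rw [norm_mul, hC1n, norm_pow, hyn]; norm_num
          · rw [norm_mul, norm_mul, norm_pow, hyn, hCn, n9]; norm_num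
        · rw [norm_mul, norm_mul, hyn, hCn, n27]; norm_num
      · rw [norm_mul, hCn, n27]; norm_num
    rw [← hx, norm_mul, norm_mul, norm_pow, hyn, n3] at e1
    linarith
  · refine ⟨hy1, ?_⟩
    have hy3 : 3 ≤ ‖y‖ := by
      have := gapxy 1 y (by rwa [norm_one])
      rw [norm_one] at this; linarith
    have hyne : ‖y‖ ≠ 3 := by
      intro h3
      refine sq_norm_ne V (1 / 9) ?_ (by norm_num)
      have e0 : ‖y + 1‖ = 3 := by rw [nadd, h3]; rw [h3, norm_one]; norm_num
      rw [h, nadd, norm_mul, norm_pow, norm_pow, n4, h3, norm_div, norm_one, n9]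
      · norm_num
      · rw [norm_mul, norm_mul, hDn, norm_pow, e0, n4, norm_pow, h3]; norm_num
    have hy9 : 9 ≤ ‖y‖ := by
      have n13 : ‖(1 / 3 : ℚ_[3])‖ = 3 := by rw [norm_div, norm_one, n3]; norm_num
      have := gapxy (1 / 3) y (by rw [n13]; exact lt_of_le_of_ne hy3 (Ne.symm hyne))
      rw [n13] at this; linarith
    have e0 : ‖(C + 1) * y ^ 3‖ = ‖y‖ ^ 3 / 27 := by
      rw [norm_mul, hC1n, norm_pow]; ring
    have e1 : ‖9 * C * y ^ 2 + 27 * C * y + 27 * C‖ ≤ ‖y‖ ^ 2 / 9 := by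
      apply nadd_le
      · apply nadd_le
        · rw [norm_mul, norm_mul, norm_pow, hCn, n9]; apply le_of_eq; ring
        · rw [norm_mul, norm_mul, hCn, n27]; nlinarith
      · rw [norm_mul, hCn, n27]; nlinarith
    have e2 : ‖(C + 1) * y ^ 3 + (9 * C * y ^ 2 + 27 * C * y + 27 * C)‖ = ‖y‖ ^ 3 / 27 := by
      rw [nadd, e0]
      rw [e0]
      have : 9 * ‖y‖ ^ 2 ≤ ‖y‖ * ‖y‖ ^ 2 := by gcongr
      have h2 : 0 < ‖y‖ ^ 2 := by positivity
      nlinarith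
    rw [← add_assoc, ← add_assoc, ← hx, norm_mul, norm_mul, norm_pow, n3] at e2
    have : ‖y‖ ^ 2 * (‖x‖ - ‖y‖ / 9) = 0 := by linear_combination 3 * e2
    rcases mul_eq_zero.mp this with h | h
    · exact absurd h (by positivity)
    · linarith

theorem eta (t : ℤ_[3]) (ht : 3 * t ^ 2 = t + 1) (τ q : ℚ_[3])
    (h : τ ^ 3 + 3 * (4 - 3 * (t : ℚ_[3])) * τ ^ 2 * q + 9 * (5 * (t : ℚ_[3]) - 3) * τ * q ^ 2
      + 3 * (4 - 3 * (t : ℚ_[3])) * (5 * (t : ℚ_[3]) - 3) * q ^ 3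
      = 6 * (2 - 3 * (t : ℚ_[3])) * t * (τ ^ 2 - 3 * (5 * (t : ℚ_[3]) - 3) * q ^ 2 + 4)) : False := by
  have hu : ‖4 - 3 * (t : ℚ_[3])‖ = 1 := by
    apply nun' _ (4 - 3 * t) (by push_cast; ring)
    simp only [map_mul, map_sub, map_ofNat, t3 t ht]
    decide
  have he : ‖5 * (t : ℚ_[3]) - 3‖ = 1 := by
    apply nun' _ (5 * t - 3) (by push_cast; ring)
    simp only [map_mul, map_sub, map_ofNat, t3 t ht]
    decide
  have hr : ‖2 * ((2 - 3 * (t : ℚ_[3])) * t)‖ = 1 := by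
    apply nun' _ (2 * ((2 - 3 * t) * t)) (by push_cast; ring)
    simp only [map_mul, map_sub, map_ofNat, t3 t ht]
    decide
  have n9 : ‖(9 : ℚ_[3])‖ = 1 / 9 := by
    rw [show (9 : ℚ_[3]) = 3 ^ 2 by norm_num, norm_pow, n3]; norm_num
  set u := 4 - 3 * (t : ℚ_[3]) with hudef
  set e := 5 * (t : ℚ_[3]) - 3 with hedef
  have hR : ‖6 * (2 - 3 * (t : ℚ_[3])) * t * (τ ^ 2 - 3 * e * q ^ 2 + 4)‖
      = ‖τ ^ 2 - 3 * e * q ^ 2 + 4‖ / 3 := by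
    rw [show 6 * (2 - 3 * (t : ℚ_[3])) * t * (τ ^ 2 - 3 * e * q ^ 2 + 4)
      = 3 * (2 * ((2 - 3 * (t : ℚ_[3])) * t)) * (τ ^ 2 - 3 * e * q ^ 2 + 4) by ring,
      norm_mul, norm_mul, n3, hr]; ring
  have hA := norm_nonneg τ
  have hB := norm_nonneg q
  have s1 : ‖τ ^ 2‖ = ‖τ‖ ^ 2 := norm_pow _ _
  have s2 : ‖-(3 * e * q ^ 2)‖ = ‖q‖ ^ 2 / 3 := by
    rw [norm_neg, norm_mul, norm_mul, norm_pow, n3, he]; ring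
  rcases le_or_gt ‖q‖ ‖τ‖ with hle | hlt
  · by_cases hτ : τ = 0
    · have hq : q = 0 := by
        rw [hτ, norm_zero] at hle
        exact norm_eq_zero.mp (le_antisymm hle hB)
      rw [hτ, hq] at hR h
      have := congrArg norm h
      rw [hR] at this
      simp [n4] at this
    have hAp : 0 < ‖τ‖ := norm_pos_iff.mpr hτ
    have hL : ‖τ ^ 3 + 3 * u * τ ^ 2 * q + 9 * e * τ * q ^ 2 + 3 * u * e * q ^ 3‖ = ‖τ‖ ^ 3 := by
      have e1 : ‖3 * u * τ ^ 2 * q + 9 * e * τ * q ^ 2 + 3 * u * e * q ^ 3‖ ≤ ‖τ‖ ^ 3 / 3 := by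
        apply nadd_le
        · apply nadd_le
          · rw [norm_mul, norm_mul, norm_mul, norm_pow, n3, hu]
            have : ‖τ‖ ^ 2 * ‖q‖ ≤ ‖τ‖ ^ 2 * ‖τ‖ := by gcongr
            linarith
          · rw [norm_mul, norm_mul, norm_mul, norm_pow, n9, he]
            have : ‖τ‖ * ‖q‖ ^ 2 ≤ ‖τ‖ * ‖τ‖ ^ 2 := by gcongr
            have : 0 < ‖τ‖ ^ 3 := by positivity
            linarith
        · rw [norm_mul, norm_mul, norm_mul, norm_pow, n3, hu, he]
          have : ‖q‖ ^ 3 ≤ ‖τ‖ ^ 3 := by gcongr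
          linarith
      rw [add_assoc, add_assoc, ← add_assoc (3 * u * τ ^ 2 * q), nadd, norm_pow]
      rw [norm_pow]
      have : 0 < ‖τ‖ ^ 3 := by positivity
      linarith
    rw [h, hR] at hL
    rcases lt_trichotomy ‖τ‖ 1 with h1 | h1 | h1
    · have e1 : ‖τ ^ 2 - 3 * e * q ^ 2 + 4‖ = 1 := by
        have : ‖τ ^ 2 + -(3 * e * q ^ 2)‖ ≤ ‖τ‖ ^ 2 := by
          apply nadd_le _ _ _ s1.le
          rw [s2]
          have : ‖q‖ ^ 2 ≤ ‖τ‖ ^ 2 := by gcongr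
          have : 0 < ‖τ‖ ^ 2 := by positivity
          linarith
        rw [sub_eq_add_neg, add_comm, nadd, n4]
        rw [n4]; nlinarith
      rw [e1] at hL
      have h3 : ‖τ‖ ≤ 1 / 3 := by
        have := gapxy τ 1 (by rwa [norm_one]); rwa [norm_one] at this
      have : ‖τ‖ ^ 3 ≤ (1 / 3) ^ 3 := by gcongr
      norm_num at this
      linarith
    · have e1 : ‖τ ^ 2 - 3 * e * q ^ 2 + 4‖ ≤ 1 := by
        apply nadd_le _ _ _ _ n4.le
        rw [sub_eq_add_neg]
        apply nadd_le
        · rw [s1, h1]; norm_num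
        · rw [s2]; rw [h1] at hle; nlinarith
      rw [h1] at hL
      linarith
    · have e1 : ‖τ ^ 2 - 3 * e * q ^ 2 + 4‖ ≤ ‖τ‖ ^ 2 := by
        apply nadd_le
        · rw [sub_eq_add_neg]
          apply nadd_le _ _ _ s1.le
          rw [s2]
          have : ‖q‖ ^ 2 ≤ ‖τ‖ ^ 2 := by gcongr
          have : 0 < ‖τ‖ ^ 2 := by positivity
          linarith
        · rw [n4]; nlinarith
      have : ‖τ‖ ^ 2 * 1 < ‖τ‖ ^ 2 * ‖τ‖ := by gcongr
      nlinarith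
  · have hBp : 0 < ‖q‖ := lt_of_le_of_lt hA hlt
    have hAB := gapxy τ q hlt
    have hL : ‖τ ^ 3 + 3 * u * τ ^ 2 * q + 9 * e * τ * q ^ 2 + 3 * u * e * q ^ 3‖ = ‖q‖ ^ 3 / 3 := by
      have hq3 : ‖3 * u * e * q ^ 3‖ = ‖q‖ ^ 3 / 3 := by
        rw [norm_mul, norm_mul, norm_mul, norm_pow, n3, hu, he]; ring
      have e1 : ‖τ ^ 3 + 3 * u * τ ^ 2 * q + 9 * e * τ * q ^ 2‖ ≤ ‖q‖ ^ 3 / 27 := by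
        apply nadd_le
        · apply nadd_le
          · rw [norm_pow]
            have : ‖τ‖ ^ 3 ≤ (‖q‖ / 3) ^ 3 := by gcongr
            linarith
          · rw [norm_mul, norm_mul, norm_mul, norm_pow, n3, hu]
            have : ‖τ‖ ^ 2 * ‖q‖ ≤ (‖q‖ / 3) ^ 2 * ‖q‖ := by gcongr
            linarith
        · rw [norm_mul, norm_mul, norm_mul, norm_pow, n9, he]
          have : ‖τ‖ * ‖q‖ ^ 2 ≤ (‖q‖ / 3) * ‖q‖ ^ 2 := by gcongr
          linarith
      rw [add_comm, nadd, hq3]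
      rw [hq3]
      have : 0 < ‖q‖ ^ 3 := by positivity
      linarith
    have hL2 := hL
    rw [h, hR] at hL2
    rcases lt_trichotomy ‖q‖ 1 with h1 | h1 | h1
    · have e1 : ‖τ ^ 2 - 3 * e * q ^ 2 + 4‖ = 1 := by
        have : ‖τ ^ 2 + -(3 * e * q ^ 2)‖ ≤ ‖q‖ ^ 2 := by
          apply nadd_le
          · rw [s1]; gcongr
          · rw [s2]; have : 0 < ‖q‖ ^ 2 := by positivity
            linarith
        rw [sub_eq_add_neg, add_comm, nadd, n4]
        rw [n4]; nlinarith
      rw [e1] at hL2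
      have : ‖q‖ ^ 3 < 1 := pow_lt_one₀ hB h1 (by norm_num)
      linarith
    · obtain ⟨Q, hQ⟩ := toInt q h1.le
      obtain ⟨T, hT⟩ := toInt (τ / 3) (by rw [norm_div, n3]; rw [h1] at hAB; linarith)
      have hτ : τ = 3 * T := by rw [hT]; ring
      have hz : 9 * T ^ 3 + 9 * (4 - 3 * t) * T ^ 2 * Q + 9 * (5 * t - 3) * T * Q ^ 2
          + (4 - 3 * t) * (5 * t - 3) * Q ^ 3
          = 2 * (2 - 3 * t) * t * (9 * T ^ 2 - 3 * (5 * t - 3) * Q ^ 2 + 4) := by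
        have : (3 : ℚ_[3]) * (9 * T ^ 3 + 9 * (4 - 3 * t) * T ^ 2 * Q + 9 * (5 * t - 3) * T * Q ^ 2
          + (4 - 3 * t) * (5 * t - 3) * Q ^ 3)
          = 3 * (2 * (2 - 3 * t) * t * (9 * T ^ 2 - 3 * (5 * t - 3) * Q ^ 2 + 4)) := by
          rw [hudef, hedef, hτ, ← hQ] at h
          linear_combination h
        have := mul_left_cancel₀ (by norm_num) this
        apply PadicInt.ext
        push_cast
        exact this
      have hz9 := congrArg (PadicInt.toZModPow (p := 3) 2) hz
      have ht9 := congrArg (PadicInt.toZModPow (p := 3) 2) ht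
      simp only [map_mul, map_pow, map_add, map_sub, map_ofNat, map_one] at hz9 ht9
      have key : ∀ a : ZMod (3 ^ 2), 3 * a ^ 2 = a + 1 → a = 2 := by decide
      rw [key _ ht9] at hz9
      have k9 : (9 : ZMod (3 ^ 2)) = 0 := by decide
      rw [k9] at hz9
      simp only [zero_mul, zero_add, zero_sub] at hz9
      revert hz9
      generalize (PadicInt.toZModPow (p := 3) 2) Q = a
      revert a; decide
    · have e1 : ‖τ ^ 2 - 3 * e * q ^ 2 + 4‖ ≤ ‖q‖ ^ 2 / 3 ∨ ‖τ ^ 2 - 3 * e * q ^ 2 + 4‖ ≤ 1 := by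
        have h3 : ‖τ ^ 2 + -(3 * e * q ^ 2)‖ ≤ ‖q‖ ^ 2 / 3 := by
          apply nadd_le _ _ _ _ s2.le
          rw [s1]
          have : ‖τ‖ ^ 2 ≤ (‖q‖ / 3) ^ 2 := by gcongr
          have : 0 < ‖q‖ ^ 2 := by positivity
          linarith
        rw [sub_eq_add_neg]
        rcases le_total (‖q‖ ^ 2 / 3) 1 with h4 | h4
        · right; exact nadd_le _ _ _ (h3.trans h4) n4.le
        · left; exact nadd_le _ _ _ h3 (n4.le.trans h4)
      have : ‖q‖ ^ 2 * 1 < ‖q‖ ^ 2 * ‖q‖ := by gcongr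
      have : 0 < ‖q‖ ^ 2 := by positivity
      rcases e1 with e1 | e1 <;> nlinarith
end

section
theorem norootF {F : Type*} [Field F] (w : F) (e : F →+* ℚ_[17]) (z : ℤ_[17])
    (hz : PadicInt.toZMod z = 5) (he : e w = z) (x : F) (h : 4 * x ^ 3 + (-1 - 11 * w) * (x + 1) ^ 2 = 0) :
    False := by
  have h1 : e (4 * x) ^ 3 + (-1 - 11 * (z : ℚ_[17])) * (e (4 * x) + 4) ^ 2 = 0 := by
    have := congrArg e h
    simp only [map_mul, map_pow, map_add, map_sub, map_neg, map_one, map_ofNat, map_zero, he] at this ⊢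
    linear_combination 16 * this
  have c4 : ((4 : ℤ_[17]) : ℚ_[17]) = 4 := rfl
  have c11 : ((11 : ℤ_[17]) : ℚ_[17]) = 11 := rfl
  generalize e (4 * x) = X at h1
  rcases le_total ‖X‖ 1 with hX | hX
  · obtain ⟨Y, rfl⟩ : ∃ Y : ℤ_[17], (Y : ℚ_[17]) = X := ⟨⟨X, hX⟩, rfl⟩
    have h2 : Y ^ 3 + (-1 - 11 * z) * (Y + 4) ^ 2 = 0 := by
      apply PadicInt.ext
      push_cast
      rw [c4, c11]
      exact h1
    have h3 := congrArg (PadicInt.toZMod (p := 17)) h2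
    simp only [map_mul, map_pow, map_add, map_sub, map_neg, map_one, map_ofNat, map_zero, hz] at h3
    revert h3
    generalize PadicInt.toZMod Y = a
    revert a; decide
  · have hX0 : X ≠ 0 := by rintro rfl; simp at hX; linarith
    obtain ⟨Y, hY⟩ : ∃ Y : ℤ_[17], (Y : ℚ_[17]) = X⁻¹ :=
      ⟨⟨X⁻¹, by rw [norm_inv]; exact inv_le_one_of_one_le₀ hX⟩, rfl⟩
    have hYX : (Y : ℚ_[17]) * X = 1 := by rw [hY]; exact inv_mul_cancel₀ hX0
    have h2 : 1 + (-1 - 11 * z) * Y * (1 + 4 * Y) ^ 2 = 0 := by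
      apply PadicInt.ext
      push_cast
      rw [c4, c11]
      have e1 : (1 : ℚ_[17]) + (-1 - 11 * (z : ℚ_[17])) * Y * (1 + 4 * Y) ^ 2
        = Y ^ 3 * (X ^ 3 + (-1 - 11 * (z : ℚ_[17])) * (X + 4) ^ 2) := by
        have e3 : X = (Y : ℚ_[17])⁻¹ := by rw [hY, inv_inv]
        have hY0 : (Y : ℚ_[17]) ≠ 0 := by rw [hY]; exact inv_ne_zero hX0
        rw [e3]; field_simp
      rw [e1, h1, mul_zero]
    have h3 := congrArg (PadicInt.toZMod (p := 17)) h2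
    simp only [map_mul, map_pow, map_add, map_sub, map_neg, map_one, map_ofNat, map_zero, hz] at h3
    revert h3
    generalize PadicInt.toZMod Y = a
    revert a; decide

theorem isog {F : Type*} [Field F] [CharZero F] (w : F) (hw : w ^ 2 = w + 3) (x τ q : F)
    (h4 : 4 * x = τ ^ 2 - (-4 - 5 * w) * q ^ 2)
    (hq : 4 * (1 - w) * (x + 1) = 3 * τ ^ 2 * q + (-4 - 5 * w) * q ^ 3) :
    ∃ y V : F, y ≠ 0 ∧ V ^ 2 = 4 * y ^ 3 + (-12 + 11 * w) * (y + 1) ^ 2 ∧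
      81 * x * y ^ 2 = 27 * y ^ 3 + (1 + 11 * w) * (y + 3) ^ 3 := by
  have k1 : τ ^ 2 * (1 + w * q) = (1 + w) * (2 * w - 1) * q ^ 3 + (-4 - 5 * w) * q ^ 2 - 4 := by
    have : (3 : F) * (τ ^ 2 * (1 + w * q) - ((1 + w) * (2 * w - 1) * q ^ 3 + (-4 - 5 * w) * q ^ 2 - 4)) = 0 := by
      linear_combination (-w) * hq + w * (1 - w) * h4 - (4 - τ ^ 2 + (-4 - 5 * w) * q ^ 2) * (-hw) + q ^ 3 * hw - (8 + 2 * q ^ 3) * hw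
    rcases mul_eq_zero.mp this with h | h
    · exact absurd h (by norm_num)
    · linear_combination h
  have k2 : (6 - w) ^ 2 * τ ^ 2 * (1 + w * q) = -108 + (-12 + 11 * w) * (w * q - 2) ^ 2 * (1 + w * q) := by
    grind
  have hm : 1 + w * q ≠ 0 := by
    intro h0
    rw [h0] at k2
    norm_num at k2
  refine ⟨-3 / (1 + w * q), (6 - w) * τ / (1 + w * q), div_ne_zero (by norm_num) hm, ?_, ?_⟩
  · field_simp
    linear_combination k2
  · have k3 : 27 * x * (1 + w * q) = -27 + (1 + 11 * w) * (w * q) ^ 3 := by grind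
    field_simp
    linear_combination 3 * k3

theorem descent {F : Type*} [Field F] [CharZero F] (w : F) (hw : w ^ 2 = w + 3) (c : F →+* F) (cw : c w = 1 - w)
    (cc : ∀ x, c (c x) = x) (i : F →+* ℚ_[3]) (t : ℤ_[3]) (ht : 3 * t ^ 2 = t + 1)
    (hi : i w = 3 * (t : ℚ_[3]))
    (hstep : ∀ x V : F, V ^ 2 = 4 * x ^ 3 + (-1 - 11 * w) * (x + 1) ^ 2 → ∃ τ q : F,
      (4 * x = τ ^ 2 - (-4 - 5 * w) * q ^ 2 ∧ 4 * (1 - w) * (x + 1) = 3 * τ ^ 2 * q + (-4 - 5 * w) * q ^ 3)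
      ∨ τ ^ 3 + 3 * (3 + w) * τ ^ 2 * q + 3 * (-4 - 5 * w) * τ * q ^ 2 + (3 + w) * (-4 - 5 * w) * q ^ 3
        = 2 * (1 + w) * (1 - w) * (τ ^ 2 - (-4 - 5 * w) * q ^ 2 + 4))
    (n : ℕ) : ∀ x V : F, V ^ 2 = 4 * x ^ 3 + (-1 - 11 * w) * (x + 1) ^ 2 → 1 < ‖i x‖ → ‖i x‖ ≤ 3 ^ n → False := by
  have key : ∀ x V : F, V ^ 2 = 4 * x ^ 3 + (-1 - 11 * w) * (x + 1) ^ 2 → ∃ y V : F, y ≠ 0 ∧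
      V ^ 2 = 4 * y ^ 3 + (-12 + 11 * w) * (y + 1) ^ 2 ∧
      81 * x * y ^ 2 = 27 * y ^ 3 + (1 + 11 * w) * (y + 3) ^ 3 := by
    intro x V h
    obtain ⟨τ, q, ⟨h4, hq⟩ | h1⟩ := hstep x V h
    · exact isog w hw x τ q h4 hq
    · exfalso
      apply eta t ht (i (c τ)) (i (c q))
      have := congrArg (fun z => i (c z)) h1
      simp only [map_mul, map_pow, map_add, map_sub, map_neg, map_one, map_ofNat, cw, hi] at this
      linear_combination this
  induction n with
  | zero => intro x V _ h1 h2; rw [pow_zero] at h2; linarith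
  | succ n ih =>
    intro x V h h1 h2
    obtain ⟨y, U, hy, hU, hxy⟩ := key x V h
    obtain ⟨ny, nx⟩ := D2 t ht (i x) (i y) (i U) ((map_ne_zero i).mpr hy)
      (by
        have := congrArg i hU
        simp only [map_mul, map_pow, map_add, map_sub, map_neg, map_one, map_ofNat, hi] at this
        linear_combination this)
      (by
        have := congrArg i hxy
        simp only [map_mul, map_pow, map_add, map_sub, map_neg, map_one, map_ofNat, hi] at this
        linear_combination this) h1
    obtain ⟨y', U', hy', hU', hxy'⟩ := key (c y) (c U) (by
        have := congrArg c hU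
        simp only [map_mul, map_pow, map_add, map_sub, map_neg, map_one, map_ofNat, cw] at this
        linear_combination this)
    have ht' : 3 * (t : ℚ_[3]) ^ 2 = t + 1 := by
      have := congrArg (fun z : ℤ_[3] => (z : ℚ_[3])) ht
      push_cast at this
      exact this
    have E1 := congrArg (fun z => i (c z)) hU'
    have E2 := congrArg (fun z => i (c z)) hxy'
    simp only [map_mul, map_pow, map_add, map_sub, map_neg, map_one, map_ofNat, cw, hi, cc] at E1 E2
    obtain ⟨ny', nx'⟩ := D3 t ht (i y) (i (c y')) (i (c U')) ((12 - 33 * (t : ℚ_[3])) / 27)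
      (by linear_combination (121 / 9 : ℚ_[3]) * ht') (by linear_combination (-121 / 9 : ℚ_[3]) * ht')
      (by linear_combination E1) ((map_ne_zero i).mpr ((map_ne_zero c).mpr hy'))
      (by linear_combination E2 / 27) ny
    refine ih (c y') (c U') ?_ ny' ?_
    · have := congrArg c hU'
      simp only [map_mul, map_pow, map_add, map_sub, map_neg, map_one, map_ofNat, cw] at this
      linear_combination this
    · rw [pow_succ] at h2; linarith

theorem claimC {F : Type*} [Field F] [CharZero F] (w : F) (hw : w ^ 2 = w + 3) (c : F →+* F) (cw : c w = 1 - w)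
    (cc : ∀ x, c (c x) = x) (i : F →+* ℚ_[3]) (t : ℤ_[3]) (ht : 3 * t ^ 2 = t + 1)
    (hi : i w = 3 * (t : ℚ_[3])) (e : F →+* ℚ_[17]) (z : ℤ_[17])
    (hz : PadicInt.toZMod z = 5) (he : e w = z)
    (hstep : ∀ x V : F, V ^ 2 = 4 * x ^ 3 + (-1 - 11 * w) * (x + 1) ^ 2 → ∃ τ q : F,
      (4 * x = τ ^ 2 - (-4 - 5 * w) * q ^ 2 ∧ 4 * (1 - w) * (x + 1) = 3 * τ ^ 2 * q + (-4 - 5 * w) * q ^ 3)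
      ∨ τ ^ 3 + 3 * (3 + w) * τ ^ 2 * q + 3 * (-4 - 5 * w) * τ * q ^ 2 + (3 + w) * (-4 - 5 * w) * q ^ 3
        = 2 * (1 + w) * (1 - w) * (τ ^ 2 - (-4 - 5 * w) * q ^ 2 + 4))
    (x V : F) (h : V ^ 2 = 4 * x ^ 3 + (-1 - 11 * w) * (x + 1) ^ 2) : False := by
  have fin : ∀ x V : F, V ^ 2 = 4 * x ^ 3 + (-1 - 11 * w) * (x + 1) ^ 2 → 1 < ‖i x‖ → False := by
    intro x V h h1
    obtain ⟨n, hn⟩ := pow_unbounded_of_one_lt ‖i x‖ (by norm_num : (1 : ℝ) < 3)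
    exact descent w hw c cw cc i t ht hi hstep n x V h h1 hn.le
  rcases lt_or_ge 1 ‖i x‖ with h1 | h1
  · exact fin x V h h1
  · have hV : V ≠ 0 := by
      rintro rfl
      exact norootF w e z hz he x (by rw [← h]; ring)
    have hd := D1 t ht (i x) (i V) (by
      have := congrArg i h
      simp only [map_mul, map_pow, map_add, map_sub, map_neg, map_one, map_ofNat, hi] at this
      linear_combination this) h1 ((map_ne_zero i).mpr hV)
    obtain ⟨m, hm⟩ : ∃ m : F, 2 * V * m = 12 * x ^ 2 + 2 * (-1 - 11 * w) * (x + 1) :=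
      ⟨(12 * x ^ 2 + 2 * (-1 - 11 * w) * (x + 1)) / (2 * V), by field_simp⟩
    have hmi : i m = (12 * i x ^ 2 + 2 * (-1 - 33 * (t : ℚ_[3])) * (i x + 1)) / (2 * i V) := by
      have hV' : i V ≠ 0 := (map_ne_zero i).mpr hV
      rw [eq_div_iff (by simpa using hV')]
      have := congrArg i hm
      simp only [map_mul, map_pow, map_add, map_sub, map_neg, map_one, map_ofNat, hi] at this
      linear_combination this
    refine fin ((m ^ 2 - (-1 - 11 * w)) / 4 - 2 * x)
      (V + m * ((m ^ 2 - (-1 - 11 * w)) / 4 - 2 * x - x)) ?_ ?_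
    · linear_combination h + ((m ^ 2 - (-1 - 11 * w)) / 4 - 2 * x - x) * hm
    · rw [← hmi] at hd
      have : i ((m ^ 2 - (-1 - 11 * w)) / 4 - 2 * x) = (i m ^ 2 - (-1 - 33 * (t : ℚ_[3]))) / 4 - 2 * i x := by
        simp only [map_mul, map_pow, map_add, map_sub, map_neg, map_one, map_ofNat, hi, map_div₀]
        ring
      rw [this]; exact hd
end

section
theorem stepC {F L : Type*} [Field F] [Field L] [CharZero F] [CharZero L] (w : F) (hw : w ^ 2 = w + 3)
    (ι : F →+* L) (θ η : L) (c : L ≃+* L) (cι : ∀ a, c (ι a) = ι a) (cθ : c θ = -θ)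
    (hθ : θ ^ 2 = ι (-4 - 5 * w)) (hη : η * (2 * ι (1 + w)) = ι (3 + w) + θ)
    (hsp : ∀ β : L, ∃ τ q : F, 2 * β = ι τ + ι q * θ)
    (hun : ∀ A B : F, ι A + ι B * θ = 0 → A = 0 ∧ B = 0)
    (hD : ∀ V : F, V ^ 2 ≠ -1 - 11 * w) (hc3 : ∀ x y : F, x ^ 3 = y ^ 3 → x = y)
    (hcube : ∀ x α : L, α * c α = x ^ 3 → x ≠ 0 → α - c α = (1 - ι w) * (x + 1) * θ →
      ∃ (j : ℤ) (β : L), α = η ^ j * β ^ 3)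
    (x V : F) (h : V ^ 2 = 4 * x ^ 3 + (-1 - 11 * w) * (x + 1) ^ 2) : ∃ τ q : F,
      (4 * x = τ ^ 2 - (-4 - 5 * w) * q ^ 2 ∧ 4 * (1 - w) * (x + 1) = 3 * τ ^ 2 * q + (-4 - 5 * w) * q ^ 3)
      ∨ τ ^ 3 + 3 * (3 + w) * τ ^ 2 * q + 3 * (-4 - 5 * w) * τ * q ^ 2 + (3 + w) * (-4 - 5 * w) * q ^ 3
        = 2 * (1 + w) * (1 - w) * (τ ^ 2 - (-4 - 5 * w) * q ^ 2 + 4) := by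
  have ιinj : Function.Injective ι := ι.injective
  have hww : ι w ^ 2 = ι w + 3 := by rw [← map_pow, hw, map_add, map_ofNat]
  have ht : θ ^ 2 = -4 - 5 * ι w := by
    rw [hθ]; simp only [map_sub, map_mul, map_neg, map_ofNat]
  have hee : η * (2 * (1 + ι w)) = 3 + ι w + θ := by
    simpa only [map_add, map_mul, map_one, map_ofNat] using hη
  have hη2 : c η * (2 * (1 + ι w)) = 3 + ι w - θ := by
    have := congrArg c hee
    simp only [map_add, map_mul, map_one, map_ofNat, cι, cθ] at this
    linear_combination this
  have he0 : (1 + ι w) ≠ 0 := by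
    intro h0
    have h1 : ι w = -1 := by linear_combination h0
    rw [h1] at hww; norm_num at hww
  have hnn : η * c η = 1 := by
    have h4 : 4 * (1 + ι w) ^ 2 ≠ 0 := mul_ne_zero (by norm_num) (pow_ne_zero 2 he0)
    apply mul_right_cancel₀ h4
    linear_combination (c η * (2 * (1 + ι w))) * hee + (3 + ι w + θ) * hη2 - ht - 3 * hww
  have hη0 : η ≠ 0 := left_ne_zero_of_mul_eq_one hnn
  have hx0 : x ≠ 0 := by
    rintro rfl
    exact hD V (by linear_combination h)
  have hιx0 : ι x ≠ 0 := (map_ne_zero ι).mpr hx0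
  have hh := congrArg ι h
  simp only [map_add, map_sub, map_neg, map_mul, map_pow, map_one, map_ofNat] at hh
  -- norm consequence
  have nrm : ∀ (V' : F) (ζ β : L) (τ q : F), V' ^ 2 = V ^ 2 → ζ * c ζ = 1 → 2 * β = ι τ + ι q * θ →
      ι V' + (1 - ι w) * (ι x + 1) * θ = 2 * (ζ * β ^ 3) → 4 * x = τ ^ 2 - (-4 - 5 * w) * q ^ 2 := by
    intro V' ζ β τ q hV' hζ hβ hα
    have hβ2 : 2 * c β = ι τ - ι q * θ := by
      have := congrArg c hβ
      simp only [map_add, map_mul, map_ofNat, cι, cθ] at this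
      linear_combination this
    have hα2 : ι V' - (1 - ι w) * (ι x + 1) * θ = 2 * (c ζ * c β ^ 3) := by
      have := congrArg c hα
      simp only [map_add, map_sub, map_one, map_mul, map_pow, map_ofNat, cι, cθ] at this
      linear_combination this
    have hV'' : ι V' ^ 2 = ι V ^ 2 := by rw [← map_pow, hV', map_pow]
    have e1 : (4 * β * c β) ^ 3 = (4 * ι x) ^ 3 := by
      have p1 : 4 * (β * c β) ^ 3 = 4 * ι x ^ 3 := by
        linear_combination (ι V' - (1 - ι w) * (ι x + 1) * θ) * (-hα) - 2 * (ζ * β ^ 3) * hα2 + hV'' + hh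
          - 4 * (β * c β) ^ 3 * hζ - (1 - ι w) ^ 2 * (ι x + 1) ^ 2 * ht
          + (ι x + 1) ^ 2 * (5 * ι w - 1) * hww
      linear_combination 16 * p1
    have e2 : 4 * β * c β = ι (τ ^ 2 - (-4 - 5 * w) * q ^ 2) := by
      simp only [map_add, map_sub, map_neg, map_mul, map_pow, map_one, map_ofNat]
      linear_combination (2 * c β) * hβ + (ι τ + ι q * θ) * hβ2 - ι q ^ 2 * ht
    rw [e2] at e1
    have e3 : (4 * x) ^ 3 = (τ ^ 2 - (-4 - 5 * w) * q ^ 2) ^ 3 := by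
      apply ιinj
      rw [map_pow, map_pow, e1]; simp only [map_mul, map_ofNat]
    exact hc3 _ _ e3
  have case1 : ∀ (V' : F) (β : L), V' ^ 2 = V ^ 2 →
      ι V' + (1 - ι w) * (ι x + 1) * θ = 2 * (η * β ^ 3) → ∃ τ q : F,
       τ ^ 3 + 3 * (3 + w) * τ ^ 2 * q + 3 * (-4 - 5 * w) * τ * q ^ 2 + (3 + w) * (-4 - 5 * w) * q ^ 3
        = 2 * (1 + w) * (1 - w) * (τ ^ 2 - (-4 - 5 * w) * q ^ 2 + 4) := by
    intro V' β hV' hα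
    obtain ⟨τ, q, hβ⟩ := hsp β
    have h4 := nrm V' η β τ q hV' hnn hβ hα
    refine ⟨τ, q, ?_⟩
    have hz := hun (8 * (1 + w) * V' - ((3 + w) * (τ ^ 3 + 3 * (-4 - 5 * w) * τ * q ^ 2)
        + (-4 - 5 * w) * (3 * τ ^ 2 * q + (-4 - 5 * w) * q ^ 3)))
      (8 * (1 + w) * (1 - w) * (x + 1) - ((3 + w) * (3 * τ ^ 2 * q + (-4 - 5 * w) * q ^ 3)
        + (τ ^ 3 + 3 * (-4 - 5 * w) * τ * q ^ 2))) (by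
      simp only [map_add, map_sub, map_neg, map_mul, map_pow, map_one, map_ofNat]
      have b3 : 8 * β ^ 3 = (ι τ + ι q * θ) ^ 3 := by rw [← hβ]; ring
      linear_combination 8 * (1 + ι w) * hα + 8 * β ^ 3 * hee + (3 + ι w + θ) * b3
        + ((3 + ι w + θ) * (3 * ι τ * ι q ^ 2 + ι q ^ 3 * θ) + (3 * ι τ ^ 2 * ι q + ι q ^ 3 * (-4 - 5 * ι w))) * ht)
    linear_combination -hz.2 - 2 * (1 + w) * (1 - w) * (-h4)
  set α : L := (ι V + (1 - ι w) * (ι x + 1) * θ) / 2 with hα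
  have hα2 : ι V + (1 - ι w) * (ι x + 1) * θ = 2 * α := by rw [hα]; ring
  have hcα : ι V - (1 - ι w) * (ι x + 1) * θ = 2 * c α := by
    have := congrArg c hα2
    simp only [map_add, map_sub, map_one, map_mul, map_ofNat, cι, cθ] at this
    linear_combination this
  obtain ⟨j, β, hj⟩ := hcube (ι x) α (by
    have p1 : 4 * (α * c α) = 4 * ι x ^ 3 := by
      linear_combination (ι V - (1 - ι w) * (ι x + 1) * θ) * (-hα2) - 2 * α * hcα + hh
          - (1 - ι w) ^ 2 * (ι x + 1) ^ 2 * ht + (ι x + 1) ^ 2 * (5 * ι w - 1) * hww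
    exact mul_left_cancel₀ (by norm_num) p1) hιx0 (by
      have : (2 : L) * (α - c α) = 2 * ((1 - ι w) * (ι x + 1) * θ) := by
        linear_combination -hα2 + hcα
      exact mul_left_cancel₀ (by norm_num) this)
  obtain ⟨k, hk⟩ : ∃ k : ℤ, j = 3 * k ∨ j = 3 * k + 1 ∨ j = 3 * k - 1 := ⟨(j + 1) / 3, by omega⟩
  have hcub : η ^ (3 * k) * β ^ 3 = (η ^ k * β) ^ 3 := by
    rw [mul_pow, mul_comm 3 k, zpow_mul]; norm_cast
  rcases hk with rfl | rfl | rfl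
  · rw [hcub] at hj
    obtain ⟨τ, q, hβ⟩ := hsp (η ^ k * β)
    generalize η ^ k * β = γ at *
    have h4 := nrm V 1 γ τ q rfl (by simp) hβ (by rw [hα2, hj]; ring)
    refine ⟨τ, q, Or.inl ⟨h4, ?_⟩⟩
    have hz := hun (4 * V - (τ ^ 3 + 3 * (-4 - 5 * w) * τ * q ^ 2))
      (4 * (1 - w) * (x + 1) - (3 * τ ^ 2 * q + (-4 - 5 * w) * q ^ 3)) (by
      simp only [map_add, map_sub, map_neg, map_mul, map_pow, map_one, map_ofNat]
      have b3 : 8 * γ ^ 3 = (ι τ + ι q * θ) ^ 3 := by rw [← hβ]; ring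
      linear_combination 4 * hα2 + 8 * hj + b3 + (3 * ι τ * ι q ^ 2 + ι q ^ 3 * θ) * ht)
    linear_combination hz.2
  · rw [zpow_add₀ hη0, zpow_one, mul_right_comm, hcub] at hj
    obtain ⟨τ, q, hq⟩ := case1 V (η ^ k * β) rfl (by rw [hα2, hj]; ring)
    exact ⟨τ, q, Or.inr hq⟩
  · rw [zpow_sub₀ hη0, zpow_one, div_mul_eq_mul_div, hcub] at hj
    have hj2 : c α = η * c (η ^ k * β) ^ 3 := by
      have e : η⁻¹ = c η := inv_eq_of_mul_eq_one_right hnn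
      have : c (c η) = η := by
        have h5 := congrArg c hη2
        simp only [map_add, map_sub, map_one, map_mul, map_ofNat, cι, cθ] at h5
        apply mul_right_cancel₀ (mul_ne_zero (two_ne_zero) he0)
        linear_combination h5 - hee
      rw [hj, div_eq_mul_inv, e, map_mul, this, map_pow, mul_comm]
    obtain ⟨τ, q, hq⟩ := case1 (-V) (-c (η ^ k * β)) (by ring) (by
      rw [map_neg]; linear_combination -hcα - 2 * hj2)
    exact ⟨τ, q, Or.inr hq⟩
end

open NumberField Module
open scoped QuadraticAlgebra
section
theorem cube' {L : Type*} [Field L] [CharZero L] (w r : L) (hw : w ^ 2 = w + 3)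
    (hr : r ^ 2 = (1 + w) * r - 2 * (1 + w))
    (hind : ∀ a b c d : ℚ, (a : L) + b * w + c * r + d * (w * r) = 0 → a = 0 ∧ b = 0 ∧ c = 0 ∧ d = 0)
    (hsp : ∀ x : L, ∃ a b c d : ℚ, x = (a : L) + b * w + c * r + d * (w * r))
    (c : L ≃+* L) (cw : c w = w) (cr : c r = 1 + w - r) (f : L →+* ℝ) (g : L →+* ℂ)
    (hg : ¬ ComplexEmbedding.IsReal g) (x α : L) (hα : α * c α = x ^ 3) (hx0 : x ≠ 0)
    (hd : α - c α = (1 - w) * (x + 1) * (2 * r - (1 + w))) :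
    ∃ (j : ℤ) (β : L), α = ((1 + r) * (w - 2)) ^ j * β ^ 3 := by
  have li : LinearIndependent ℚ ![1, w, r, w * r] := by
    rw [Fintype.linearIndependent_iff]
    intro s hs
    rw [Fin.sum_univ_four] at hs
    simp only [Matrix.cons_val, Rat.smul_def] at hs
    obtain ⟨h0, h1, h2, h3⟩ := hind (s 0) (s 1) (s 2) (s 3) (by linear_combination hs)
    intro i
    fin_cases i
    · exact h0
    · exact h1
    · exact h2
    · exact h3
  have sp : ⊤ ≤ Submodule.span ℚ (Set.range ![1, w, r, w * r]) := by
    intro x _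
    obtain ⟨a, b, c, d, rfl⟩ := hsp x
    have m : ∀ i : Fin 4, ∀ q : ℚ, (q : L) * (![1, w, r, w * r] i) ∈ Submodule.span ℚ (Set.range ![1, w, r, w * r]) := by
      intro i q
      rw [← Rat.smul_def]
      exact Submodule.smul_mem _ _ (Submodule.subset_span ⟨i, rfl⟩)
    have := Submodule.add_mem _ (Submodule.add_mem _ (Submodule.add_mem _ (m 0 a) (m 1 b)) (m 2 c)) (m 3 d)
    simpa using this
  let B : Basis (Fin 4) ℚ L := Basis.mk li sp
  have : NumberField L := { to_charZero := inferInstance, to_finiteDimensional := Module.Finite.of_basis B }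
  let Q : QD L := ⟨B, w, r, hw, hr, by simp [B], by simp [B], by simp [B], by simp [B]⟩
  exact Q.cube c cw cr f g hg x α hα hx0 hd

/-- ring homomorphism out of a quadratic algebra -/
def qhom {R A : Type*} [CommRing R] [CommRing A] (φ : R →+* A) (a b : R) (u : A)
    (hu : u * u = φ a + φ b * u) : QuadraticAlgebra R a b →+* A where
  toFun z := φ z.re + φ z.im * u
  map_one' := by simp
  map_zero' := by simp
  map_add' x y := by simp; ring
  map_mul' x y := by simp; linear_combination (-(φ x.im * φ y.im)) * hu

theorem qhom_apply {R A : Type*} [CommRing R] [CommRing A] (φ : R →+* A) (a b : R) (u : A)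
    (hu : u * u = φ a + φ b * u) (z : QuadraticAlgebra R a b) :
    qhom φ a b u hu z = φ z.re + φ z.im * u := rfl

abbrev F13 := QuadraticAlgebra ℚ 3 1

theorem no13 (r : ℚ) : r ^ 2 ≠ 13 := by
  intro h
  have h1 : IsSquare (13 : ℚ) := ⟨r, by rw [← h]; ring⟩
  rw [show (13 : ℚ) = ((13 : ℕ) : ℚ) by norm_num, Rat.isSquare_natCast_iff] at h1
  obtain ⟨k, hk⟩ := h1
  have : k ≤ 3 ∨ 4 ≤ k := by omega
  rcases this with h | h
  · interval_cases k <;> omega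
  · nlinarith

instance factF : Fact (∀ r : ℚ, r ^ 2 ≠ 3 + 1 * r) := ⟨fun r h => no13 (2 * r - 1) (by linear_combination 4 * h)⟩

/-- the generator -/
def ww : F13 := ⟨0, 1⟩
theorem hww : ww ^ 2 = ww + 3 := by
  rw [sq]; ext <;> simp [ww]

theorem normneg (x : F13) (a b : ℚ) (h : x ^ 2 = ⟨a, b⟩) : 0 ≤ a ^ 2 + a * b - 3 * b ^ 2 := by
  have h2 := congrArg QuadraticAlgebra.norm h
  rw [map_pow] at h2
  rw [QuadraticAlgebra.norm_def] at h2
  rw [QuadraticAlgebra.norm_def] at h2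
  nlinarith [sq_nonneg (x.re * x.re + 1 * x.re * x.im - 3 * x.im * x.im)]

theorem c13 (a b : ℚ) : (⟨a, b⟩ : F13) = (a : F13) + (b : F13) * ww := by
  ext <;> simp [ww]

instance factL : Fact (∀ r : F13, r ^ 2 ≠ -2 * (1 + ww) + (1 + ww) * r) := ⟨fun r h => by
  have h2 : (2 * r - (1 + ww)) ^ 2 = (⟨-4, -5⟩ : F13) := by
    rw [c13]; push_cast
    linear_combination 4 * h + hww
  have := normneg _ _ _ h2
  norm_num at this⟩

abbrev L13 := QuadraticAlgebra F13 (-2 * (1 + ww)) (1 + ww)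

/-- inclusion -/
def io : F13 →+* L13 := algebraMap F13 L13
/-- second generator -/
def rr : L13 := ⟨0, 1⟩

theorem hrr : rr ^ 2 = (1 + io ww) * rr - 2 * (1 + io ww) := by
  rw [sq]
  ext <;> simp [rr, io, QuadraticAlgebra.algebraMap_eq]

theorem L13_eq (x : L13) : x = io x.re + io x.im * rr := by
  ext <;> simp [rr, io, QuadraticAlgebra.algebraMap_eq]

theorem F13_eq (x : F13) : x = (x.re : F13) + (x.im : F13) * ww := by
  ext <;> simp [ww]

noncomputable def fF : F13 →+* ℝ := qhom (Rat.castHom ℝ) 3 1 ((1 - √13) / 2) (by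
  have := Real.sq_sqrt (show (0 : ℝ) ≤ 13 by norm_num)
  simp; linear_combination this / 4)

theorem fF_ww : fF ww = (1 - √13) / 2 := by simp [fF, qhom_apply, ww]

theorem s13 : 3.6 < √13 ∧ √13 < 3.61 := by
  constructor
  · rw [Real.lt_sqrt (by norm_num)]; norm_num
  · rw [Real.sqrt_lt' (by norm_num)]; norm_num

noncomputable def fL : L13 →+* ℝ := qhom fF _ _ ((1 + (1 - √13) / 2 + √(-4 - 5 * ((1 - √13) / 2))) / 2) (by
  have h := Real.sq_sqrt (show (0 : ℝ) ≤ 13 by norm_num)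
  have h1 := Real.sq_sqrt (show (0 : ℝ) ≤ -4 - 5 * ((1 - √13) / 2) by linarith [s13.1])
  simp only [map_add, map_mul, map_neg, map_one, map_ofNat, fF_ww]
  linear_combination h1 / 4 - h / 16)

noncomputable def gF : F13 →+* ℂ := qhom (Rat.castHom ℂ) 3 1 ((1 + (√13 : ℝ)) / 2) (by
  have : ((√13 : ℝ) : ℂ) ^ 2 = 13 := by
    rw [← Complex.ofReal_pow, Real.sq_sqrt (by norm_num)]; norm_num
  simp; linear_combination this / 4)

theorem gF_ww : gF ww = (1 + (√13 : ℝ)) / 2 := by simp [gF, qhom_apply, ww]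

noncomputable def gL : L13 →+* ℂ := qhom gF _ _
    ((1 + (1 + (√13 : ℝ)) / 2 + (√(4 + 5 * ((1 + √13) / 2)) : ℝ) * Complex.I) / 2) (by
  have h : ((√13 : ℝ) : ℂ) ^ 2 = 13 := by
    rw [← Complex.ofReal_pow, Real.sq_sqrt (by norm_num)]; norm_num
  have h1 : ((√(4 + 5 * ((1 + √13) / 2)) : ℝ) : ℂ) ^ 2 = 4 + 5 * ((1 + (√13 : ℝ)) / 2) := by
    rw [← Complex.ofReal_pow, Real.sq_sqrt (by positivity)]; push_cast; ring
  simp only [map_add, map_mul, map_neg, map_one, map_ofNat, gF_ww]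
  linear_combination -h1 / 4 - h / 16 + ((√(4 + 5 * ((1 + √13) / 2)) : ℝ) : ℂ) ^ 2 / 4 * Complex.I_sq)

theorem gL_nr : ¬ ComplexEmbedding.IsReal gL := by
  intro h
  have h1 := RingHom.congr_fun h rr
  have h2 : gL rr = (1 + (1 + (√13 : ℝ)) / 2 + (√(4 + 5 * ((1 + √13) / 2)) : ℝ) * Complex.I) / 2 := by
    simp [gL, qhom_apply, rr]
  rw [ComplexEmbedding.conjugate_coe_eq, h2, Complex.conj_eq_iff_im] at h1
  have h3 : 0 < √(4 + 5 * ((1 + √13) / 2)) := by positivity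
  have h4 : ((1 + (1 + (√13 : ℝ)) / 2 + (√(4 + 5 * ((1 + √13) / 2)) : ℝ) * Complex.I) / 2 : ℂ)
     = ((1 + (1 + √13) / 2) / 2 : ℝ) + ((√(4 + 5 * ((1 + √13) / 2)) / 2 : ℝ) : ℂ) * Complex.I := by
    push_cast; ring
  rw [h4] at h1
  simp only [Complex.add_im, Complex.ofReal_im, Complex.mul_im, Complex.ofReal_re, Complex.I_im, Complex.I_re] at h1
  linarith

theorem hstep13 (x V : F13) (h : V ^ 2 = 4 * x ^ 3 + (-1 - 11 * ww) * (x + 1) ^ 2) : ∃ τ q : F13,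
      (4 * x = τ ^ 2 - (-4 - 5 * ww) * q ^ 2 ∧ 4 * (1 - ww) * (x + 1) = 3 * τ ^ 2 * q + (-4 - 5 * ww) * q ^ 3)
      ∨ τ ^ 3 + 3 * (3 + ww) * τ ^ 2 * q + 3 * (-4 - 5 * ww) * τ * q ^ 2 + (3 + ww) * (-4 - 5 * ww) * q ^ 3
        = 2 * (1 + ww) * (1 - ww) * (τ ^ 2 - (-4 - 5 * ww) * q ^ 2 + 4) := by
  have hw' : io ww ^ 2 = io ww + 3 := by rw [← map_pow, hww, map_add, map_ofNat]
  have hun : ∀ A B : F13, io A + io B * rr = 0 → A = 0 ∧ B = 0 := by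
    intro A B h
    have h1 := congrArg QuadraticAlgebra.re h
    have h2 := congrArg QuadraticAlgebra.im h
    simp [rr, io, QuadraticAlgebra.algebraMap_eq] at h1 h2
    exact ⟨h1, h2⟩
  have hunF : ∀ a b : ℚ, (a : F13) + b * ww = 0 → a = 0 ∧ b = 0 := by
    intro A B h
    have h1 := congrArg QuadraticAlgebra.re h
    have h2 := congrArg QuadraticAlgebra.im h
    simp [ww] at h1 h2
    exact ⟨h1, h2⟩
  have cι : ∀ a, (starRingAut : L13 ≃+* L13) (io a) = io a := by
    intro a
    rw [starRingAut_apply]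
    ext <;> simp [io, QuadraticAlgebra.algebraMap_eq]
  have cr : (starRingAut : L13 ≃+* L13) rr = 1 + io ww - rr := by
    rw [starRingAut_apply]
    ext <;> simp [io, rr, QuadraticAlgebra.algebraMap_eq]
  refine stepC ww hww io (2 * rr - (1 + io ww)) ((1 + rr) * (io ww - 2)) starRingAut cι ?_ ?_ ?_ ?_ ?_ ?_ ?_ ?_ x V h
  · simp only [map_sub, map_mul, map_add, map_one, map_ofNat, cι, cr]; ring
  · simp only [map_sub, map_mul, map_add, map_neg, map_one, map_ofNat]
    linear_combination 4 * hrr + hw'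
  · simp only [map_sub, map_mul, map_add, map_neg, map_one, map_ofNat]
    linear_combination (2 + 2 * rr) * hw'
  · intro β
    refine ⟨2 * β.re + (1 + ww) * β.im, β.im, ?_⟩
    conv_lhs => rw [L13_eq β]
    simp only [map_mul, map_add, map_one, map_ofNat]
    ring
  · intro A B h
    have := hun (A - (1 + ww) * B) (2 * B) (by
      simp only [map_sub, map_mul, map_add, map_one, map_ofNat]
      linear_combination h)
    have hB : B = 0 := by simpa using this.2
    refine ⟨?_, hB⟩
    rw [hB] at this
    simpa using this.1
  · intro V hV
    have := normneg V (-1) (-11) (by rw [hV, c13]; push_cast; ring)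
    norm_num at this
  · intro x y hxy
    apply fF.injective
    have := congrArg fF hxy
    rw [map_pow, map_pow] at this
    exact (Odd.strictMono_pow (by decide : Odd 3)).injective this
  · intro x α hα hx0 hd
    refine cube' (io ww) rr hw' hrr ?_ ?_ starRingAut (cι ww) cr fL gL gL_nr x α hα hx0 hd
    · intro a b c d h
      have := hun ((a : F13) + b * ww) ((c : F13) + d * ww) (by
        simp only [map_mul, map_add, map_ratCast]
        linear_combination h)
      obtain ⟨h1, h2⟩ := this
      exact ⟨(hunF _ _ h1).1, (hunF _ _ h1).2, hunF _ _ h2⟩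
    · intro x
      refine ⟨x.re.re, x.re.im, x.im.re, x.im.im, ?_⟩
      conv_lhs => rw [L13_eq x, F13_eq x.re, F13_eq x.im]
      simp only [map_mul, map_add, map_ratCast]
      ring

/-- The elliptic curve `E1` has no affine points over `ℚ(√13)`. -/
theorem claimC13 (x V : F13) (h : V ^ 2 = 4 * x ^ 3 + (-1 - 11 * ww) * (x + 1) ^ 2) : False := by
  obtain ⟨t, ht⟩ := hens3
  obtain ⟨z, hz, hz5⟩ := hens17
  have ht' : 3 * (t : ℚ_[3]) ^ 2 = t + 1 := by
    have := congrArg (fun z : ℤ_[3] => (z : ℚ_[3])) ht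
    push_cast at this
    exact this
  have hz' : (z : ℚ_[17]) ^ 2 = z + 3 := by
    have := congrArg (fun z : ℤ_[17] => (z : ℚ_[17])) hz
    push_cast at this
    exact this
  refine claimC ww hww (starRingAut : F13 ≃+* F13).toRingHom ?_ ?_
    (qhom (Rat.castHom ℚ_[3]) 3 1 (3 * (t : ℚ_[3])) ?_) t ht ?_
    (qhom (Rat.castHom ℚ_[17]) 3 1 (z : ℚ_[17]) ?_) z hz5 ?_ hstep13 x V h
  · change starRingAut ww = _
    rw [starRingAut_apply]
    ext <;> simp [ww]
  · intro x
    change starRingAut (starRingAut x) = _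
    rw [starRingAut_apply, starRingAut_apply, star_star]
  · simp; linear_combination 3 * ht'
  · simp [qhom_apply, ww]
  · simp; linear_combination hz'
  · simp [qhom_apply, ww]
end

section
/-- The fifteen equations in normalized form. -/
structure XP {K : Type*} [Field K] (x y z a b c d e : K) : Prop where
  o1 : 13*x*a - 26*y*a + 90*y*c + 16*y*d + 23*y*e - 91*z*a + 13*z*b + 18*z*c - 41*z*d + 184*z*e = 0
  o2 : 26*x*b - 26*y*a + 140*y*c + 35*y*d + 30*y*e - 91*z*a + 26*z*b + 28*z*c - 58*z*d + 240*z*e = 0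
  o3 : 13*x*c - 26*y*a + 128*y*c + 32*y*d + 33*y*e - 130*z*a + 26*z*b + 36*z*c - 82*z*d + 264*z*e = 0
  o4 : 13*x*d + 39*y*a - 205*y*c - 61*y*d - 30*y*e + 195*z*a - 39*z*b - 41*z*c + 97*z*d - 409*z*e = 0
  o5 : 52*x*e + 78*y*a - 280*y*c - 109*y*d - 60*y*e + 221*z*a - 78*z*b - 56*z*c + 142*z*d - 506*z*e = 0
  o6 : 13*y*b - 5*y*c + 2*y*d - 2*y*e + 26*z*a - z*c + 16*z*d - 16*z*e = 0
  g1 : 169*x^2 - 15*a*d - 451*a*e - 14*b^2 + 120*b*c - 255*b*d - 166*b*e + 32*c^2 + 118*c*d + 227*c*e + 65*d^2 -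
    146*d*e + 271*e^2 = 0
  g2 : 169*x*y + 19*a*d - 402*a*e - 23*b^2 + 43*b*c - 158*b*d - 178*b*e + 8*c^2 + 192*c*d + 203*c*e + 13*d^2 -
    56*d*e + 292*e^2 = 0
  g3 : 338*x*z - 34*a*d - 49*a*e + 61*b^2 - 53*b*c - 45*b*d + 90*b*e - 80*c^2 + 56*c*d - 41*c*e + 52*d^2 -
    90*d*e + 148*e^2 = 0
  g4 : 338*y^2 + 42*a*d - 747*a*e + 21*b^2 + 197*b*c - 443*b*d - 284*b*e + 4*c^2 + 304*c*d + 407*c*e + 26*d^2 -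
    418*d*e + 744*e^2 = 0
  g5 : 169*y*z - a*d + 28*a*e + 32*b^2 - 44*b*c - 4*b*d + 34*b*e - 10*c^2 - 6*c*d - 114*c*e - 8*d*e - 40*e^2 = 0
  g6 : 169*z^2 - 8*a*d + 185*a*e + 9*b^2 - 79*b*c + 85*b*d + 168*b*e + 50*c^2 - 22*c*d - 145*c*e + 13*d^2 +
    66*d*e - 112*e^2 = 0
  g7 : 2*a^2 - 2*a*d + 9*a*e + b^2 - 3*b*c + 5*b*d + 4*b*e - 4*c*d - 5*c*e - 2*d^2 + 6*d*e - 8*e^2 = 0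
  g8 : a*b - 3*a*e + b*c - 2*b*d - 3*b*e + 2*c*d + 2*c*e - d*e + 2*e^2 = 0
  g9 : a*c + 3*a*e - b*c + 2*b*d + b*e - c*d - 2*c*e + d*e - 2*e^2 = 0

theorem XP.quartic {K : Type*} [Field K] [CharZero K] {x y z a b c d e : K} (h : XP x y z a b c d e) :
    2*x^4 + 4*x^3*y - 11*x^3*z - 10*x^2*y^2 - 75*x^2*y*z + 17*x^2*z^2 + 27*x*y^3 + 60*x*y^2*z - 87*x*y*z^2 +
      5*x*z^3 - 21*y^4 + 23*y^3*z + 40*y^2*z^2 + 9*y*z^3 - 7*z^4 = 0 := by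
  linear_combination (2/169*x^2 + 4/169*x*y - 11/169*x*z - 10/169*y^2 - 75/169*y*z + 17/169*z^2) * h.g1 + (27/169*y^2 +
      60/169*y*z - 87/169*z^2) * h.g2 + (5/338*z^2) * h.g3 + (-21/338*y^2 + 23/338*y*z + 20/169*z^2) * h.g4 +
      (9/169*z^2) * h.g5 + (-7/169*z^2) * h.g6 + (30/2197*x*d + 902/2197*x*e + 15590/15379*y*b -
      202858/199927*y*c + 42086/199927*y*d + 193331/199927*y*e - 192333/54925*z*b + 8787507/1999270*z*c +
      2953234/714025*z*d - 62833301/9996350*z*e) * h.o1 + (14/2197*x*b - 120/2197*x*c + 255/2197*x*d +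
      166/2197*x*e - 7697/15379*y*a + 28/2197*y*b - 33415/399854*y*c + 154013/399854*y*d - 156703/199927*y*e +
      194783/109850*z*a - 7/169*z*b - 670133/2856100*z*c + 556453/2856100*z*d - 3413339/1428050*z*e) * h.o2 +
      (-64/2197*x*c - 236/2197*x*d - 454/2197*x*e + 169370/199927*y*a - 1845/15379*y*b + 23328/28561*y*c -
      364398/199927*y*d + 139942/199927*y*e - 10134307/1999270*z*a + 134441/109850*z*b + 10240/28561*z*c -
      8443618/4998175*z*d + 11032318/4998175*z*e) * h.o3 + (-10/169*x*d + 292/2197*x*e + 7782/199927*y*a -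
      4971/15379*y*b + 121288/199927*y*c - 13163/28561*y*d + 252299/399854*y*e - 2491734/714025*z*a -
      202831/109850*z*b + 8470218/4998175*z*c + 18573/28561*z*d - 583668/199927*z*e) * h.o4 + (-271/4394*x*e +
      19212/199927*y*a + 14265/30758*y*b - 176651/399854*y*c - 61435/399854*y*d - 931/4394*y*e +
      11042869/9996350*z*a + 101939/109850*z*b + 2617857/19992700*z*c + 36513/799708*z*d + 141/4394*z*e) * h.o5
      + (1403/4394*y*b - 905831/384475*z*a + 32419/30758*z*b + 1702074/384475*z*c - 208467/109850*z*d) * h.o6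

/-- rational part of `M` -/
def mm0 {K : Type*} [Field K] (x y z a b c : K) : K := 8669/432*x^2*a - 1675/432*x^2*b - 169/48*x^2*c + 71/288*x*y*a + 12211/864*x*y*b - 2815/288*x*z*a +
  49/108*x*z*b - 16565/864*y^2*a - 10211/288*y^2*b - 28163/864*y*z*a + 2143/432*y*z*b + 425/36*z^2*a +
  821/108*z^2*b

/-- irrational part of `M` -/
def mm1 {K : Type*} [Field K] (x y z a b c : K) : K := -307/432*x^2*a + 5/432*x^2*b - 169/48*x^2*c + 2327/288*x*y*a + 4771/864*x*y*b + 1457/288*x*z*a +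
  1159/108*x*z*b - 5573/864*y^2*a - 515/288*y^2*b + 6733/864*y*z*a - 2129/432*y*z*b + 17/36*z^2*a -
  433/108*z^2*b

theorem XP.sextic0 {K : Type*} [Field K] [CharZero K] {x y z a b c d e : K} (h : XP x y z a b c d e) :
    mm0 x y z a b c ^ 2 + 13 * mm1 x y z a b c ^ 2 = -4172/27*x^6 + 4486/9*x^5*y + 4804/9*x^5*z - 13693/18*x^4*y^2 - 28853/27*x^4*y*z - 139514/81*x^4*z^2 +
      23890/27*x^3*y^3 - 19031/54*x^3*y^2*z + 1044649/162*x^3*y*z^2 - 32846/81*x^3*z^3 - 7222/9*x^2*y^4 +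
      40675/18*x^2*y^3*z - 5819153/648*x^2*y^2*z^2 + 951937/972*x^2*y*z^3 + 48979/972*x^2*z^4 + 7675/18*x*y^5 -
      199423/108*x*y^4*z + 1785307/324*x*y^3*z^2 - 724679/972*x*y^2*z^3 - 2453/18*x*y*z^4 + 19961/972*x*z^5 -
      9949/108*y^6 + 8539/18*y^5*z - 101590/81*y^4*z^2 + 246085/1458*y^3*z^3 + 511757/5832*y^2*z^4 -
      67279/2916*y*z^5 + 8939/5832*z^6 := by
  unfold mm0 mm1
  linear_combination (4172/4563*x^4 - 4486/1521*x^3*y - 4804/1521*x^3*z + 13693/3042*x^2*y^2 + 28853/4563*x^2*y*z +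
      139514/13689*x^2*z^2 - 23890/4563*x*y^3 + 19031/9126*x*y^2*z - 1044649/27378*x*y*z^2 + 32846/13689*x*z^3
      + 7222/1521*y^4 - 40675/3042*y^3*z + 5819153/109512*y^2*z^2 - 951937/164268*y*z^3 - 48979/164268*z^4) *
      h.g1 + (-7675/3042*y^4 + 199423/18252*y^3*z - 1785307/54756*y^2*z^2 + 724679/164268*y*z^3 +
      2453/3042*z^4) * h.g2 + (-19961/328536*z^4) * h.g3 + (9949/36504*y^4 - 8539/6084*y^3*z +
      50795/13689*y^2*z^2 - 246085/492804*y*z^3 - 511757/1971216*z^4) * h.g4 + (67279/492804*z^4) * h.g5 +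
      (-8939/985608*z^4) * h.g6 + (38188399/1213056*x^3*a - 7270265/606528*x^3*b - 30407/5184*x^3*c +
      20860/19773*x^3*d + 1881572/59319*x^3*e + 63369461/1213056*x^2*y*a + 2868417619/205006464*x^2*y*b -
      6171364237/22778496*x^2*y*c - 320172019/12812904*x^2*y*d - 23995987109/205006464*x^2*y*e +
      110995805/606528*x^2*z*a - 47478728647/410012928*x^2*z*b - 150675881/5694624*x^2*z*c +
      31033905947/205006464*x^2*z*d - 13451709941/25625808*x^2*z*e + 193677145/1617408*x*y^2*a +
      53885531/5061888*x*y^2*b - 565833678949/666271008*x*y^2*c - 1480632232577/5330168064*x*y^2*d -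
      19693702967/148060224*x*y^2*e + 63020879/89856*x*y*z*a + 518502259/17083872*x*y*z*b -
      18495504168137/5330168064*x*y*z*c - 978808911139/1184481792*x*y*z*d - 3071032297121/1776722688*x*y*z*e +
      6549201703/4852224*x*z^2*a - 43106549585/51251616*x*z^2*b - 450099691927/666271008*x*z^2*c +
      6304972214285/5330168064*x*z^2*d - 635998491473/222090336*x*z^2*e + 9066223/67392*y^3*a -
      11992556311/60742656*y^3*b - 8966536045733/7106890752*y^3*c - 21460486009/273341952*y^3*d -
      70902638705/98706816*y^3*e + 96596009/41472*y^2*z*a - 1283886498403/2551191552*y^2*z*b -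
      171629812729315/33165490176*y^2*z*c + 13690272287099/16582745088*y^2*z*d -
      250952312575327/49748235264*y^2*z*e + 18789960643/2426112*y*z^2*a - 52718170518983/35716681728*y*z^2*b -
      17658621253772341/1392950587392*y*z^2*c + 4196470263776209/2089425881088*y*z^2*d -
      28327723765394857/2089425881088*y*z^2*e + 45781456705/4852224*z^3*a - 37582832540527/172205429760*z^3*b -
      49019895851406845/12536555286528*z^3*c + 2571589920355307/746223528960*z^3*d -
      46363705785982387/2611782351360*z^3*e) * h.o1 + (438960823/410012928*x^3*b - 73131275/22778496*x^3*c +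
      177310/19773*x^3*d + 346276/59319*x^3*e - 2353261567/410012928*x^2*y*b + 138959586041/5330168064*x^2*y*c
      - 81698454935/3553445376*x^2*y*d - 50435782219/5330168064*x^2*y*e + 1316522299/410012928*x^2*z*b -
      14084675641/666271008*x^2*z*c - 10965119861/197413632*x^2*z*d + 33417915605/666271008*x^2*z*e +
      58888273435/1640051712*x*y^2*b - 119424542057/5330168064*x*y^2*c + 153734035199/3553445376*x*y^2*d +
      30627473791/1332542016*x*y^2*e + 12375051679/205006464*x*y*z*b + 2681630658275/5330168064*x*y*z*c +
      156615119179/666271008*x*y*z*d + 157433571107/1184481792*x*y*z*e + 94674065009/820025856*x*z^2*b +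
      11483489471/136670976*x*z^2*c - 937493895545/10660336128*x*z^2*d + 1050246759227/1332542016*x*z^2*e +
      80565246617/1093367808*y^3*a - 14005692767/273341952*y^3*b - 13701911409851/42641344512*y^3*c -
      4634627100929/42641344512*y^3*d - 780857125049/7106890752*y^3*e + 16577102309701/45921447936*y^2*z*a -
      45021699095/546683904*y^2*z*b - 314900560430633/596978823168*y^2*z*c - 362399184943/22960723968*y^2*z*d -
      7258444742425/18655588224*y^2*z*e + 10431482118079/642900271104*y*z^2*a - 33349234001/205006464*y*z^2*b +
      1319438348091391/642900271104*y*z^2*c - 3555447675958691/12536555286528*y*z^2*d +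
      305961288932491/1567069410816*y*z^2*e - 1076610436641473/344410859520*z^3*a +
      216173519191/820025856*z^3*b + 4414847738546573/8954682347520*z^3*c -
      1746033960300481/1119335293440*z^3*d + 2828448178425953/559667646720*z^3*e) * h.o2 +
      (84274477/7592832*x^3*c - 492296/59319*x^3*d - 947044/59319*x^3*e - 248388553/9253764*x^2*y*c -
      23374783999/296120448*x^2*y*d - 7361225779/296120448*x^2*y*e - 586696711/74030112*x^2*z*c +
      7942808725/148060224*x^2*z*d - 1050431731/37015056*x^2*z*e + 16007501442409/8661523104*x*y^2*c +
      90185873622707/69292184832*x*y^2*d + 615146239663/666271008*x*y^2*e + 7506218088019/8661523104*x*y*z*c -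
      10663714512455/11548697472*x*y*z*d + 1412628516251/333135504*x*y*z*e + 342245222321/4330761552*x*z^2*c -
      1861489587665/4330761552*x*z^2*d + 33863788987/41641938*x*z^2*e + 661206533553167/277168739328*y^3*a +
      1638882589397/7106890752*y^3*b - 905543036592143/75066533568*y^3*c - 2564009131769035/600532268544*y^3*d
      - 954888753038413/600532268544*y^3*e + 32333791074653503/3880362350592*y^2*z*a -
      10549566494859331/3880362350592*y^2*z*b + 926788591245079/150133067136*y^2*z*c +
      87998194245989917/12611177639424*y^2*z*d - 538387367554421137/25222355278848*y^2*z*e -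
      584817137358367741/54325072908288*y*z^2*a + 75270707354374585/54325072908288*y*z^2*b +
      661927794108535/150133067136*y*z^2*c - 347734240447058533/132417365213952*y*z^2*d +
      20723886169092421157/1059338921711616*y*z^2*e - 213355798571285287/162975218724864*z^3*a +
      14968199985797911/58205435258880*z^3*b + 39759445829683/75066533568*z^3*c -
      701504125958285411/5296694608558080*z^3*d + 12204335255376622843/2648347304279040*z^3*e) * h.o3 +
      (-20860/4563*x^3*d + 609112/59319*x^3*e - 3011776/257049*x^2*y*d - 13467635/257049*x^2*y*e +
      31532048/771147*x^2*z*d - 146854658/771147*x^2*z*e + 2233076351083/10660336128*x*y^2*d +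
      13081379788541/34646092416*x*y^2*e - 400057309393/666271008*x*y*z*d + 302675315927/240597864*x*y*z*e +
      35302435459/166567752*x*z^2*d - 495939687491/541345194*x*z^2*e + 1376880191083/962391456*y^3*a +
      2179206275/444180672*y^3*b - 2156261454177793/300266134272*y^3*c - 147825341585593/75066533568*y^3*d -
      186305525631863/100088711424*y^3*e + 11048965993747231/1940181175296*y^2*z*a -
      3331306788247237/1940181175296*y^2*z*b + 8909009066106287/3152794409856*y^2*z*c +
      10436292974181805/1801596805632*y^2*z*d - 41960831188343069/3152794409856*y^2*z*e -
      140523979131649457/27162536454144*y*z^2*a + 106730980660714919/81487609362432*y*z^2*b +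
      59049034593813169/33104341303488*y*z^2*c - 105695039873783/56299900176*y*z^2*d +
      1805857314155614435/176556486951936*y*z^2*e + 9707395308752629/9700905876480*z^3*a +
      5521457792391689/3637839703680*z^3*b - 3899820125601490189/5296694608558080*z^3*c -
      27202821978929/28149950088*z^3*d + 15964492379675297/7356520289664*z^3*e) * h.o4 + (-282653/59319*x^3*e +
      1012105/118638*x^2*y*e - 862231/118638*x^2*z*e + 4041783682951/138584369664*x*y^2*e +
      2815182042583/8661523104*x*y*z*e + 321188556469/2165380776*x*z^2*e + 3303442620367/20531017728*y^3*a +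
      15160519951/1184481792*y^3*b - 5928651524111089/7206387222528*y^3*c -
      1406805927005575/7206387222528*y^3*d - 52362586838191/200177422848*y^3*e +
      873013371282911/862302744576*y^2*z*a - 317008782149795/1940181175296*y^2*z*b -
      163781158319252603/100889421115392*y^2*z*c + 3503337788662913/16814903519232*y^2*z*d -
      7143301192014187/3603193611264*y^2*z*e + 165482375924451293/108650145816576*y*z^2*a -
      3175545099945593/5092975585152*y*z^2*b - 8536991062660322069/4237355686846464*y*z^2*c +
      273390037750189309/706225947807744*y*z^2*d - 637469594897183/225199600704*y*z^2*e +
      120694293014673191/135812682270720*z^3*a - 9099544940874809/14551358814720*z^3*b -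
      1269530099140755643/10593389217116160*z^3*c + 21808832312149327/29426081158656*z^3*d -
      789590523935/231686832*z^3*e) * h.o5 + (9120779383/91113984*y^3*b - 13124135041/182227968*y^2*z*b -
      85214541277/2551191552*y*z^2*b + 776638834645963/1607250677760*z^3*a - 235885778826629/321450135552*z^3*b
      - 739311449149579/1205438008320*z^3*c + 19456217937083/10933678080*z^3*d) * h.o6

theorem XP.sextic1 {K : Type*} [Field K] [CharZero K] {x y z a b c d e : K} (h : XP x y z a b c d e) :
    2 * mm0 x y z a b c * mm1 x y z a b c = 448/27*x^6 - 614/9*x^5*y + 568/9*x^5*z + 2099/18*x^4*y^2 - 1751/27*x^4*y*z - 34994/81*x^4*z^2 -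
      2486/27*x^3*y^3 - 18731/54*x^3*y^2*z + 273739/162*x^3*y*z^2 - 10001/81*x^3*z^3 + 146/9*x^2*y^4 +
      13975/18*x^2*y^3*z - 1573265/648*x^2*y^2*z^2 + 286291/972*x^2*y*z^3 + 3556/243*x^2*z^4 + 343/18*x*y^5 -
      61717/108*x*y^4*z + 491983/324*x*y^3*z^2 - 210821/972*x*y^2*z^3 - 370/9*x*y*z^4 + 5819/972*x*z^5 -
      220/27*y^6 + 1292/9*y^5*z - 112999/324*y^4*z^2 + 68491/1458*y^3*z^3 + 149369/5832*y^2*z^4 -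
      18223/2916*y*z^5 + 2123/5832*z^6 := by
  unfold mm0 mm1
  linear_combination (-448/4563*x^4 + 614/1521*x^3*y - 568/1521*x^3*z - 2099/3042*x^2*y^2 + 1751/4563*x^2*y*z +
      34994/13689*x^2*z^2 + 2486/4563*x*y^3 + 18731/9126*x*y^2*z - 273739/27378*x*y*z^2 + 10001/13689*x*z^3 -
      146/1521*y^4 - 1075/234*y^3*z + 1573265/109512*y^2*z^2 - 286291/164268*y*z^3 - 3556/41067*z^4) * h.g1 +
      (-343/3042*y^4 + 61717/18252*y^3*z - 491983/54756*y^2*z^2 + 16217/12636*y*z^3 + 370/1521*z^4) * h.g2 +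
      (-5819/328536*z^4) * h.g3 + (110/4563*y^4 - 646/1521*y^3*z + 112999/109512*y^2*z^2 - 68491/492804*y*z^3 -
      149369/1971216*z^4) * h.g4 + (18223/492804*z^4) * h.g5 + (-2123/985608*z^4) * h.g6 +
      (-2661383/1213056*x^3*a + 21445/46656*x^3*b - 54353/5184*x^3*c - 2240/19773*x^3*d - 202048/59319*x^3*e +
      24903683/1213056*x^2*y*a + 2355515317/205006464*x^2*y*b - 68174971/22778496*x^2*y*c +
      16954667/12812904*x^2*y*d + 2764920109/205006464*x^2*y*e + 806363/606528*x^2*z*a +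
      14376368831/410012928*x^2*z*b - 203939831/5694624*x^2*z*c - 2733870739/205006464*x^2*z*d +
      380587693/25625808*x^2*z*e + 38087551/1617408*x*y^2*a + 202944941/5061888*x*y^2*b -
      55049132083/666271008*x*y^2*c + 8970313705/5330168064*x*y^2*d - 3119531537/148060224*x*y^2*e +
      14559449/89856*x*y*z*a + 1642806499/17083872*x*y*z*b + 955630189057/5330168064*x*y*z*c +
      168475715483/1184481792*x*y*z*d - 44782543223/1776722688*x*y*z*e + 9054337/4852224*x*z^2*a +
      9729356029/51251616*x*z^2*b - 130867867207/666271008*x*z^2*c - 908131417429/5330168064*x*z^2*d +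
      158734822633/222090336*x*z^2*e + 1551361/67392*y^3*a - 16971095671/425198592*y^3*b -
      10594430119685/49748235264*y^3*c - 1996061214661/24874117632*y^3*d - 3739646369/690947712*y^3*e +
      239082851/539136*y^2*z*a - 1308144363139/17858340864*y^2*z*b - 251507991293443/232158431232*y^2*z*c -
      46451812746085/116079215616*y^2*z*d - 153518768521663/348237646848*y^2*z*e + 2706456421/2426112*y*z^2*a -
      118351388294759/250016772096*y*z^2*b - 815318934004501/9750654111744*y*z^2*c +
      1612636553372977/14625981167616*y*z^2*d - 220025754270433/86544267264*y*z^2*e + 8039923/373248*z^3*a -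
      1670857747349579/6027190041600*z^3*b - 167751823611680593/438779435028480*z^3*c +
      401020748674003/2009063347200*z^3*d + 14647657050242401/91412382297600*z^3*e) * h.o1 +
      (-23091407/410012928*x^3*b + 34170355/22778496*x^3*c - 19040/19773*x^3*d - 37184/59319*x^3*e -
      580992937/410012928*x^2*y*b - 45168966097/5330168064*x^2*y*c + 13333040815/3553445376*x^2*y*d +
      11916820931/5330168064*x^2*y*e - 1465754339/410012928*x^2*z*b + 20088671/666271008*x^2*z*c -
      434041091/197413632*x^2*z*d - 3078617917/666271008*x^2*z*e + 10059300973/1640051712*x*y^2*b -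
      100588578287/5330168064*x*y^2*c - 42394733143/3553445376*x*y^2*d - 17235905591/1332542016*x*y^2*e +
      1888627189/205006464*x*y*z*b - 717662604283/5330168064*x*y*z*c - 3749520145/333135504*x*y*z*d -
      124995601435/1184481792*x*y*z*e - 9022846201/820025856*x*z^2*b - 38332947691/1776722688*x*z^2*c +
      939532889569/10660336128*x*z^2*d - 337274956339/1332542016*x*z^2*e + 17047773341/588736512*y^3*a -
      4567763321/273341952*y^3*b - 59852989749083/298489411584*y^3*c - 6449405936993/298489411584*y^3*d -
      3068845491737/49748235264*y^3*e + 83939661864229/321450135552*y^2*z*a - 31519455473/546683904*y^2*z*b -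
      1834813325112329/4178851762176*y^2*z*c + 188516221995869/2089425881088*y^2*z*d -
      65951325891985/130589117568*y^2*z*e + 3116406020087263/4500301897728*y*z^2*a -
      12276532091/205006464*y*z^2*b - 3984890430100577/4500301897728*y*z^2*c +
      2057795205812029/87755887005696*y*z^2*d - 12153801947946005/10969485875712*y*z^2*e +
      9394263360805979/12054380083200*z^3*a - 63458228399/820025856*z^3*b -
      46433078252429279/313413882163200*z^3*c + 12153335431709083/39176735270400*z^3*d -
      30611285842907579/19588367635200*z^3*e) * h.o2 + (16315435/7592832*x^3*c + 52864/59319*x^3*d +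
      101696/59319*x^3*e + 317225381/9253764*x^2*y*c + 2970917447/296120448*x^2*y*d +
      2863117451/296120448*x^2*y*e + 463063583/74030112*x^2*z*c - 1202202557/148060224*x^2*z*d +
      3095729675/37015056*x^2*z*e - 1938910189409/8661523104*x*y^2*c - 12957035262427/69292184832*x*y^2*d -
      125352510551/666271008*x*y^2*e + 974780506381/8661523104*x*y*z*c + 3948429248935/11548697472*x*y*z*d -
      358268903329/333135504*x*y*z*e + 112199452715/4330761552*x*z^2*c - 231641732501/4330761552*x*z^2*d +
      6290687215/41641938*x*z^2*e - 1165587781719505/1940181175296*y^3*a + 200492047817/3826787328*y^3*b +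
      223547256065959/75066533568*y^3*c + 4013943520006037/4203725879808*y^3*d +
      2101186220912915/4203725879808*y^3*e - 73491789112622369/27162536454144*y^2*z*a +
      16123720596161309/27162536454144*y^2*z*b - 19432558398047/150133067136*y^2*z*c -
      106040143924803395/88278243475968*y^2*z*d + 1013508929350564559/176556486951936*y^2*z*e +
      342289241291354915/380275510358016*y*z^2*a + 144281924802505753/380275510358016*y*z^2*b +
      163913628119953/150133067136*y*z^2*c + 532925226688722443/926921556497664*y*z^2*d -
      12790114035198782587/7415372451981312*y*z^2*e - 5060408039203813091/5704132655370240*z^3*a +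
      485187743141348627/2037190234060800*z^3*b + 18383114615485/75066533568*z^3*c -
      78348702645400356367/185384311299532800*z^3*d + 206147187209978376071/92692155649766400*z^3*e) * h.o3 +
      (2240/4563*x^3*d - 65408/59319*x^3*e + 211634/257049*x^2*y*d + 1697260/257049*x^2*y*e -
      638392/771147*x^2*z*d + 9598096/771147*x^2*z*e - 310358160035/10660336128*x*y^2*d -
      2398703807701/34646092416*x*y^2*e + 76334884505/666271008*x*y*z*d - 60292946563/240597864*x*y*z*e -
      18270615851/166567752*x*z^2*d + 437785861663/541345194*x*z^2*e - 1719522534293/6736740192*y^3*a -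
      2860001965/239174208*y^3*b + 2611783413714719/2101862939904*y^3*c + 26348570551457/75066533568*y^3*d +
      219495456502345/700620979968*y^3*e - 8495367594882689/13581268227072*y^2*z*a +
      2434975726936667/13581268227072*y^2*z*b - 59216447532241729/22069560868992*y^2*z*c -
      2646868791963365/1801596805632*y^2*z*d + 38615780540601115/22069560868992*y^2*z*e +
      582160692582879535/190137755179008*y*z^2*a - 320837146136023225/570413265537024*y*z^2*b -
      302252067983127287/231730389124416*y*z^2*c + 37705058280473/28149950088*y*z^2*d -
      7939165657934521085/1235895408663552*y*z^2*e + 116080193539613993/339531705676800*z^3*a -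
      36219759500663027/127324389628800*z^3*b - 53401962417665590433/185384311299532800*z^3*c +
      9381913607293/28149950088*z^3*d - 35973987708460351/51495642027648*z^3*e) * h.o4 + (30352/59319*x^3*e -
      162455/118638*x^2*y*e + 266590/59319*x^2*z*e - 1048508094719/138584369664*x*y^2*e -
      997223625119/8661523104*x*y*z*e - 709217073299/2165380776*x*z^2*e - 7492681755281/143717124096*y^3*a +
      7214187451/637797888*y^3*b + 14269647729130799/50444710557696*y^3*c +
      3284405614968281/50444710557696*y^3*d + 16948240119047/200177422848*y^3*e -
      3063312567331585/6036119212032*y^2*z*a + 1135041763695517/13581268227072*y^2*z*b +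
      1022417813318405221/706225947807744*y^2*z*c + 18583078955312513/117704324634624*y^2*z*d +
      3378554062284995/3603193611264*y^2*z*e - 1005853555077436099/760551020716032*y*z^2*a +
      10617018187858855/35650829096064*y*z^2*b + 28445382598434690571/29661489807925248*y*z^2*c -
      3188271317131296419/4943581634654208*y*z^2*d + 634972503364951/225199600704*y*z^2*e -
      2355140564754557213/4753443879475200*z^3*a + 76562689485511427/509297558515200*z^3*b +
      64173708590192179129/370768622599065600*z^3*c - 64491366987762641/205982568110592*z^3*d +
      241426987993/231686832*z^3*e) * h.o5 + (857571217/91113984*y^3*b + 35439243167/1275595776*y^2*z*b +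
      74999879183/1373718528*y*z^2*b + 843761943800471/56253773721600*z^3*a -
      167527741781093/2250150948864*z^3*b - 4058656985451863/42190330291200*z^3*c +
      12494511890113/54668390400*z^3*d) * h.o6

theorem XP.sextic2 {K : Type*} [Field K] [CharZero K] {x y z a b c d e : K} (h : XP x y z a b c d e) :
    mm0 x y z a b c ^ 2 - 13 * mm1 x y z a b c ^ 2 = -12051*x^3*y^3 - 282893/18*x^3*y^2*z + 164749/54*x^3*y*z^2 - 207649/18*x^3*z^3 + 151463/6*x^2*y^4 +
      2629211/18*x^2*y^3*z + 1354951/36*x^2*y^2*z^2 - 16314493/108*x^2*y*z^3 + 2841293/108*x^2*z^4 -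
      46852*x*y^5 - 1415921/12*x*y^4*z + 4217135/36*x*y^3*z^2 + 1725217/9*x*y^2*z^3 - 14249729/108*x*y*z^4 +
      579475/108*x*z^5 + 124865/4*y^6 - 31213/3*y^5*z - 2082691/18*y^4*z^2 - 672308/27*y^3*z^3 +
      1578850/27*y^2*z^4 + 1135615/54*y*z^5 - 122447/12*z^6 := by
  unfold mm0 mm1
  linear_combination (927/13*x*y^3 + 21761/234*x*y^2*z - 12673/702*x*y*z^2 + 15973/234*x*z^3 - 11651/78*y^4 - 202247/234*y^3*z
      - 104227/468*y^2*z^2 + 1254961/1404*y*z^3 - 218561/1404*z^4) * h.g1 + (3604/13*y^4 + 108917/156*y^3*z -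
      324395/468*y^2*z^2 - 132709/117*y*z^3 + 1096133/1404*z^4) * h.g2 + (-44575/2808*z^4) * h.g3 +
      (-9605/104*y^4 + 2401/78*y^3*z + 160207/468*y^2*z^2 + 25858/351*y*z^3 - 60725/351*z^4) * h.g4 +
      (-87355/702*z^4) * h.g5 + (9419/156*z^4) * h.g6 + (684503/22464*x^3*a - 44755/3744*x^3*b -
      13715/864*x^3*c + 1644077/22464*x^2*y*a + 23625/832*x^2*y*b - 20115463/97344*x^2*y*c -
      684503/18252*x^2*y*d - 15743569/292032*x^2*y*e + 2137589/11232*x^2*z*a - 3941711/44928*x^2*z*b -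
      1777991/8112*x^2*z*c + 28064623/292032*x^2*z*d - 15743569/36504*x^2*z*e + 1144499/89856*x*y^2*a -
      6329413/44928*x*y^2*b - 31073149/73008*x*y^2*c - 12147163/194688*x*y^2*d - 15808135/146016*x*y^2*e +
      32404573/44928*x*y*z*a - 3285517/11232*x*y*z*b - 301417477/584064*x*y*z*c + 58451959/389376*x*y*z*d -
      563441779/584064*x*y*z*e + 13488983/9984*x*z^2*a - 1217299/1404*x*z^2*b - 9462409/11232*x*z^2*c -
      355493/14976*x*z^2*d - 4429343/5616*x*z^2*e + 1448713/11232*y^3*a + 3772145801/1817088*y^3*b -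
      409851002069/212599296*y^3*c + 35752359035/106299648*y^3*d + 19056573617/8858304*y^3*e +
      3452771/2304*y^2*z*a + 1100019152839/228953088*y^2*z*b - 10127039334521/2976390144*y^2*z*c +
      1274748201145/165355008*y^2*z*d - 3926416508725/496065024*y^2*z*e + 346569827/44928*y*z^2*a +
      681640077379/356149248*y*z^2*b + 129607296551867/41669462016*y*z^2*c +
      490843495557643/20834731008*y*z^2*d - 348324985022545/6944910336*y*z^2*e + 94197937/9984*z^3*a -
      399733027854889/8585740800*z^3*b + 25044496447974037/625041930240*z^3*c +
      1585546558489549/37204876800*z^3*d - 12142108915780709/130217068800*z^3*e) * h.o1 + (25975/44928*x^3*b +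
      1885/1728*x^3*c - 64085/14976*x^2*y*b + 31469197/584064*x^2*y*c + 7683835/1168128*x^2*y*d +
      1928855/194688*x^2*y*e + 25655/4992*x^2*z*b + 9287017/146016*x^2*z*c - 10256455/584064*x^2*z*d +
      1928855/24336*x^2*z*e + 544811/179712*x*y^2*b - 14006579/194688*x*y^2*c - 4561025/389376*x*y^2*d -
      327425/16224*x*y^2*e - 787441/11232*x*y*z*b + 47252923/584064*x*y*z*c + 4838995/97344*x*y*z*d -
      148746437/1168128*x*y*z*e - 145619/6912*x*z^2*b + 6560963/194688*x*z^2*c - 15575635/389376*x*z^2*d +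
      39850363/146016*x*z^2*e - 37524149111/32707584*y^3*a + 1262315/129792*y^3*b +
      159298600583/425198592*y^3*c + 56366358653/47244288*y^3*d - 287757658889/212599296*y^3*e -
      486607171859/152635392*y^2*z*a + 392588839/2336256*y^2*z*b + 23874936759437/5952780288*y^2*z*c +
      4646240187181/992130048*y^2*z*d - 1311660898673/186024384*y^2*z*e - 22409500419835/6410686464*y*z^2*a +
      42360295/146016*y*z^2*b + 886586754010081/83338924032*y*z^2*c + 1381815612586319/125008386048*y*z^2*d -
      261765793239319/15626048256*y*z^2*e + 334929023535289/17171481600*z^3*a + 624510379/1168128*z^3*b -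
      320729634553/34342963200*z^3*c + 57742310086781/4292870400*z^3*d - 15039613886653/2146435200*z^3*e) *
      h.o2 + (-2197/192*x^3*c + 5692/27*x^2*y*c + 77357/1728*x^2*y*d + 94373/1728*x^2*y*e + 22169/432*x^2*z*c -
      101411/864*x^2*z*d + 94373/216*x^2*z*e - 387662233/316368*x*y^2*c - 1674583171/2530944*x*y^2*d -
      536330065/949104*x*y^2*e - 82143775/949104*x*y*z*c + 1877823667/1265472*x*y*z*d -
      4278486401/949104*x*y*z*e + 5785027/237276*x*z^2*c + 5131921/35152*x*z^2*d + 4051373/39546*x*z^2*e -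
      341474321015/212599296*y^3*a - 10980673667/23622144*y^3*b + 128407775105/8225568*y^3*c +
      401996108851/460631808*y^3*d + 1440288253717/460631808*y^3*e - 54730858127431/2976390144*y^2*z*a -
      8604832342261/2976390144*y^2*z*b + 368291206321/49353408*y^2*z*c - 133625889068773/9673267968*y^2*z*d +
      227713680477203/6448845312*y^2*z*e - 789340752329963/41669462016*y*z^2*a -
      44225062878901/3205343232*y*z^2*b + 99591657535/16451136*y*z^2*c - 2024368118494847/101569313664*y*z^2*d
      + 25039280176117219/812554509312*y*z^2*e - 29599893191133397/625041930240*z^3*a +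
      303756312800389/223229260800*z^3*b + 7060360757/8225568*z^3*c - 660770492468934569/20313862732800*z^3*d +
      433469908745204497/10156931366400*z^3*e) * h.o3 + (-1241389777/15185664*x*y^2*d -
      596888615/3796416*x*y^2*e + 390427579/949104*x*y*z*d - 68863855/79092*x*y*z*e - 122343433/237276*x*z^2*d
      + 183705485/59319*x*z^2*e - 9938964907/6643728*y^3*a - 1820847935/2214576*y^3*b +
      141687982349/17716608*y^3*c + 1892260561/1898208*y^3*d + 155217321131/53149824*y^3*e -
      18193202556023/1488195072*y^2*z*a - 3105465405089/496065024*y^2*z*b - 707735591807/186024384*y^2*z*c -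
      95950677259/15185664*y^2*z*d + 531746901173/62008128*y^2*z*e - 77708342722541/6944910336*y*z^2*a -
      1534878590194223/62504193024*y*z^2*b + 13806226522769/1953256032*y*z^2*c + 8416902583/1898208*y*z^2*d -
      384994806497911/10417365504*y*z^2*e - 1098616735755649/37204876800*z^3*a -
      32331833304553/1073217600*z^3*b + 43196966207357213/1562604825600*z^3*c + 247569682/59319*z^3*d -
      47652018090167/1302170688*z^3*e) * h.o4 + (-251014609/15185664*x*y^2*e - 251014609/949104*x*y*z*e -
      251014609/237276*x*z^2*e - 4220856193/32707584*y^3*a + 34191621803/35433216*y^3*b +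
      4633671345001/5527581696*y^3*c + 10800803997/204725248*y^3*d - 12487923719/197413632*y^3*e -
      1825488041855/5952780288*y^2*z*a + 6925611623395/1488195072*y^2*z*b + 21817323462681/2866153472*y^2*z*c +
      5284186714949/4299230208*y^2*z*d + 1585822916605/394827264*y^2*z*e - 41812310207573/83338924032*y*z^2*a +
      45243885127985/3906512064*y*z^2*b + 13155104341759277/3250218037248*y*z^2*c -
      86718164747303/180567668736*y*z^2*d + 50045201389/2741856*y*z^2*e + 5916446451839509/520868275200*z^3*a +
      425909339155189/55807315200*z^3*b - 280655899559257297/40627725465600*z^3*c +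
      119729275410331/67712875776*z^3*d + 22701774103/1542294*z^3*e) * h.o5 + (74281475/129792*y^3*b +
      4301944357/1817088*y^2*z*b + 586550898931/76317696*y*z^2*b - 847188102724339/80133580800*z^3*a +
      63223086836473/3205343232*z^3*b + 52761304954559/4623091200*z^3*c - 11554000707151/233625600*z^3*d) *
      h.o6

end

section
/-- rational part of `l` -/
def fl0 {K : Type*} [Field K] (n B : K) : K := n/2 + 25/36*B
/-- irrational part of `l` -/
def fl1 {K : Type*} [Field K] (B : K) : K := B/36
/-- rational part of `N` -/
def fN0 {K : Type*} [Field K] (n B t : K) : K := -17/12*n^2 + 91/12*n*t - 79/12*n*B + 455/36*B*t - 385/54*B^2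
/-- irrational part of `N` -/
def fN1 {K : Type*} [Field K] (n B t : K) : K := 1/12*n^2 + 13/12*n*t - 1/12*n*B + 65/36*B*t - 19/54*B^2
/-- rational part of the right side -/
def fR0 {K : Type*} [Field K] (N0 N1 l0 l1 : K) : K := N0^3 + 39*N0*N1^2
  + (-13/2)*((l0^2+13*l1^2)*((N0+4*(l0^2+13*l1^2))^2+13*(N1+8*l0*l1)^2) + 13*(2*l0*l1)*(2*(N0+4*(l0^2+13*l1^2))*(N1+8*l0*l1)))
  + (-143/2)*((l0^2+13*l1^2)*(2*(N0+4*(l0^2+13*l1^2))*(N1+8*l0*l1)) + (2*l0*l1)*((N0+4*(l0^2+13*l1^2))^2+13*(N1+8*l0*l1)^2))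
/-- irrational part of the right side -/
def fR1 {K : Type*} [Field K] (N0 N1 l0 l1 : K) : K := 3*N0^2*N1 + 13*N1^3
  + (-11/2)*((l0^2+13*l1^2)*((N0+4*(l0^2+13*l1^2))^2+13*(N1+8*l0*l1)^2) + 13*(2*l0*l1)*(2*(N0+4*(l0^2+13*l1^2))*(N1+8*l0*l1)))
  + (-13/2)*((l0^2+13*l1^2)*(2*(N0+4*(l0^2+13*l1^2))*(N1+8*l0*l1)) + (2*l0*l1)*((N0+4*(l0^2+13*l1^2))^2+13*(N1+8*l0*l1)^2))

theorem sq13 {L : Type*} [Field L] [CharZero L] (s N0 N1 l0 l1 m0 m1 : L) (hs : s^2 = 13)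
    (h0 : m0^2 + 13*m1^2 = fR0 N0 N1 l0 l1) (h1 : 2*m0*m1 = fR1 N0 N1 l0 l1) :
    (m0 + s*m1)^2 = (N0+s*N1)^3 + (-13/2-11/2*s)*(l0+s*l1)^2*((N0+s*N1)+4*(l0+s*l1)^2)^2 := by
  have e1 : (l0+s*l1)^2 = (l0^2+13*l1^2) + s*(2*l0*l1) := by linear_combination l1^2*hs
  have e2 : (N0+s*N1)^3 = N0^3 + 39*N0*N1^2 + s*(3*N0^2*N1 + 13*N1^3) := by
    linear_combination (3*N0*N1^2 + s*N1^3)*hs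
  have e3 : ((N0+s*N1)+4*(l0+s*l1)^2)^2 = ((N0+4*(l0^2+13*l1^2))^2+13*(N1+8*l0*l1)^2)
      + s*(2*(N0+4*(l0^2+13*l1^2))*(N1+8*l0*l1)) := by
    rw [e1]; linear_combination (N1+8*l0*l1)^2*hs
  rw [e3, e1, e2]
  unfold fR0 at h0
  unfold fR1 at h1
  generalize N0+4*(l0^2+13*l1^2) = H0 at *
  generalize N1+8*l0*l1 = H1 at *
  generalize l0^2+13*l1^2 = A at *
  generalize H0^2 + 13*H1^2 = P at *
  linear_combination h0 + s*h1 + (m1^2 - (-13/2-11/2*s)*(2*l0*l1)*(2*H0*H1) - (-11/2)*(A*(2*H0*H1)+2*l0*l1*P))*hs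

theorem XP.nbt {K : Type*} [Field K] [CharZero K] {x y z a b c d e : K} (h : XP x y z a b c d e) (n B t : K)
    (hx : x = (n+3*t)/2) (hy : y = 2*t-B) (hz : z = 3*t-B) :
    n^4 + 7*n^3*B - 13*n^3*t - 136*n^2*B^2 + 689*n^2*B*t - 845*n^2*t^2 - 20*n*B^3 - 1092*n*B^2*t +
      5577*n*B*t^2 - 6591*n*t^3 + 352*B^4 - 3692*B^3*t + 11492*B^2*t^2 - 10985*B*t^3 = 0 ∧
    ∃ m0 m1 : K, m0^2 + 13*m1^2 = fR0 (fN0 n B t) (fN1 n B t) (fl0 n B) (fl1 B) ∧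
      2*m0*m1 = fR1 (fN0 n B t) (fN1 n B t) (fl0 n B) (fl1 B) ∧
      m0^2 - 13*m1^2 = 1957631/432*n^3*B^3 - 883363/27*n^3*B^2*t + 1447823/18*n^3*B*t^2 - 1083121/16*n^3*t^3 +
      9093253/432*n^2*B^4 - 20727005/216*n^2*B^3*t - 3139513/72*n^2*B^2*t^2 + 100699495/144*n^2*B*t^3 -
      799708*n^2*t^4 - 940225/108*n*B^5 + 66650051/216*n*B^4*t - 257059985/144*n*B^3*t^2 +
      119690363/36*n*B^2*t^3 - 19849895/24*n*B*t^4 - 32302491/16*n*t^5 - 1363271/27*B^6 + 66794377/108*B^5*t -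
      1063758839/432*B^4*t^2 + 712774907/216*B^3*t^3 + 57379049/72*B^2*t^4 - 53837485/16*B*t^5 := by
  refine ⟨?_, mm0 x y z a b c, mm1 x y z a b c, ?_, ?_, ?_⟩
  · have := h.quartic
    rw [hx, hy, hz] at this
    linear_combination 8 * this
  · rw [h.sextic0]; subst hx hy hz; unfold fR0 fN0 fN1 fl0 fl1; ring
  · rw [h.sextic1]; subst hx hy hz; unfold fR1 fN0 fN1 fl0 fl1; ring
  · rw [h.sextic2]; subst hx hy hz; ring

set_option maxHeartbeats 4000000 in
theorem relN {K : Type*} [Field K] [CharZero K] (n t a0 a1 z : K) (hq : n^4 - 13*n^3*t + 7*n^3 - 845*n^2*t^2 + 689*n^2*t - 136*n^2 - 6591*n*t^3 + 5577*n*t^2 - 1092*n*t - 20*n -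
      10985*t^3 + 11492*t^2 - 3692*t + 352 = 0)
    (h0 : fN0 n 1 t = a0*(fl0 n 1^2 + 13*fl1 1^2) + 26*a1*fl0 n 1*fl1 1)
    (h1 : fN1 n 1 t = a1*(fl0 n 1^2 + 13*fl1 1^2) + 2*a0*fl0 n 1*fl1 1)
    (hz : z*(fl0 n 1^2 - 13*fl1 1^2)^3 = -1083121/16*n^3*t^3 + 1447823/18*n^3*t^2 - 883363/27*n^3*t + 1957631/432*n^3 - 799708*n^2*t^4 +
      100699495/144*n^2*t^3 - 3139513/72*n^2*t^2 - 20727005/216*n^2*t + 9093253/432*n^2 - 32302491/16*n*t^5 -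
      19849895/24*n*t^4 + 119690363/36*n*t^3 - 257059985/144*n*t^2 + 66650051/216*n*t - 940225/108*n -
      53837485/16*t^5 + 57379049/72*t^4 + 712774907/216*t^3 - 1063758839/432*t^2 + 66794377/108*t - 1363271/27)
    (hl : fl0 n 1^2 - 13*fl1 1^2 ≠ 0) :
    (672 - 2080*a1 - 130*a1^2 + 442*a1^3 + 176*a0 - 416*a0*a1 + 26*a0^2 - 34*a0^2*a1 - 2/3*z)
     + n*(384 - 1456*a1 + 156*a1^2 + 325*a1^3 + 80*a0 - 312*a0*a1 - 13*a0*a1^2 + 12*a0^2 - 25*a0^2*a1 + 1*a0^3) = 0 ∧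
    (1920 - 4576*a1 + 286/3*a1^2 + 5525/6*a1^3 + 176*a0 - 2548/3*a0*a1 + 221/6*a0*a1^2 - 26/3*a0^2 -
      425/6*a0^2*a1 - 17/6*a0^3)
     + n*(1008 - 3120*a1 + 663*a1^2 + 663*a1^3 - 24*a0 - 624*a0*a1 - 27*a0^2 - 51*a0^2*a1 + 1*z) = 0 ∧
    (2624 - 40072/3*a1 + 140/3*a1^2 + 17017/6*a1^3 + 632/3*a0 - 7844/3*a0*a1 + 653/6*a0*a1^2 + 32/3*a0^2 -
      1309/6*a0^2*a1 - 653/78*a0^3 - 548/117*z + 25/18*a1*z + 1/18*a0*z)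
     + n*(1280 - 27760/3*a1 + 5020/3*a1^2 + 6227/3*a1^3 - 448/3*a0 - 5872/3*a0*a1 - 116/3*a0^2 - 479/3*a0^2*a1 +
      1*a1*z) = 0 ∧
    (5408 - 85384/3*a1 - 2470/3*a1^2 + 35425/6*a1^3 + 6440/3*a0 - 17636/3*a0*a1 + 1157/6*a0*a1^2 + 986/3*a0^2
      - 2725/6*a0^2*a1 - 89/6*a0^3 - 86/9*z + 13/18*a1*z + 25/18*a0*z)
     + n*(3200 - 60112/3*a1 + 7384/3*a1^2 + 12935/3*a1^3 + 3200/3*a0 - 13168/3*a0*a1 + 448/3*a0^2 - 995/3*a0^2*a1 +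
      1*a0*z) = 0 := by
  have hE : (9*n^2+25*n+17 : K) ≠ 0 := by
    intro h
    exact hl (by unfold fl0 fl1; linear_combination h/36)
  have k0 : a0*(9*n^2+25*n+17)^2 = -459*n^4 + 2457*n^3*t - 3447*n^3 + 10413*n^2*t - 9154*n^2 + 14664*n*t - 10398*n + 6890*t - 4320 := by
    unfold fN0 fN1 fl0 fl1 at *
    linear_combination (-(324*n^2 + 900*n + 638))*h0 + (468*n + 650)*h1
  have k1 : a1*(9*n^2+25*n+17)^2 = 27*n^4 + 351*n^3*t + 99*n^3 + 1287*n^2*t + 172*n^2 + 1482*n*t + 216*n + 520*t + 132 := by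
    unfold fN0 fN1 fl0 fl1 at *
    linear_combination (-(324*n^2 + 900*n + 638))*h1 + (36*n + 50)*h0
  have kz : z*(9*n^2+25*n+17)^3 = -3158380836*n^3*t^3 + 3752757216*n^3*t^2 - 1526451264*n^3*t + 211424148*n^3 - 37311176448*n^2*t^4 +
      32626636380*n^2*t^3 - 2034404424*n^2*t^2 - 4477033080*n^2*t + 982071324*n^2 - 94194063756*n*t^5 -
      38588195880*n*t^4 + 155118710448*n*t^3 - 83287435140*n*t^2 + 14396411016*n*t - 406177200*n -
      156990106260*t^5 + 37181623752*t^4 + 153959379912*t^3 - 114885954612*t^2 + 28855170864*t - 2355732288 := by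
    unfold fl0 fl1 at *
    linear_combination 46656*hz
  have hE6 := pow_ne_zero 6 hE
  refine ⟨?_, ?_, ?_, ?_⟩
  · apply (mul_eq_zero.mp ?_).resolve_right hE6
    have key : ∀ p0 p1 pz E : K, a0*E^2 = p0 → a1*E^2 = p1 → z*E^3 = pz →
        ((672 - 2080*a1 - 130*a1^2 + 442*a1^3 + 176*a0 - 416*a0*a1 + 26*a0^2 - 34*a0^2*a1 - 2/3*z)
          + n*(384 - 1456*a1 + 156*a1^2 + 325*a1^3 + 80*a0 - 312*a0*a1 - 13*a0*a1^2 + 12*a0^2 - 25*a0^2*a1 + 1*a0^3))*E^6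
        = (672*E^6 - 2080*p1^1*E^4 - 130*p1^2*E^2 + 442*p1^3 + 176*p0^1*E^4 - 416*p0^1*p1^1*E^2 + 26*p0^2*E^2 -
      34*p0^2*p1^1 - 2/3*pz*E^3)
          + n*(384*E^6 - 1456*p1^1*E^4 + 156*p1^2*E^2 + 325*p1^3 + 80*p0^1*E^4 - 312*p0^1*p1^1*E^2 - 13*p0^1*p1^2 +
      12*p0^2*E^2 - 25*p0^2*p1^1 + 1*p0^3) := by
      rintro _ _ _ E rfl rfl rfl; ring
    rw [key _ _ _ _ k0 k1 kz]
    linear_combination (4251528*n^9 + 72748368*n^8 - 1860752088*n^7*t + 1251523872*n^7 - 6945579576*n^6*t^2 - 21127417272*n^6*t +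
      11392963632*n^6 - 57879829800*n^5*t^2 - 100460142432*n^5*t + 53075520216*n^5 - 200135589264*n^4*t^2 -
      260434000008*n^4*t + 139834264896*n^4 - 367525009800*n^3*t^2 - 398719859616*n^3*t + 218999250576*n^3 -
      378033890832*n^2*t^2 - 361272683304*n^2*t + 202867343856*n^2 - 206509516200*n*t^2 - 179671191336*n*t +
      102910021560*n - 46808823672*t^2 - 37883003184*t + 22076663760)*hq
  · apply (mul_eq_zero.mp ?_).resolve_right hE6
    have key : ∀ p0 p1 pz E : K, a0*E^2 = p0 → a1*E^2 = p1 → z*E^3 = pz →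
        ((1920 - 4576*a1 + 286/3*a1^2 + 5525/6*a1^3 + 176*a0 - 2548/3*a0*a1 + 221/6*a0*a1^2 - 26/3*a0^2 -
      425/6*a0^2*a1 - 17/6*a0^3)
          + n*(1008 - 3120*a1 + 663*a1^2 + 663*a1^3 - 24*a0 - 624*a0*a1 - 27*a0^2 - 51*a0^2*a1 + 1*z))*E^6
        = (1920*E^6 - 4576*p1^1*E^4 + 286/3*p1^2*E^2 + 5525/6*p1^3 + 176*p0^1*E^4 - 2548/3*p0^1*p1^1*E^2 +
      221/6*p0^1*p1^2 - 26/3*p0^2*E^2 - 425/6*p0^2*p1^1 - 17/6*p0^3)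
          + n*(1008*E^6 - 3120*p1^1*E^4 + 663*p1^2*E^2 + 663*p1^3 - 24*p0^1*E^4 - 624*p0^1*p1^1*E^2 - 27*p0^2*E^2 -
      51*p0^2*p1^1 + 1*pz*E^3) := by
      rintro _ _ _ E rfl rfl rfl; ring
    rw [key _ _ _ _ k0 k1 kz]
    linear_combination (-17006112*n^9 + 2791128132*n^8*t - 1279946124*n^8 + 10418369364*n^7*t^2 + 31691125908*n^7*t -
      14799568968*n^7 + 86819744700*n^6*t^2 + 150690213648*n^6*t - 73866788136*n^6 + 300203383896*n^5*t^2 +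
      390651000012*n^5*t - 199887479784*n^5 + 551287514700*n^4*t^2 + 598079789424*n^4*t - 316770719868*n^4 +
      567050836248*n^3*t^2 + 541909024956*n^3*t - 294763509864*n^3 + 309764274300*n^2*t^2 + 269506787004*n^2*t
      - 149288369328*n^2 + 70213235508*n*t^2 + 56824504776*n*t - 31517877600*n + 225506700)*hq
  · apply (mul_eq_zero.mp ?_).resolve_right hE6
    have key : ∀ p0 p1 pz E : K, a0*E^2 = p0 → a1*E^2 = p1 → z*E^3 = pz →
        ((2624 - 40072/3*a1 + 140/3*a1^2 + 17017/6*a1^3 + 632/3*a0 - 7844/3*a0*a1 + 653/6*a0*a1^2 + 32/3*a0^2 -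
      1309/6*a0^2*a1 - 653/78*a0^3 - 548/117*z + 25/18*a1*z + 1/18*a0*z)
          + n*(1280 - 27760/3*a1 + 5020/3*a1^2 + 6227/3*a1^3 - 448/3*a0 - 5872/3*a0*a1 - 116/3*a0^2 - 479/3*a0^2*a1 +
      1*a1*z))*E^6
        = (2624*E^6 - 40072/3*p1^1*E^4 + 140/3*p1^2*E^2 + 17017/6*p1^3 + 632/3*p0^1*E^4 - 7844/3*p0^1*p1^1*E^2 +
      653/6*p0^1*p1^2 + 32/3*p0^2*E^2 - 1309/6*p0^2*p1^1 - 653/78*p0^3 - 548/117*pz*E^3 + 25/18*p1^1*pz*E^1 +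
      1/18*p0^1*pz*E^1)
          + n*(1280*E^6 - 27760/3*p1^1*E^4 + 5020/3*p1^2*E^2 + 6227/3*p1^3 - 448/3*p0^1*E^4 - 5872/3*p0^1*p1^1*E^2 -
      116/3*p0^2*E^2 - 479/3*p0^2*p1^1 + 1*p1^1*pz*E^1) := by
      rintro _ _ _ E rfl rfl rfl; ring
    rw [key _ _ _ _ k0 k1 kz]
    linear_combination (27162540*n^9 + 804483576*n^8*t + 1810888488/13*n^8 + 15567678360*n^7*t^2 - 10046780568*n^7*t +
      62269447896/13*n^7 + 45146267244*n^6*t^3 + 111110849928*n^6*t^2 - 179784475344*n^6*t +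
      824467742424/13*n^6 + 371202641784*n^5*t^3 + 293530059576*n^5*t^2 - 964606110696*n^5*t +
      4431530130336/13*n^5 + 1262980760184*n^4*t^3 + 287912902680*n^4*t^2 - 2641979448792*n^4*t +
      12481777322928/13*n^4 + 2275520498784*n^3*t^3 - 136426098744*n^3*t^2 - 4162882675320*n^3*t +
      20239292682924/13*n^3 + 2289268744776*n^2*t^3 - 548954247816*n^2*t^2 - 3827936719296*n^2*t +
      19098008687304/13*n^2 + 1219135002696*n*t^3 - 447913380096*n*t^2 - 1914839514432*n*t + 9775383104520/13*n
      + 268462371060*t^3 - 125359127712*t^2 - 403504844904*t + 2102987084880/13)*hq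
  · apply (mul_eq_zero.mp ?_).resolve_right hE6
    have key : ∀ p0 p1 pz E : K, a0*E^2 = p0 → a1*E^2 = p1 → z*E^3 = pz →
        ((5408 - 85384/3*a1 - 2470/3*a1^2 + 35425/6*a1^3 + 6440/3*a0 - 17636/3*a0*a1 + 1157/6*a0*a1^2 + 986/3*a0^2
      - 2725/6*a0^2*a1 - 89/6*a0^3 - 86/9*z + 13/18*a1*z + 25/18*a0*z)
          + n*(3200 - 60112/3*a1 + 7384/3*a1^2 + 12935/3*a1^3 + 3200/3*a0 - 13168/3*a0*a1 + 448/3*a0^2 - 995/3*a0^2*a1 +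
      1*a0*z))*E^6
        = (5408*E^6 - 85384/3*p1^1*E^4 - 2470/3*p1^2*E^2 + 35425/6*p1^3 + 6440/3*p0^1*E^4 - 17636/3*p0^1*p1^1*E^2 +
      1157/6*p0^1*p1^2 + 986/3*p0^2*E^2 - 2725/6*p0^2*p1^1 - 89/6*p0^3 - 86/9*pz*E^3 + 13/18*p1^1*pz*E^1 +
      25/18*p0^1*pz*E^1)
          + n*(3200*E^6 - 60112/3*p1^1*E^4 + 7384/3*p1^2*E^2 + 12935/3*p1^3 + 3200/3*p0^1*E^4 - 13168/3*p0^1*p1^1*E^2 +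
      448/3*p0^2*E^2 - 995/3*p0^2*p1^1 + 1*p0^1*pz*E^1) := by
      rintro _ _ _ E rfl rfl rfl; ring
    rw [key _ _ _ _ k0 k1 kz]
    linear_combination (236904588*n^9 - 16697640024*n^8*t + 9856826496*n^8 + 25626793608*n^7*t^2 - 302065500672*n^7*t +
      134424684000*n^7 + 316023870708*n^6*t^3 + 189686173248*n^6*t^2 - 2237861402712*n^6*t + 896735781072*n^6 +
      2688711026976*n^5*t^3 + 541755206928*n^5*t^2 - 8932056351192*n^5*t + 3397643937504*n^5 +
      9492978070368*n^4*t^3 + 683719883496*n^4*t^2 - 21229034484528*n^4*t + 7831983711960*n^4 +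
      17802492262776*n^3*t^3 + 174360187872*n^3*t^2 - 31041890037288*n^3*t + 11222733510348*n^3 +
      18702073439712*n^2*t^3 - 478851623640*n^2*t^2 - 27460295760456*n^2*t + 9783627872904*n^2 +
      10435290282144*n*t^3 - 497177361720*n*t^2 - 13507247524680*n*t + 4758237906480*n + 2416161339540*t^3 -
      150047757288*t^2 - 2839885973496*t + 991237909440)*hq
end

section
theorem quad_setup {K : Type*} [Field K] [Algebra ℚ K] [CharZero K] (hK : Module.finrank ℚ K = 2)
    (σ : K ≃ₐ[ℚ] K) (hσ : σ ≠ AlgEquiv.refl) :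
    (∀ x, σ (σ x) = x) ∧ (∀ x, σ x = x → ∃ q : ℚ, x = (q : K)) ∧ ∃ θ : K, θ ≠ 0 ∧ σ θ = -θ := by
  have hfd : FiniteDimensional ℚ K := Module.finite_of_finrank_pos (by omega)
  have hσσ : ∀ x, σ (σ x) = x := by
    have hc : Fintype.card (K ≃ₐ[ℚ] K) ≤ 2 := hK ▸ AlgEquiv.card_le
    have h2 : σ * σ = 1 := by
      by_contra hne
      have : 2 < Fintype.card (K ≃ₐ[ℚ] K) := by
        rw [Fintype.two_lt_card_iff]
        refine ⟨1, σ, σ * σ, fun h => hσ h.symm, fun h => hne h.symm, fun h => hσ ?_⟩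
        exact (left_eq_mul.mp h)
      omega
    intro x
    exact DFunLike.congr_fun h2 x
  obtain ⟨w, hw⟩ : ∃ w, σ w ≠ w := by
    by_contra hcon
    push Not at hcon
    exact hσ (AlgEquiv.ext hcon)
  refine ⟨hσσ, ?_, w - σ w, fun h => hw (sub_eq_zero.mp h).symm, by rw [map_sub, hσσ]; ring⟩
  intro x hx
  by_contra hcon
  push Not at hcon
  have hli : ¬ LinearIndependent ℚ ![1, x, w] := by
    intro h
    have := h.fintype_card_le_finrank
    simp [hK] at this
  rw [Fintype.not_linearIndependent_iff] at hli
  obtain ⟨g, hg, i, hi⟩ := hli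
  replace hg : (g 0 : K) + (g 1 : K) * x + (g 2 : K) * w = 0 := by
    simpa [Fin.sum_univ_three, Algebra.smul_def, eq_ratCast] using hg
  by_cases h2 : g 2 = 0
  · by_cases h1 : g 1 = 0
    · rw [h1, h2] at hg
      have h0 : g 0 = 0 := by simpa using hg
      fin_cases i <;> simp_all
    · apply hcon (-(g 0) / g 1)
      have : (g 1 : K) ≠ 0 := by exact_mod_cast h1
      rw [h2] at hg
      push_cast at hg ⊢
      field_simp
      linear_combination hg
  · have h2' : (g 2 : K) ≠ 0 := by exact_mod_cast h2
    have e := congrArg σ hg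
    simp only [map_add, map_mul, map_ratCast, map_zero, hx] at e
    exact hw (mul_left_cancel₀ h2' (by linear_combination e - hg))

theorem int_of_rat {K : Type*} [Field K] [CharZero K] (y : K) (q : ℚ) (h : y = (q : K)) (hy : IsIntegral ℤ y) :
    ∃ m : ℤ, y = (m : K) := by
  have hq : IsIntegral ℤ q := by
    have : IsIntegral ℤ ((Rat.castHom K).toIntAlgHom q) := by
      change IsIntegral ℤ (Rat.castHom K q)
      simpa [← h] using hy
    exact (isIntegral_algHom_iff _ (Rat.castHom K).injective).mp this
  obtain ⟨m, hm⟩ := IsIntegrallyClosed.isIntegral_iff.mp hq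
  refine ⟨m, ?_⟩
  rw [h, ← hm]; simp

theorem nosext5 : ∀ T N : ZMod 5, T^5 + 42*T^4 - 4*T^3*N + 397*T^3 - 126*T^2*N - 3072*T^2 + 3*T*N^2 - 794*T*N - 64800*T + 42*N^2 + 3072*N - 203904 = 0 →
    -T^4*N - 42*T^3*N + 3*T^2*N^2 - 397*T^2*N + 84*T*N^2 + 3072*T*N - N^3 + 397*N^2 + 64800*N + 4629312 ≠ 0 := by
  decide

theorem nosext5' : ∀ y : ZMod 5, y^6 + 42*y^5 + 397*y^4 - 3072*y^3 - 64800*y^2 - 203904*y + 4629312 ≠ 0 := by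
  decide

theorem nosext {K : Type*} [Field K] [Algebra ℚ K] [CharZero K] (σ : K ≃ₐ[ℚ] K) (hσσ : ∀ x, σ (σ x) = x)
    (hfix : ∀ x, σ x = x → ∃ q : ℚ, x = (q : K)) (y : K)
    (h : y^6 + 42*y^5 + 397*y^4 - 3072*y^3 - 64800*y^2 - 203904*y + 4629312 = 0) : False := by
  open Polynomial in
  have hy : IsIntegral ℤ y := by
    refine ⟨X^6 + 42*X^5 + 397*X^4 - 3072*X^3 - 64800*X^2 - 203904*X + 4629312, ?_, ?_⟩
    · have : (X^6 + 42*X^5 + 397*X^4 - 3072*X^3 - 64800*X^2 - 203904*X + 4629312 : ℤ[X])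
        = X^6 + (C 42*X^5 + C 397*X^4 - C 3072*X^3 - C 64800*X^2 - C 203904*X + C 4629312) := by
        simp only [map_ofNat]; ring
      rw [this]
      apply monic_X_pow_add
      refine lt_of_le_of_lt (b := 5) ?_ (by norm_num)
      compute_degree
    · simpa using h
  have hσy : IsIntegral ℤ (σ y) := hy.map (σ.toRingEquiv.toRingHom.toIntAlgHom)
  obtain ⟨q1, h1⟩ := hfix (y + σ y) (by rw [map_add, hσσ]; ring)
  obtain ⟨q2, h2⟩ := hfix (y * σ y) (by rw [map_mul, hσσ]; ring)
  obtain ⟨T, hT⟩ := int_of_rat _ _ h1 (hy.add hσy)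
  obtain ⟨N, hN⟩ := int_of_rat _ _ h2 (hy.mul hσy)
  have hquad : y^2 - T*y + N = 0 := by rw [← hT, ← hN]; ring
  have hlin : ((T^5 + 42*T^4 - 4*T^3*N + 397*T^3 - 126*T^2*N - 3072*T^2 + 3*T*N^2 - 794*T*N - 64800*T + 42*N^2 + 3072*N - 203904 : ℤ) : K) * y
      + ((-T^4*N - 42*T^3*N + 3*T^2*N^2 - 397*T^2*N + 84*T*N^2 + 3072*T*N - N^3 + 397*N^2 + 64800*N + 4629312 : ℤ) : K) = 0 := by
    push_cast
    linear_combination h - (y^4 + (T + 42)*y^3 + (T^2 + 42*T - N + 397)*y^2 + (T^3 + 42*T^2 - 2*T*N + 397*T - 42*N - 3072)*y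
      + (T^4 + 42*T^3 - 3*T^2*N + 397*T^2 - 84*T*N - 3072*T + N^2 - 397*N - 64800))*hquad
  have hne := nosext5 T N
  generalize hR1 : T^5 + 42*T^4 - 4*T^3*N + 397*T^3 - 126*T^2*N - 3072*T^2 + 3*T*N^2 - 794*T*N - 64800*T + 42*N^2 + 3072*N - 203904 = R1 at hlin
  generalize hR0 : -T^4*N - 42*T^3*N + 3*T^2*N^2 - 397*T^2*N + 84*T*N^2 + 3072*T*N - N^3 + 397*N^2 + 64800*N + 4629312 = R0 at hlin
  by_cases hz : R1 = 0
  · have hz0 : R0 = 0 := by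
      rw [hz] at hlin
      simpa using hlin
    apply hne
    · have := congrArg (Int.cast : ℤ → ZMod 5) (hR1.trans hz)
      push_cast at this
      exact this
    · have := congrArg (Int.cast : ℤ → ZMod 5) (hR0.trans hz0)
      push_cast at this
      exact this
  · have hz' : (R1 : K) ≠ 0 := by exact_mod_cast hz
    obtain ⟨m, hm⟩ := int_of_rat y (-(R0 : ℚ) / R1) (by
      push_cast; field_simp; linear_combination hlin) hy
    rw [hm] at h
    have h' : m^6 + 42*m^5 + 397*m^4 - 3072*m^3 - 64800*m^2 - 203904*m + 4629312 = 0 := by exact_mod_cast h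
    have := congrArg (Int.cast : ℤ → ZMod 5) h'
    push_cast at this
    exact nosext5' m this

theorem XP.u0 {K : Type*} [Field K] [CharZero K] {a b c d e : K} (h : XP 0 0 0 a b c d e)
    (hns : ∀ y : K, y^6 + 42*y^5 + 397*y^4 - 3072*y^3 - 64800*y^2 - 203904*y + 4629312 ≠ 0) :
    a = 0 ∧ b = 0 ∧ c = 0 ∧ d = 0 ∧ e = 0 := by
  have c1 : 996*c^3 + 1487*c*d*e + 1048*c*e^2 - 258*d^3 - 632*d^2*e + 1661*d*e^2 + 464*e^3 = 0 := by
    linear_combination (189233539735/20399470832*a - 135211845057/20399470832*b - 475390714999/20399470832*c -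
      69187314597/10199735416*d - 328023162297/10199735416*e) * h.g1 + (-753918485/1569190064*a -
      75942098305/10199735416*b + 14907128659/10199735416*c + 506499848105/20399470832*d -
      35634729151/20399470832*e) * h.g2 + (-13570532730/1274966927*a + 144357906113/40798941664*b -
      71100352095/3138380128*c + 767242127/40798941664*d - 632475180637/40798941664*e) * h.g3 +
      (-148521941545/20399470832*a + 188722223711/40798941664*b + 511979532673/40798941664*c -
      221012222901/40798941664*d + 46983883737/3138380128*e) * h.g4 + (338509399765/10199735416*a -
      367837557445/20399470832*b + 20802156805/1569190064*c - 90267787215/20399470832*d -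
      431208773953/20399470832*e) * h.g5 + (-39957679705/2549933854*a) * h.g6
  have c2 : 498*c^2*d + 3107*c*d*e + 6835*c*e^2 - 345*d^3 - 710*d^2*e - 1345*d*e^2 + 7301*e^3 = 0 := by
    linear_combination (326154923255/40798941664*a + 817604398959/40798941664*b - 1492203200951/40798941664*c -
      507398403021/20399470832*d + 15118009767/20399470832*e) * h.g1 + (-1299422005/3138380128*a -
      48123145325/1569190064*b + 955750650275/20399470832*c + 227851038937/40798941664*d -
      2153312410799/40798941664*e) * h.g2 + (-11694798045/1274966927*a - 1811580968831/81597883328*b -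
      532698877779/81597883328*c + 1464116423311/81597883328*d + 3233308822771/81597883328*e) * h.g3 +
      (-255986134985/40798941664*a + 383620482943/81597883328*b - 502802429119/81597883328*c +
      835159000491/81597883328*d + 1326250081557/81597883328*e) * h.g4 + (583440480245/20399470832*a +
      1059188286235/40798941664*b - 1215614177311/40798941664*c - 98248210863/40798941664*d -
      4645411313105/40798941664*e) * h.g5 + (-68869366265/5099867708*a) * h.g6
  have c3 : 83*c^2*e - 311*c*d*e - 571*c*e^2 + 27*d^3 + 70*d^2*e + 163*d*e^2 - 728*e^3 = 0 := by
    linear_combination (-20500972933/40798941664*a - 7175106337/3138380128*b + 103485251941/40798941664*c +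
      3836748707/1569190064*d - 29052639781/20399470832*e) * h.g1 + (81677183/3138380128*a +
      57595765531/20399470832*b - 93054427065/20399470832*c + 19424813205/40798941664*d +
      230434765005/40798941664*e) * h.g2 + (735094647/1274966927*a + 196468346141/81597883328*b +
      25796993561/81597883328*c - 160807197901/81597883328*d - 379068365881/81597883328*e) * h.g3 +
      (16090405051/40798941664*a - 23608446109/81597883328*b + 92993152029/81597883328*c -
      111851485857/81597883328*d - 94131873183/81597883328*e) * h.g4 + (-36673055167/20399470832*a -
      137526875377/40798941664*b + 97676379069/40798941664*c + 30573476397/40798941664*d +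
      454348356307/40798941664*e) * h.g5 + (4328890699/5099867708*a) * h.g6
  have c4 : 498*c*d^2 + 4037*c*d*e + 5938*c*e^2 - 252*d^3 - 1262*d^2*e - 553*d*e^2 + 7514*e^3 = 0 := by
    linear_combination (60645537437/10199735416*a + 207379699341/10199735416*b - 298879570397/10199735416*c -
      133384950891/5099867708*d + 5669860701/5099867708*e) * h.g1 + (-241615687/784595032*a -
      151541084639/5099867708*b + 234850406465/5099867708*c + 26496291019/10199735416*d -
      491447554973/10199735416*e) * h.g2 + (-8698164732/1274966927*a - 442491753077/20399470832*b -
      77101448721/20399470832*c + 433804236949/20399470832*d + 800465558185/20399470832*e) * h.g3 +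
      (-47598290339/10199735416*a + 92281884805/20399470832*b - 198504337333/20399470832*c +
      242026795929/20399470832*d + 309037416159/20399470832*e) * h.g4 + (108485443463/5099867708*a +
      264358267993/10199735416*b - 311949047509/10199735416*c - 73782119301/10199735416*d -
      1071851583779/10199735416*e) * h.g5 + (-12805631411/1274966927*a) * h.g6
  have hf : 36*d^6 + 252*d^5*e + 397*d^4*e^2 - 512*d^3*e^3 - 1800*d^2*e^4 - 944*d*e^5 + 3572*e^6 = 0 := by
    linear_combination (159712055504713059030861/378486149702389395512138*c^2*d -
      191826042100616231606248/176191828309732994462547*c^2*e - 14749240908339080340/97397362249714203683*c*d^2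
      + 121947701773217749808951/33894282062900542881684*c*d*e +
      95182492974757008593237/11298094020966847627228*c*e^2 - 7333334319511/10429671578428*d^3 -
      33070967599447/15644507367642*d^2*e - 139085934693481/31289014735284*d*e^2 + 893/116*e^3) * c1 +
      (-159712055504713059030861/189243074851194697756069*c^3 + 29498481816678160680/97397362249714203683*c^2*d
      + 1093647634672777042195396/176191828309732994462547*c^2*e +
      11029867114062268776/97397362249714203683*c*d^2 - 63760814599547431543691/33894282062900542881684*c*d*e -
      4633453012078954441270/2824523505241711906807*c*e^2 + 2197872576247/5214835789214*d^3 +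
      9942646567394/7822253683821*d^2*e - 50005268142389/31289014735284*d*e^2) * c2 +
      (767304168402464926424992/58730609436577664820849*c^3 +
      7546432711922974570064/58730609436577664820849*c^2*d +
      3422979246476111330995472/58730609436577664820849*c^2*e) * c3
  have he : e = 0 := by
    by_contra he
    apply hns (6*d/e)
    field_simp
    linear_combination 1296*hf
  subst he
  have hd : d = 0 := by
    apply pow_eq_zero_iff (n := 6) (by norm_num) |>.mp
    linear_combination hf/36
  subst hd
  have hc : c = 0 := by
    apply pow_eq_zero_iff (n := 3) (by norm_num) |>.mp
    linear_combination c1/996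
  subst hc
  have hb : b = 0 := by
    apply pow_eq_zero_iff (n := 2) (by norm_num) |>.mp
    linear_combination -h.g1/14
  subst hb
  have ha : a = 0 := by
    apply pow_eq_zero_iff (n := 2) (by norm_num) |>.mp
    linear_combination h.g7/2
  exact ⟨ha, rfl, rfl, rfl, rfl⟩

theorem XP.smul {K : Type*} [Field K] {x y z a b c d e : K} (h : XP x y z a b c d e) (k : K) :
    XP (k*x) (k*y) (k*z) (k*a) (k*b) (k*c) (k*d) (k*e) :=
  ⟨by linear_combination k^2*h.o1, by linear_combination k^2*h.o2, by linear_combination k^2*h.o3, by linear_combination k^2*h.o4, by linear_combination k^2*h.o5, by linear_combination k^2*h.o6, by linear_combination k^2*h.g1, by linear_combination k^2*h.g2, by linear_combination k^2*h.g3, by linear_combination k^2*h.g4, by linear_combination k^2*h.g5, by linear_combination k^2*h.g6, by linear_combination k^2*h.g7, by linear_combination k^2*h.g8, by linear_combination k^2*h.g9⟩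
end

section
theorem kerA {K : Type*} [Field K] [CharZero K] (x y z a b c d e : K)
    (h0 : 13*x*a - 26*y*a + 90*y*c + 16*y*d + 23*y*e - 91*z*a + 13*z*b + 18*z*c - 41*z*d + 184*z*e = 0)
    (h1 : 13*x*c - 26*y*a + 128*y*c + 32*y*d + 33*y*e - 130*z*a + 26*z*b + 36*z*c - 82*z*d + 264*z*e = 0)
    (h2 : 13*x*d + 39*y*a - 205*y*c - 61*y*d - 30*y*e + 195*z*a - 39*z*b - 41*z*c + 97*z*d - 409*z*e = 0)
    (h3 : 52*x*e + 78*y*a - 280*y*c - 109*y*d - 60*y*e + 221*z*a - 78*z*b - 56*z*c + 142*z*d - 506*z*e = 0)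
    (hv : a = 0) (hm : 4*x^3*z - 14*x^2*y*z + 38*x^2*z^2 + 9*x*y^2*z - 11*x*y*z^2 + 28*x*z^3 - 3*y^3*z - 31*y^2*z^2 - 8*y*z^3 ≠ 0) :
    b = 0 ∧ c = 0 ∧ d = 0 ∧ e = 0 := by
  subst hv
  refine ⟨?_, ?_, ?_, ?_⟩
  · apply (mul_eq_zero.mp ?_).resolve_left hm
    linear_combination (8788*x^3 + 35152*x^2*y + 4394*x^2*z - 39546*x*y^2 - 358111*x*y*z + 79092*x*z^2 + 98865*y^3 + 59319*y^2*z -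
      399854*y*z^2 + 43940*z^3)/28561*h0 + (-60840*x^2*y - 12168*x^2*z + 101400*x*y^2 - 74360*x*y*z - 18928*x*z^2 -
      93795*y^3 + 99541*y^2*z + 15210*y*z^2 - 1690*z^3)/28561*h1 + (-10816*x^2*y + 27716*x^2*z + 23153*x*y^2 -
      255866*x*y*z + 69966*x*z^2 + 11154*y^3 + 28730*y^2*z - 252148*y*z^2 + 27040*z^3)/28561*h2 + (-3887*x^2*y -
      31096*x^2*z + 12337*x*y^2 + 47489*x*y*z - 38363*x*z^2 - 19266*y^3 + 40053*y^2*z + 67431*y*z^2 -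
      6760*z^3)/28561*h3
  · apply (mul_eq_zero.mp ?_).resolve_left hm
    linear_combination (-17576*x^2*z + 4394*x*y*z - 61516*x*z^2 + 6591*y^2*z + 74698*y*z^2 + 228488*z^3)/28561*h0 + (8788*x^2*z +
      4394*x*y*z + 83486*x*z^2 - 6591*y^2*z - 50531*y*z^2 - 8788*z^3)/28561*h1 + (2197*y^2*z + 35152*y*z^2 +
      140608*z^3)/28561*h2 + (2197*x*y*z + 17576*x*z^2 - 2197*y^2*z - 21970*y*z^2 - 35152*z^3)/28561*h3
  · apply (mul_eq_zero.mp ?_).resolve_left hm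
    linear_combination (26364*x^2*z - 17576*x*y*z + 175760*x*z^2 - 65910*y^2*z - 74698*y*z^2 + 114244*z^3)/28561*h0 + (-43940*x*y*z -
      8788*x*z^2 + 65910*y^2*z - 8788*y*z^2 - 4394*z^3)/28561*h1 + (8788*x^2*z - 21970*x*y*z + 101062*x*z^2 -
      8788*y^2*z - 43940*y*z^2 + 70304*z^3)/28561*h2 + (-6591*x*y*z - 24167*x*z^2 + 15379*y^2*z + 6591*y*z^2 -
      17576*z^3)/28561*h3
  · apply (mul_eq_zero.mp ?_).resolve_left hm
    linear_combination (13182*x^2*z + 28561*x*y*z + 43940*x*z^2 - 39546*y^2*z - 118638*y*z^2)/28561*h0 + (-43940*x*y*z - 8788*x*z^2 +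
      32955*y^2*z + 6591*y*z^2)/28561*h1 + (2197*x*y*z + 17576*x*z^2 - 8788*y^2*z - 70304*y*z^2)/28561*h2 +
      (2197*x^2*z - 10985*x*y*z - 4394*x*z^2 + 8788*y^2*z + 17576*y*z^2)/28561*h3

theorem kerB {K : Type*} [Field K] [CharZero K] (x y z a b c d e : K)
    (h0 : 26*x*b - 26*y*a + 140*y*c + 35*y*d + 30*y*e - 91*z*a + 26*z*b + 28*z*c - 58*z*d + 240*z*e = 0)
    (h1 : 13*x*c - 26*y*a + 128*y*c + 32*y*d + 33*y*e - 130*z*a + 26*z*b + 36*z*c - 82*z*d + 264*z*e = 0)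
    (h2 : 13*x*d + 39*y*a - 205*y*c - 61*y*d - 30*y*e + 195*z*a - 39*z*b - 41*z*c + 97*z*d - 409*z*e = 0)
    (h3 : 52*x*e + 78*y*a - 280*y*c - 109*y*d - 60*y*e + 221*z*a - 78*z*b - 56*z*c + 142*z*d - 506*z*e = 0)
    (hv : c = 0) (hm : 8*x^3*y + 40*x^3*z - 2*x^2*y^2 - 15*x^2*y*z - 112*x^2*z^2 - 3*x*y^3 + 32*x*y^2*z - 105*x*y*z^2 + 108*x*z^3 -
      6*y^2*z^2 - 54*y*z^3 - 84*z^4 ≠ 0) :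
    a = 0 ∧ b = 0 ∧ d = 0 ∧ e = 0 := by
  subst hv
  refine ⟨?_, ?_, ?_, ?_⟩
  · apply (mul_eq_zero.mp ?_).resolve_left hm
    linear_combination (17576*x^2*z - 4394*x*y*z + 61516*x*z^2 - 6591*y^2*z - 74698*y*z^2 - 228488*z^3)/57122*h0 + (-17576*x^3 +
      102752*x^2*y + 22308*x^2*z - 10140*x*y^2 + 398502*x*y*z - 319748*x*z^2 + 5070*y^2*z + 32110*y*z^2 -
      14872*z^3)/57122*h1 + (43264*x^2*y - 110864*x^2*z + 43602*x*y^2 + 329212*x*y*z + 71656*x*z^2 - 2028*y^2*z -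
      30420*y*z^2 - 113568*z^3)/57122*h2 + (11154*x^2*y + 89232*x^2*z - 27378*x*y^2 - 58136*x*y*z - 198068*x*z^2 +
      507*y^2*z + 1014*y*z^2 - 24336*z^3)/57122*h3
  · apply (mul_eq_zero.mp ?_).resolve_left hm
    linear_combination (17576*x^2*y + 87880*x^2*z - 4394*x*y^2 - 32955*x*y*z - 272428*x*z^2 - 6591*y^3 + 70304*y^2*z - 217503*y*z^2 +
      197730*z^3)/57122*h0 + (-17576*x^2*y - 61516*x^2*z + 1352*x*y^2 - 167310*x*y*z + 38194*x*z^2 + 5070*y^3 -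
      59150*y^2*z - 307242*y*z^2 + 201786*z^3)/57122*h1 + (-4056*x*y^2 - 117624*x*y*z + 4056*x*z^2 - 2028*y^3 -
      73008*y^2*z - 409656*y*z^2 + 14196*z^3)/57122*h2 + (1014*x*y^2 - 3549*x*y*z - 93288*x*z^2 + 507*y^3 +
      44616*y^2*z + 69459*y*z^2 + 187590*z^3)/57122*h3
  · apply (mul_eq_zero.mp ?_).resolve_left hm
    linear_combination (-85683*y*z^2 + 57122*z^3)/57122*h0 + (52728*x^2*y + 263640*x^2*z + 184548*x*y*z - 136214*x*z^2 + 65910*y*z^2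
      + 259246*z^3)/57122*h1 + (35152*x^2*y + 175760*x^2*z + 26364*x*y^2 + 180154*x*y*z - 140608*x*z^2 + 26364*y*z^2
      + 184548*z^3)/57122*h2 + (-13182*x*y^2 - 57122*x*y*z + 43940*x*z^2 - 19773*y*z^2 + 13182*z^3)/57122*h3
  · apply (mul_eq_zero.mp ?_).resolve_left hm
    linear_combination (57122*x*z^2 - 57122*y*z^2 - 114244*z^3)/57122*h0 + (26364*x^2*y + 74698*x^2*z - 13182*x*y^2 + 254852*x*y*z -
      180154*x*z^2 + 17576*y*z^2 + 35152*z^3)/57122*h1 + (8788*x*y^2 + 254852*x*y*z - 8788*x*z^2)/57122*h2 +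
      (8788*x^2*y + 43940*x^2*z - 8788*x*y^2 - 61516*x*y*z - 74698*x*z^2 - 13182*y*z^2 - 26364*z^3)/57122*h3

theorem minor5 : ∀ x y z : ZMod 5, 2*x^4 + 4*x^3*y - 11*x^3*z - 10*x^2*y^2 - 75*x^2*y*z + 17*x^2*z^2 + 27*x*y^3 + 60*x*y^2*z - 87*x*y*z^2 +
      5*x*z^3 - 21*y^4 + 23*y^3*z + 40*y^2*z^2 + 9*y*z^3 - 7*z^4 = 0 →
    4*x^3*z - 14*x^2*y*z + 38*x^2*z^2 + 9*x*y^2*z - 11*x*y*z^2 + 28*x*z^3 - 3*y^3*z - 31*y^2*z^2 - 8*y*z^3 = 0 →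
    8*x^3*y + 40*x^3*z - 2*x^2*y^2 - 15*x^2*y*z - 112*x^2*z^2 - 3*x*y^3 + 32*x*y^2*z - 105*x*y*z^2 + 108*x*z^3 -
      6*y^2*z^2 - 54*y*z^3 - 84*z^4 = 0 → x = 0 ∧ y = 0 ∧ z = 0 := by
  decide

theorem minorZ : ∀ (N : ℕ) (x y z : ℤ), x.natAbs + y.natAbs + z.natAbs ≤ N → 2*x^4 + 4*x^3*y - 11*x^3*z - 10*x^2*y^2 - 75*x^2*y*z + 17*x^2*z^2 + 27*x*y^3 + 60*x*y^2*z - 87*x*y*z^2 +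
      5*x*z^3 - 21*y^4 + 23*y^3*z + 40*y^2*z^2 + 9*y*z^3 - 7*z^4 = 0 →
    4*x^3*z - 14*x^2*y*z + 38*x^2*z^2 + 9*x*y^2*z - 11*x*y*z^2 + 28*x*z^3 - 3*y^3*z - 31*y^2*z^2 - 8*y*z^3 = 0 →
    8*x^3*y + 40*x^3*z - 2*x^2*y^2 - 15*x^2*y*z - 112*x^2*z^2 - 3*x*y^3 + 32*x*y^2*z - 105*x*y*z^2 + 108*x*z^3 -
      6*y^2*z^2 - 54*y*z^3 - 84*z^4 = 0 → x = 0 ∧ y = 0 ∧ z = 0 := by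
  intro N
  induction N with
  | zero => intro x y z h _ _ _; omega
  | succ N ih =>
    intro x y z hN hq h1 h2
    have c : ((x : ZMod 5) = 0) ∧ ((y : ZMod 5) = 0) ∧ ((z : ZMod 5) = 0) := by
      apply minor5
      · have := congrArg (Int.cast : ℤ → ZMod 5) hq
        push_cast at this
        exact this
      · have := congrArg (Int.cast : ℤ → ZMod 5) h1
        push_cast at this
        exact this
      · have := congrArg (Int.cast : ℤ → ZMod 5) h2
        push_cast at this
        exact this
    obtain ⟨cx, cy, cz⟩ := c
    obtain ⟨x', rfl⟩ := (ZMod.intCast_zmod_eq_zero_iff_dvd x 5).mp cx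
    obtain ⟨y', rfl⟩ := (ZMod.intCast_zmod_eq_zero_iff_dvd y 5).mp cy
    obtain ⟨z', rfl⟩ := (ZMod.intCast_zmod_eq_zero_iff_dvd z 5).mp cz
    push_cast at *
    by_cases h0 : x' = 0 ∧ y' = 0 ∧ z' = 0
    · omega
    · have := ih x' y' z' (by omega) (by linarith) (by linarith) (by linarith)
      exact absurd this h0

theorem minorQ (x y z : ℚ) (hne : ¬ (x = 0 ∧ y = 0 ∧ z = 0)) (hq : 2*x^4 + 4*x^3*y - 11*x^3*z - 10*x^2*y^2 - 75*x^2*y*z + 17*x^2*z^2 + 27*x*y^3 + 60*x*y^2*z - 87*x*y*z^2 +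
      5*x*z^3 - 21*y^4 + 23*y^3*z + 40*y^2*z^2 + 9*y*z^3 - 7*z^4 = 0)
    (h1 : 4*x^3*z - 14*x^2*y*z + 38*x^2*z^2 + 9*x*y^2*z - 11*x*y*z^2 + 28*x*z^3 - 3*y^3*z - 31*y^2*z^2 - 8*y*z^3 = 0)
    (h2 : 8*x^3*y + 40*x^3*z - 2*x^2*y^2 - 15*x^2*y*z - 112*x^2*z^2 - 3*x*y^3 + 32*x*y^2*z - 105*x*y*z^2 + 108*x*z^3 -
      6*y^2*z^2 - 54*y*z^3 - 84*z^4 = 0) : False := by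
  apply hne
  have dx : (x.den : ℚ) ≠ 0 := by exact_mod_cast x.den_nz
  have dy : (y.den : ℚ) ≠ 0 := by exact_mod_cast y.den_nz
  have dz : (z.den : ℚ) ≠ 0 := by exact_mod_cast z.den_nz
  set D : ℚ := x.den * y.den * z.den with hD
  have dD : D ≠ 0 := by positivity
  have ex : ((x.num * y.den * z.den : ℤ) : ℚ) = D * x := by
    push_cast
    rw [hD, ← Rat.mul_den_eq_num x]; ring
  have ey : ((y.num * x.den * z.den : ℤ) : ℚ) = D * y := by
    push_cast
    rw [hD, ← Rat.mul_den_eq_num y]; ring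
  have ez : ((z.num * x.den * y.den : ℤ) : ℚ) = D * z := by
    push_cast
    rw [hD, ← Rat.mul_den_eq_num z]; ring
  generalize x.num * y.den * z.den = X at ex
  generalize y.num * x.den * z.den = Y at ey
  generalize z.num * x.den * y.den = Z at ez
  clear_value D
  obtain ⟨hX, hY, hZ⟩ := minorZ _ X Y Z le_rfl
    (by
      have : ((2*X^4 + 4*X^3*Y - 11*X^3*Z - 10*X^2*Y^2 - 75*X^2*Y*Z + 17*X^2*Z^2 + 27*X*Y^3 + 60*X*Y^2*Z - 87*X*Y*Z^2 +
      5*X*Z^3 - 21*Y^4 + 23*Y^3*Z + 40*Y^2*Z^2 + 9*Y*Z^3 - 7*Z^4 : ℤ) : ℚ) = 0 := by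
        push_cast; rw [ex, ey, ez]; linear_combination D^4*hq
      exact_mod_cast this)
    (by
      have : ((4*X^3*Z - 14*X^2*Y*Z + 38*X^2*Z^2 + 9*X*Y^2*Z - 11*X*Y*Z^2 + 28*X*Z^3 - 3*Y^3*Z - 31*Y^2*Z^2 - 8*Y*Z^3 : ℤ) : ℚ) = 0 := by
        push_cast; rw [ex, ey, ez]; linear_combination D^4*h1
      exact_mod_cast this)
    (by
      have : ((8*X^3*Y + 40*X^3*Z - 2*X^2*Y^2 - 15*X^2*Y*Z - 112*X^2*Z^2 - 3*X*Y^3 + 32*X*Y^2*Z - 105*X*Y*Z^2 + 108*X*Z^3 - 6*Y^2*Z^2 - 54*Y*Z^3 - 84*Z^4 : ℤ) : ℚ) = 0 := by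
        push_cast; rw [ex, ey, ez]; linear_combination D^4*h2
      exact_mod_cast this)
  rw [hX] at ex; rw [hY] at ey; rw [hZ] at ez
  refine ⟨?_, ?_, ?_⟩
  · simpa [dD] using ex.symm
  · simpa [dD] using ey.symm
  · simpa [dD] using ez.symm

theorem XP.map {K L : Type*} [Field K] [Field L] {x y z a b c d e : K} (h : XP x y z a b c d e) (f : K →+* L) :
    XP (f x) (f y) (f z) (f a) (f b) (f c) (f d) (f e) := by
  constructor
  · have := congrArg f h.o1
    simpa only [map_add, map_sub, map_mul, map_pow, map_ofNat, map_zero] using this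
  · have := congrArg f h.o2
    simpa only [map_add, map_sub, map_mul, map_pow, map_ofNat, map_zero] using this
  · have := congrArg f h.o3
    simpa only [map_add, map_sub, map_mul, map_pow, map_ofNat, map_zero] using this
  · have := congrArg f h.o4
    simpa only [map_add, map_sub, map_mul, map_pow, map_ofNat, map_zero] using this
  · have := congrArg f h.o5
    simpa only [map_add, map_sub, map_mul, map_pow, map_ofNat, map_zero] using this
  · have := congrArg f h.o6
    simpa only [map_add, map_sub, map_mul, map_pow, map_ofNat, map_zero] using this
  · have := congrArg f h.g1
    simpa only [map_add, map_sub, map_mul, map_pow, map_ofNat, map_zero] using this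
  · have := congrArg f h.g2
    simpa only [map_add, map_sub, map_mul, map_pow, map_ofNat, map_zero] using this
  · have := congrArg f h.g3
    simpa only [map_add, map_sub, map_mul, map_pow, map_ofNat, map_zero] using this
  · have := congrArg f h.g4
    simpa only [map_add, map_sub, map_mul, map_pow, map_ofNat, map_zero] using this
  · have := congrArg f h.g5
    simpa only [map_add, map_sub, map_mul, map_pow, map_ofNat, map_zero] using this
  · have := congrArg f h.g6
    simpa only [map_add, map_sub, map_mul, map_pow, map_ofNat, map_zero] using this
  · have := congrArg f h.g7
    simpa only [map_add, map_sub, map_mul, map_pow, map_ofNat, map_zero] using this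
  · have := congrArg f h.g8
    simpa only [map_add, map_sub, map_mul, map_pow, map_ofNat, map_zero] using this
  · have := congrArg f h.g9
    simpa only [map_add, map_sub, map_mul, map_pow, map_ofNat, map_zero] using this

theorem XP.rat {K : Type*} [Field K] [CharZero K] (f : K →+* K) (x y z : ℚ) {a b c d e : K}
    (h : XP (x : K) (y : K) (z : K) a b c d e) (hne : ¬ (x = 0 ∧ y = 0 ∧ z = 0)) :
    ∃ μ : K, (μ = 1 ∨ μ = -1) ∧ f a = μ*a ∧ f b = μ*b ∧ f c = μ*c ∧ f d = μ*d ∧ f e = μ*e := by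
  have h' : XP (x : K) (y : K) (z : K) (f a) (f b) (f c) (f d) (f e) := by simpa using h.map f
  have hv : ¬ (a = 0 ∧ b = 0 ∧ c = 0 ∧ d = 0 ∧ e = 0) := by
    rintro ⟨rfl, rfl, rfl, rfl, rfl⟩
    have k1 := h.g1
    have k2 := h.g4
    have k3 := h.g6
    apply hne
    simpa using And.intro k1 (And.intro k2 k3)
  have main : ∃ μ : K, f a = μ*a ∧ f b = μ*b ∧ f c = μ*c ∧ f d = μ*d ∧ f e = μ*e := by
    by_cases hA : 4*(x:K)^3*(z:K) - 14*(x:K)^2*(y:K)*(z:K) + 38*(x:K)^2*(z:K)^2 + 9*(x:K)*(y:K)^2*(z:K) - 11*(x:K)*(y:K)*(z:K)^2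
      + 28*(x:K)*(z:K)^3 - 3*(y:K)^3*(z:K) - 31*(y:K)^2*(z:K)^2 - 8*(y:K)*(z:K)^3 = 0
    · by_cases hB : 8*(x:K)^3*(y:K) + 40*(x:K)^3*(z:K) - 2*(x:K)^2*(y:K)^2 - 15*(x:K)^2*(y:K)*(z:K) - 112*(x:K)^2*(z:K)^2 -
      3*(x:K)*(y:K)^3 + 32*(x:K)*(y:K)^2*(z:K) - 105*(x:K)*(y:K)*(z:K)^2 + 108*(x:K)*(z:K)^3 - 6*(y:K)^2*(z:K)^2 -
      54*(y:K)*(z:K)^3 - 84*(z:K)^4 = 0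
      · exact (minorQ x y z hne (by exact_mod_cast h.quartic) (by exact_mod_cast hA) (by exact_mod_cast hB)).elim
      · have hn : c ≠ 0 := fun h0 => hv (by
          have := kerB _ _ _ a b c d e h.o2 h.o3 h.o4 h.o5 h0 hB
          tauto)
        obtain ⟨k1, k2, k3, k4⟩ := kerB _ _ _ (f a*c - f c*a) (f b*c - f c*b) (f c*c - f c*c) (f d*c - f c*d) (f e*c - f c*e)
          (by linear_combination c*h'.o2 - f c*h.o2) (by linear_combination c*h'.o3 - f c*h.o3)
          (by linear_combination c*h'.o4 - f c*h.o4) (by linear_combination c*h'.o5 - f c*h.o5) (by ring) hB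
        refine ⟨f c / c, ?_, ?_, ?_, ?_, ?_⟩ <;> field_simp
        · linear_combination k1
        · linear_combination k2
        · linear_combination k3
        · linear_combination k4
    · have hn : a ≠ 0 := fun h0 => hv (by
        have := kerA _ _ _ a b c d e h.o1 h.o3 h.o4 h.o5 h0 hA
        tauto)
      obtain ⟨k1, k2, k3, k4⟩ := kerA _ _ _ (f a*a - f a*a) (f b*a - f a*b) (f c*a - f a*c) (f d*a - f a*d) (f e*a - f a*e)
        (by linear_combination a*h'.o1 - f a*h.o1) (by linear_combination a*h'.o3 - f a*h.o3)
        (by linear_combination a*h'.o4 - f a*h.o4) (by linear_combination a*h'.o5 - f a*h.o5) (by ring) hA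
      refine ⟨f a / a, ?_, ?_, ?_, ?_, ?_⟩ <;> field_simp
      · linear_combination k1
      · linear_combination k2
      · linear_combination k3
      · linear_combination k4
  obtain ⟨μ, ha, hb, hc, hd, he⟩ := main
  refine ⟨μ, ?_, ha, hb, hc, hd, he⟩
  rw [ha, hb, hc, hd, he] at h'
  have k1 : (x:K)*(x:K)*(μ^2-1) = 0 := by linear_combination (μ^2*h.g1 - h'.g1)/169
  have k2 : (y:K)*(y:K)*(μ^2-1) = 0 := by linear_combination (μ^2*h.g4 - h'.g4)/338
  have k3 : (z:K)*(z:K)*(μ^2-1) = 0 := by linear_combination (μ^2*h.g6 - h'.g6)/169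
  have hμ : μ^2 - 1 = 0 := by
    by_contra hc
    apply hne
    simpa [hc] using And.intro k1 (And.intro k2 k3)
  exact sq_eq_one_iff.mp (by linear_combination hμ)
end

open scoped QuadraticAlgebra
section
/-- the embedding of `ℚ(√13)` into `K(√13)` -/
def jF (K : Type*) [Field K] [CharZero K] : F13 →+* QuadraticAlgebra K 13 0 where
  toFun p := ⟨(p.re : K) + (p.im : K)/2, (p.im : K)/2⟩
  map_one' := by ext <;> simp
  map_zero' := by ext <;> simp
  map_add' x y := by ext <;> simp <;> ring
  map_mul' x y := by ext <;> simp <;> ring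

theorem jF_apply (K : Type*) [Field K] [CharZero K] (p : F13) :
    jF K p = ⟨(p.re : K) + (p.im : K)/2, (p.im : K)/2⟩ := rfl

theorem lineF (p q r t : F13) (d : ℚ) (h1 : r^2 + (d : F13)*t^2 = 4*(p^3 + 3*p*d*q^2) + (-1-11*ww)*((p+1)^2 + d*q^2))
    (h2 : 2*r*t = 4*(3*p^2*q + d*q^3) + 2*(-1-11*ww)*(p+1)*q) :
    q = 0 ∧ r = 0 ∧ (d : F13)*t^2 = 4*p^3 + (-1-11*ww)*(p+1)^2 := by
  by_cases hq : q = 0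
  · subst hq
    have h3 : r * t = 0 := by linear_combination h2/2
    rcases mul_eq_zero.mp h3 with h | h
    · subst h
      exact ⟨rfl, rfl, by linear_combination h1⟩
    · subst h
      exact (claimC13 p r (by linear_combination h1)).elim
  · exfalso
    obtain ⟨k, rfl⟩ : ∃ k, t = k*q := ⟨t/q, by field_simp⟩
    have h3 : 2*r*k = 4*(3*p^2 + d*q^2) + 2*(-1-11*ww)*(p+1) := by
      apply mul_left_cancel₀ hq
      linear_combination h2
    have h1' : r^2 + k^2*((d : F13)*q^2) = 4*(p^3 + 3*p*(d*q^2)) + (-1-11*ww)*((p+1)^2 + d*q^2) := by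
      linear_combination h1
    generalize ((d : F13)*q^2) = Q at h1' h3
    apply claimC13 ((k^2-(-1-11*ww))/4 - 2*p) (r + k*((k^2-(-1-11*ww))/4 - 3*p))
    linear_combination ((k^2-(-1-11*ww))/4 - 3*p)*h3 + h1'

theorem fR_map {K L : Type*} [Field K] [Field L] (C : K →+* L) (N0 N1 l0 l1 : K) :
    C (fR0 N0 N1 l0 l1) = fR0 (C N0) (C N1) (C l0) (C l1) ∧ C (fR1 N0 N1 l0 l1) = fR1 (C N0) (C N1) (C l0) (C l1) := by
  unfold fR0 fR1
  constructor <;> simp only [map_add, map_sub, map_mul, map_pow, map_ofNat, map_neg, map_div₀]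

theorem decQ {K : Type*} [Field K] [CharZero K] (f : K →+* K) (hff : ∀ x, f (f x) = x)
    (hfix : ∀ x, f x = x → ∃ q : ℚ, x = (q : K)) (θ : K) (hθ0 : θ ≠ 0) (hθ : f θ = -θ) (x : K) :
    ∃ u v : ℚ, x = (u : K) + v*θ := by
  obtain ⟨u, hu⟩ := hfix ((x + f x)/2) (by rw [map_div₀, map_add, hff, map_ofNat]; ring)
  obtain ⟨v, hv⟩ := hfix ((x - f x)/(2*θ)) (by
    rw [map_div₀, map_sub, hff, map_mul, map_ofNat, hθ]; field_simp; ring)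
  refine ⟨u, v, ?_⟩
  rw [← hu, ← hv]
  field_simp
  ring

theorem arithK {K : Type*} [Field K] [CharZero K] (f : K →+* K) (hff : ∀ x, f (f x) = x)
    (hfix : ∀ x, f x = x → ∃ q : ℚ, x = (q : K)) (s : K) (hs : s^2 = 13) (N0 N1 l0 l1 m0 m1 : K)
    (h0 : m0^2 + 13*m1^2 = fR0 N0 N1 l0 l1) (h1 : 2*m0*m1 = fR1 N0 N1 l0 l1) : l0 + s*l1 = 0 := by
  by_contra hl
  have hs0 : s ≠ 0 := by
    rintro rfl
    norm_num at hs
  have hfs : f s = -s := by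
    have h2 : (f s - s)*(f s + s) = 0 := by
      have := congrArg f hs
      rw [map_pow, map_ofNat] at this
      linear_combination this - hs
    rcases mul_eq_zero.mp h2 with h | h
    · obtain ⟨q, hq⟩ := hfix s (sub_eq_zero.mp h)
      rw [hq] at hs
      exact (no13 q (by exact_mod_cast hs)).elim
    · exact eq_neg_of_add_eq_zero_left h
  have hu : ((1+s)/2)*((1+s)/2) = (Rat.castHom K) 3 + (Rat.castHom K) 1*((1+s)/2) := by
    simp; linear_combination hs/4
  have sur : ∀ x : K, ∃ p : F13, qhom (Rat.castHom K) 3 1 ((1+s)/2) hu p = x := by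
    intro x
    obtain ⟨u, v, rfl⟩ := decQ f hff hfix s hs0 hfs x
    refine ⟨⟨u - v, 2*v⟩, ?_⟩
    rw [qhom_apply]
    simp
    ring
  have hw : qhom (Rat.castHom K) 3 1 ((1+s)/2) hu ww = (1+s)/2 := by
    rw [qhom_apply]; simp [ww]
  generalize qhom (Rat.castHom K) 3 1 ((1+s)/2) hu = j at *
  have key := sq13 s N0 N1 l0 l1 m0 m1 hs h0 h1
  generalize l0 + s*l1 = l at *
  generalize m0 + s*m1 = M at *
  generalize N0 + s*N1 = N at *
  have gM : M = (M/(4*l^3))*(4*l^3) := by field_simp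
  have gN : N = (N/(4*l^2))*(4*l^2) := by field_simp
  obtain ⟨V, hV⟩ := sur (M/(4*l^3))
  obtain ⟨a, ha⟩ := sur (N/(4*l^2))
  rw [← hV] at gM
  rw [← ha] at gN
  rw [gM, gN] at key
  apply claimC13 a V
  apply j.injective
  simp only [map_add, map_sub, map_mul, map_pow, map_neg, map_one, map_ofNat, hw]
  have hl6 : 16*l^6 ≠ 0 := mul_ne_zero (by norm_num) (pow_ne_zero 6 hl)
  apply mul_left_cancel₀ hl6
  linear_combination key

set_option maxHeartbeats 1000000 in
theorem arithL {K : Type*} [Field K] [CharZero K] (f : K →+* K) (hff : ∀ x, f (f x) = x)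
    (hfix : ∀ x, f x = x → ∃ q : ℚ, x = (q : K)) (θ : K) (hθ0 : θ ≠ 0) (hθ : f θ = -θ)
    (hns : ∀ r : K, r^2 ≠ 13) (N0 N1 l0 l1 m0 m1 : K)
    (h0 : m0^2 + 13*m1^2 = fR0 N0 N1 l0 l1) (h1 : 2*m0*m1 = fR1 N0 N1 l0 l1) (hl : ¬ (l0 = 0 ∧ l1 = 0)) :
    ∃ (a0 a1 d z : ℚ) (p t : F13), θ^2 = (d : K) ∧ 4*p = (a0 : F13) + a1*(2*ww-1) ∧
      (d : F13)*t^2 = 4*p^3 + (-1-11*ww)*(p+1)^2 ∧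
      N0 = a0*(l0^2+13*l1^2) + 26*a1*l0*l1 ∧ N1 = a1*(l0^2+13*l1^2) + 2*a0*l0*l1 ∧
      z*(l0^2-13*l1^2)^3 = m0^2 - 13*m1^2 := by
  have hd : ∃ d : ℚ, θ^2 = (d : K) := hfix _ (by rw [map_pow, hθ]; ring)
  obtain ⟨d, hd⟩ := hd
  have dec := decQ f hff hfix θ hθ0 hθ
  have uniq : ∀ u v : ℚ, (u : K) + v*θ = 0 → u = 0 ∧ v = 0 := by
    intro u v h
    have h' := congrArg f h
    simp only [map_add, map_mul, map_ratCast, hθ, map_zero] at h'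
    have hu : (u : K) = 0 := by linear_combination (h + h')/2
    have hv : (v : K)*θ = 0 := by linear_combination (h - h')/2
    exact ⟨by exact_mod_cast hu, by simpa [hθ0] using hv⟩
  have hfact : Fact (∀ r : K, r^2 ≠ 13 + 0*r) := ⟨fun r h => hns r (by linear_combination h)⟩
  let Θ : QuadraticAlgebra K 13 0 := ⟨θ, 0⟩
  let S : QuadraticAlgebra K 13 0 := ⟨0, 1⟩
  have hS : S^2 = 13 := by
    rw [pow_two]; ext <;> simp [S]
  have hΘ : Θ^2 = jF K (d : F13) := by
    rw [pow_two, jF_apply]; ext <;> simp [Θ, ← hd] <;> ring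
  have decL : ∀ x : QuadraticAlgebra K 13 0, ∃ u v : F13, x = jF K u + jF K v*Θ := by
    rintro ⟨x, y⟩
    obtain ⟨u0, v0, rfl⟩ := dec x
    obtain ⟨u1, v1, rfl⟩ := dec y
    refine ⟨⟨u0 - u1, 2*u1⟩, ⟨v0 - v1, 2*v1⟩, ?_⟩
    rw [jF_apply, jF_apply]
    ext <;> simp [Θ] <;> ring
  have uniqL : ∀ u v : F13, jF K u + jF K v*Θ = 0 → u = 0 ∧ v = 0 := by
    intro u v h
    rw [jF_apply, jF_apply] at h
    have e1 := congrArg QuadraticAlgebra.re h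
    have e2 := congrArg QuadraticAlgebra.im h
    simp [Θ] at e1 e2
    obtain ⟨a1, a2⟩ := uniq (u.im/2) (v.im/2) (by push_cast; linear_combination e2)
    obtain ⟨b1, b2⟩ := uniq (u.re + u.im/2) (v.re + v.im/2) (by push_cast; linear_combination e1)
    constructor
    · ext
      · simp; linarith
      · simp; linarith
    · ext
      · simp; linarith
      · simp; linarith
  obtain ⟨C, hC⟩ : ∃ C : K →+* QuadraticAlgebra K 13 0, ∀ x, C x = ⟨x, 0⟩ :=
    ⟨algebraMap K (QuadraticAlgebra K 13 0), fun _ => rfl⟩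
  have cz : CharZero (QuadraticAlgebra K 13 0) := charZero_of_injective_ringHom C.injective
  have k0 : (C m0)^2 + 13*(C m1)^2 = fR0 (C N0) (C N1) (C l0) (C l1) := by
    rw [← (fR_map C N0 N1 l0 l1).1, ← h0]
    simp only [map_add, map_mul, map_pow, map_ofNat]
  have k1 : 2*(C m0)*(C m1) = fR1 (C N0) (C N1) (C l0) (C l1) := by
    rw [← (fR_map C N0 N1 l0 l1).2, ← h1]
    simp only [map_mul, map_ofNat]
  have key := sq13 S (C N0) (C N1) (C l0) (C l1) (C m0) (C m1) hS k0 k1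
  have mk : ∀ x y : K, C x + S * C y = ⟨x, y⟩ := by
    intro x y
    rw [hC, hC]; ext <;> simp [S]
  have hw : jF K ww = (1+S)/2 := by
    rw [eq_div_iff two_ne_zero, jF_apply]
    ext <;> simp [S, ww]
  have hl' : C l0 + S*C l1 ≠ 0 := by
    rw [mk]
    intro h
    apply hl
    exact ⟨congrArg QuadraticAlgebra.re h, congrArg QuadraticAlgebra.im h⟩
  have eM := mk m0 m1
  have eN := mk N0 N1
  have el := mk l0 l1
  generalize C l0 + S*C l1 = l at *
  generalize C m0 + S*C m1 = M at *
  generalize C N0 + S*C N1 = N at *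
  obtain ⟨p, q, ha⟩ := decL (N/(4*l^2))
  obtain ⟨r, t, hV⟩ := decL (M/(4*l^3))
  have key2 : (M/(4*l^3))^2 = 4*(N/(4*l^2))^3 + jF K (-1-11*ww)*((N/(4*l^2))+1)^2 := by
    simp only [map_sub, map_mul, map_neg, map_one, map_ofNat, hw]
    have gM : M = (M/(4*l^3))*(4*l^3) := by field_simp
    have gN : N = (N/(4*l^2))*(4*l^2) := by field_simp
    generalize M/(4*l^3) = V at *
    generalize N/(4*l^2) = a at *
    rw [gM, gN] at key
    have hl6 : 16*l^6 ≠ 0 := mul_ne_zero (by norm_num) (pow_ne_zero 6 hl')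
    apply mul_left_cancel₀ hl6
    linear_combination key
  rw [ha, hV] at key2
  have e : jF K (r^2 + (d : F13)*t^2 - (4*(p^3 + 3*p*d*q^2) + (-1-11*ww)*((p+1)^2 + d*q^2)))
      + jF K (2*r*t - (4*(3*p^2*q + d*q^3) + 2*(-1-11*ww)*(p+1)*q))*Θ = 0 := by
    simp only [map_sub, map_add, map_mul, map_pow, map_neg, map_one, map_ofNat] at key2 ⊢
    rw [← hΘ]
    linear_combination key2
  obtain ⟨e1, e2⟩ := uniqL _ _ e
  obtain ⟨rfl, rfl, e3⟩ := lineF p q r t d (by linear_combination e1) (by linear_combination e2)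
  have hM : M = 4*l^3*(jF K t*Θ) := by
    have : M = (M/(4*l^3))*(4*l^3) := by field_simp
    rw [this, hV]; simp; ring
  have hN : N = 4*l^2*jF K p := by
    have : N = (N/(4*l^2))*(4*l^2) := by field_simp
    rw [this, ha]; simp; ring
  subst el
  rw [eN, jF_apply] at hN
  rw [eM, jF_apply] at hM
  have n0 := congrArg QuadraticAlgebra.re hN
  have n1 := congrArg QuadraticAlgebra.im hN
  have w0 := congrArg QuadraticAlgebra.re hM
  have w1 := congrArg QuadraticAlgebra.im hM
  simp [Θ, pow_succ] at n0 n1 w0 w1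
  refine ⟨4*p.re + 2*p.im, 2*p.im, d, 16*d*((t.re + t.im/2)^2 - 13*(t.im/2)^2), p, t, hd, ?_, e3, ?_, ?_, ?_⟩
  · conv_lhs => rw [F13_eq p]
    push_cast
    ring
  · push_cast; rw [n0]; ring
  · push_cast; rw [n1]; ring
  · push_cast; rw [w0, w1, ← hd]; ring

end

section
theorem solveA (a0 a1 z : ℚ)
    (G1 : 672 - 2080*a1 - 130*a1^2 + 442*a1^3 + 176*a0 - 416*a0*a1 + 26*a0^2 - 34*a0^2*a1 - 2/3*z = 0)
    (H1 : 384 - 1456*a1 + 156*a1^2 + 325*a1^3 + 80*a0 - 312*a0*a1 - 13*a0*a1^2 + 12*a0^2 - 25*a0^2*a1 + 1*a0^3 = 0)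
    (G2 : 1920 - 4576*a1 + 286/3*a1^2 + 5525/6*a1^3 + 176*a0 - 2548/3*a0*a1 + 221/6*a0*a1^2 - 26/3*a0^2 - 425/6*a0^2*a1
      - 17/6*a0^3 = 0)
    (H2 : 1008 - 3120*a1 + 663*a1^2 + 663*a1^3 - 24*a0 - 624*a0*a1 - 27*a0^2 - 51*a0^2*a1 + 1*z = 0)
    (G3 : 2624 - 40072/3*a1 + 140/3*a1^2 + 17017/6*a1^3 + 632/3*a0 - 7844/3*a0*a1 + 653/6*a0*a1^2 + 32/3*a0^2 -
      1309/6*a0^2*a1 - 653/78*a0^3 - 548/117*z + 25/18*a1*z + 1/18*a0*z = 0)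
    (H3 : 1280 - 27760/3*a1 + 5020/3*a1^2 + 6227/3*a1^3 - 448/3*a0 - 5872/3*a0*a1 - 116/3*a0^2 - 479/3*a0^2*a1 + 1*a1*z = 0)
    (G4 : 5408 - 85384/3*a1 - 2470/3*a1^2 + 35425/6*a1^3 + 6440/3*a0 - 17636/3*a0*a1 + 1157/6*a0*a1^2 + 986/3*a0^2 -
      2725/6*a0^2*a1 - 89/6*a0^3 - 86/9*z + 13/18*a1*z + 25/18*a0*z = 0) :
    (a0 = -10 ∧ a1 = -2) ∨ (a0 = -14/3 ∧ a1 = 2/3) := by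
  have e1 : a1 - 1/2*a0 - 3 = 0 := by
    linear_combination ((924263/9524736) + (-325/183168)*a1 + (-11/13824)*a0)*G1 + ((-2387533/21430656) + (-1003/81408)*a1)*H1 +
      ((-88391/3571776) + (635/122112)*a1)*G2 + ((53399/1785888))*H2 + ((-15913/2198016))*G3 + ((307/34344))*H3 +
      ((-203/2198016))*G4
  have e2 : 3*a0^2 + 44*a0 + 140 = 0 := by
    linear_combination ((-8583073/1785888) + (25025/274752)*a1 + (295/5184)*a0)*G1 + ((288229/55809) + (4607/5088)*a1)*H1 +
      ((35591/24804) + (-4159/11448)*a1)*G2 + ((-9597/5512))*H2 + ((4265/15264))*G3 + ((-3881/11448))*H3 +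
      ((739/45792))*G4
  have e3 : (a0 + 10)*(3*a0 + 14) = 0 := by linear_combination e2
  rcases mul_eq_zero.mp e3 with h | h
  · left; constructor <;> linarith
  · right; constructor <;> linarith

theorem posd {K : Type*} [Field K] [CharZero K] (f : K →+* K) (hff : ∀ x, f (f x) = x)
    (hfix : ∀ x, f x = x → ∃ q : ℚ, x = (q : K)) (θ : K) (hθ0 : θ ≠ 0) (hθ : f θ = -θ) (d : ℚ) (hd : θ^2 = (d : K))
    (w : K) (c : ℚ) (hc : 0 < c) (hw : w^2 = (c : K)) (hn : ¬ ∃ q : ℚ, w = (q : K)) : 0 < d := by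
  obtain ⟨u, v, rfl⟩ := decQ f hff hfix θ hθ0 hθ w
  have hv : v ≠ 0 := by
    rintro rfl
    exact hn ⟨u, by simp⟩
  have h' := congrArg f hw
  simp only [map_add, map_mul, map_pow, map_ratCast, hθ] at h'
  have huv : (u : K)*((v : K)*θ) = 0 := by linear_combination (hw - h')/4
  have hv' : (v : K)*θ ≠ 0 := mul_ne_zero (by exact_mod_cast hv) hθ0
  have hu : u = 0 := by
    have := (mul_eq_zero.mp huv).resolve_right hv'
    exact_mod_cast this
  subst hu
  have e : v^2*d = c := by
    have : ((v^2*d : ℚ) : K) = (c : K) := by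
      push_cast
      rw [← hd, ← hw]; push_cast; ring
    exact_mod_cast this
  by_contra hneg
  push Not at hneg
  nlinarith [sq_nonneg v]

theorem negA (d : ℚ) (hd : 0 < d) (p t : F13) (a0 a1 : ℚ) (hp : 4*p = (a0 : F13) + a1*(2*ww-1))
    (ha : (a0 = -10 ∧ a1 = -2) ∨ (a0 = -14/3 ∧ a1 = 2/3))
    (h : (d : F13)*t^2 = 4*p^3 + (-1-11*ww)*(p+1)^2) : False := by
  have h3 := hww
  have hd' : (0 : ℝ) < d := by exact_mod_cast hd
  have h13 : √13^2 = (13 : ℝ) := Real.sq_sqrt (by norm_num)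
  have hs0 := Real.sqrt_nonneg 13
  rcases ha with ⟨rfl, rfl⟩ | ⟨rfl, rfl⟩
  · have ep : p = -2 - ww := by push_cast at hp; linear_combination hp/4
    have e : (d : F13)*t^2 = -219 - 168*ww := by
      rw [h, ep]; linear_combination (-15*ww - 62)*h3
    have e' := congrArg fF e
    simp only [map_mul, map_pow, map_ratCast, map_sub, map_neg, map_ofNat, fF_ww] at e'
    nlinarith [mul_nonneg hd'.le (sq_nonneg (fF t))]
  · have ep : p = -4/3 + ww/3 := by push_cast at hp; linear_combination hp/4
    have e : (d : F13)*t^2 = -301/27 + 64/27*ww := by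
      rw [h, ep]; linear_combination (-29/27*ww - 14/27)*h3
    have e' := congrArg fF e
    simp only [map_mul, map_pow, map_ratCast, map_add, map_neg, map_div₀, map_ofNat, fF_ww] at e'
    nlinarith [mul_nonneg hd'.le (sq_nonneg (fF t))]

set_option maxHeartbeats 2000000 in
theorem coreB {K : Type*} [Field K] [CharZero K] (f : K →+* K) (hff : ∀ x, f (f x) = x)
    (hfix : ∀ x, f x = x → ∃ q : ℚ, x = (q : K)) (θ : K) (hθ0 : θ ≠ 0) (hθ : f θ = -θ) (n t m0 m1 : K)
    (hq : n^4 - 13*n^3*t + 7*n^3 - 845*n^2*t^2 + 689*n^2*t - 136*n^2 - 6591*n*t^3 + 5577*n*t^2 - 1092*n*t - 20*n -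
      10985*t^3 + 11492*t^2 - 3692*t + 352 = 0)
    (h0 : m0^2 + 13*m1^2 = fR0 (fN0 n 1 t) (fN1 n 1 t) (fl0 n 1) (fl1 1))
    (h1 : 2*m0*m1 = fR1 (fN0 n 1 t) (fN1 n 1 t) (fl0 n 1) (fl1 1))
    (hS : m0^2 - 13*m1^2 = -1083121/16*n^3*t^3 + 1447823/18*n^3*t^2 - 883363/27*n^3*t + 1957631/432*n^3 - 799708*n^2*t^4 +
      100699495/144*n^2*t^3 - 3139513/72*n^2*t^2 - 20727005/216*n^2*t + 9093253/432*n^2 - 32302491/16*n*t^5 -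
      19849895/24*n*t^4 + 119690363/36*n*t^3 - 257059985/144*n*t^2 + 66650051/216*n*t - 940225/108*n -
      53837485/16*t^5 + 57379049/72*t^4 + 712774907/216*t^3 - 1063758839/432*t^2 + 66794377/108*t - 1363271/27) :
    ∃ u v : ℚ, n = (u : K) ∧ t = (v : K) := by
  have hl1 : (fl1 1 : K) ≠ 0 := by unfold fl1; norm_num
  have hns : ∀ s : K, s^2 ≠ 13 := by
    intro s hs
    have k1 := arithK f hff hfix s hs _ _ _ _ _ _ h0 h1
    have k2 := arithK f hff hfix (-s) (by linear_combination hs) _ _ _ _ _ _ h0 h1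
    have k3 : s*fl1 1 = 0 := by linear_combination (k1 - k2)/2
    have k4 := (mul_eq_zero.mp k3).resolve_right hl1
    rw [k4] at hs
    norm_num at hs
  obtain ⟨a0, a1, d, z, p, t', hd, hp, hpt, k0, k1, kz⟩ :=
    arithL f hff hfix θ hθ0 hθ hns _ _ _ _ _ _ h0 h1 (fun h => hl1 h.2)
  have hll : fl0 n 1^2 - 13*fl1 1^2 ≠ 0 := by
    intro h
    apply hns (fl0 n 1/fl1 1)
    field_simp
    linear_combination h
  obtain ⟨R1, R2, R3, R4⟩ := relN n t (a0 : K) (a1 : K) (z : K) hq k0 k1 (kz.trans hS) hll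
  by_cases hn : ∃ u : ℚ, n = (u : K)
  · obtain ⟨u, rfl⟩ := hn
    by_cases hu : 3*u + 5 = 0
    · have hu' : u = -5/3 := by linarith
      subst hu'
      by_cases ht : ∃ v : ℚ, t = (v : K)
      · obtain ⟨v, rfl⟩ := ht
        exact ⟨_, v, rfl, rfl⟩
      · exfalso
        unfold fN0 fl0 fl1 at k0
        unfold fN1 fl0 fl1 at k1
        push_cast at k0 k1 hq
        have c0 : 38*a0 - 130*a1 + 120 = 0 := by
          have : ((38*a0 - 130*a1 + 120 : ℚ) : K) = 0 := by
            push_cast; linear_combination (-1296)*k0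
          exact_mod_cast this
        have c1 : 38*a1 - 10*a0 - 24 = 0 := by
          have : ((38*a1 - 10*a0 - 24 : ℚ) : K) = 0 := by
            push_cast; linear_combination (-1296)*k1
          exact_mod_cast this
        have hdpos : 0 < d := by
          apply posd f hff hfix θ hθ0 hθ d hd (6084*t - 2067) 50193 (by norm_num)
          · push_cast
            linear_combination (-246402)*hq
          · rintro ⟨v, hv⟩
            apply ht
            refine ⟨(v + 2067)/6084, ?_⟩
            push_cast
            rw [← hv]; ring
        exact negA d hdpos p t' a0 a1 hp (Or.inl ⟨by linarith, by linarith⟩) hpt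
    · have hu' : 3*(u : K) + 5 ≠ 0 := by exact_mod_cast hu
      unfold fN0 fl0 fl1 at k0
      refine ⟨u, (a0*((u/2+25/36)^2 + 13/1296) + 26*a1*(u/2+25/36)/36 + 17/12*u^2 + 79/12*u + 385/54)*36/(91*(3*u+5)), rfl, ?_⟩
      push_cast
      rw [eq_div_iff (mul_ne_zero (by norm_num) hu')]
      linear_combination 36*k0
  · exfalso
    have GH : ∀ G H : ℚ, (G : K) + n*(H : K) = 0 → G = 0 ∧ H = 0 := by
      intro G H h
      have hH : H = 0 := by
        by_contra hH
        apply hn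
        refine ⟨-G/H, ?_⟩
        have hH' : (H : K) ≠ 0 := by exact_mod_cast hH
        push_cast
        rw [eq_div_iff hH']
        linear_combination h
      subst hH
      refine ⟨?_, rfl⟩
      have : (G : K) = 0 := by simpa using h
      exact_mod_cast this
    obtain ⟨G1, H1⟩ := GH (672 - 2080*a1 - 130*a1^2 + 442*a1^3 + 176*a0 - 416*a0*a1 + 26*a0^2 - 34*a0^2*a1 - 2/3*z)
      (384 - 1456*a1 + 156*a1^2 + 325*a1^3 + 80*a0 - 312*a0*a1 - 13*a0*a1^2 + 12*a0^2 - 25*a0^2*a1 + 1*a0^3) (by push_cast; linear_combination R1)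
    obtain ⟨G2, H2⟩ := GH (1920 - 4576*a1 + 286/3*a1^2 + 5525/6*a1^3 + 176*a0 - 2548/3*a0*a1 + 221/6*a0*a1^2 - 26/3*a0^2 - 425/6*a0^2*a1
      - 17/6*a0^3)
      (1008 - 3120*a1 + 663*a1^2 + 663*a1^3 - 24*a0 - 624*a0*a1 - 27*a0^2 - 51*a0^2*a1 + 1*z) (by push_cast; linear_combination R2)
    obtain ⟨G3, H3⟩ := GH (2624 - 40072/3*a1 + 140/3*a1^2 + 17017/6*a1^3 + 632/3*a0 - 7844/3*a0*a1 + 653/6*a0*a1^2 + 32/3*a0^2 -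
      1309/6*a0^2*a1 - 653/78*a0^3 - 548/117*z + 25/18*a1*z + 1/18*a0*z)
      (1280 - 27760/3*a1 + 5020/3*a1^2 + 6227/3*a1^3 - 448/3*a0 - 5872/3*a0*a1 - 116/3*a0^2 - 479/3*a0^2*a1 + 1*a1*z) (by push_cast; linear_combination R3)
    obtain ⟨G4, H4⟩ := GH (5408 - 85384/3*a1 - 2470/3*a1^2 + 35425/6*a1^3 + 6440/3*a0 - 17636/3*a0*a1 + 1157/6*a0*a1^2 + 986/3*a0^2 -
      2725/6*a0^2*a1 - 89/6*a0^3 - 86/9*z + 13/18*a1*z + 25/18*a0*z)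
      (3200 - 60112/3*a1 + 7384/3*a1^2 + 12935/3*a1^3 + 3200/3*a0 - 13168/3*a0*a1 + 448/3*a0^2 - 995/3*a0^2*a1 +
      1*a0*z) (by push_cast; linear_combination R4)
    have ha := solveA a0 a1 z G1 H1 G2 H2 G3 H3 G4
    have ha' := ha
    unfold fN0 fl0 fl1 at k0
    unfold fN1 fl0 fl1 at k1
    rcases ha with ⟨rfl, rfl⟩ | ⟨rfl, rfl⟩
    · apply hn
      refine ⟨-5/3, ?_⟩
      have e : (3*n + 5)^2 = 0 := by
        push_cast at k0 k1
        linear_combination (-3)*(k0 - 7*k1)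
      have e' := pow_eq_zero_iff two_ne_zero |>.mp e
      push_cast
      linear_combination e'/3
    · have hdpos : 0 < d := by
        apply posd f hff hfix θ hθ0 hθ d hd (n - 1) 6 (by norm_num)
        · push_cast at k0 k1 ⊢
          linear_combination 3*(k0 - 7*k1)
        · rintro ⟨v, hv⟩
          apply hn
          refine ⟨v + 1, ?_⟩
          push_cast
          rw [← hv]; ring
      exact negA d hdpos p t' _ _ hp ha' hpt
end

section
theorem XP.prop {K : Type*} [Field K] [CharZero K] (f : K →+* K) (hff : ∀ x, f (f x) = x)
    (hfix : ∀ x, f x = x → ∃ q : ℚ, x = (q : K)) (θ : K) (hθ0 : θ ≠ 0) (hθ : f θ = -θ)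
    {x y z a b c d e : K} (h : XP x y z a b c d e) (hne : ¬ (x = 0 ∧ y = 0 ∧ z = 0)) :
    ∃ (k : K) (p q r : ℚ), k ≠ 0 ∧ x = k*p ∧ y = k*q ∧ z = k*r := by
  obtain ⟨n, B, t, hx, hy, hz⟩ : ∃ n B t : K, x = (n+3*t)/2 ∧ y = 2*t-B ∧ z = 3*t-B :=
    ⟨2*x-3*(z-y), 2*(z-y)-y, z-y, by ring, by ring, by ring⟩
  by_cases hB : B = 0
  · subst hB
    by_cases hn : n = 0
    · subst hn
      refine ⟨t, 3/2, 2, 3, ?_, ?_, ?_, ?_⟩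
      · rintro rfl
        apply hne
        rw [hx, hy, hz]
        simp
      · push_cast; rw [hx]; ring
      · push_cast; rw [hy]; ring
      · push_cast; rw [hz]; ring
    · obtain ⟨-, m0, m1, h0, h1, -⟩ := h.nbt n 0 t hx hy hz
      have hl0 : fl0 n 0 ≠ 0 := by
        unfold fl0
        simpa using hn
      have hl1 : (fl1 0 : K) = 0 := by unfold fl1; simp
      have hns : ∀ s : K, s^2 ≠ 13 := by
        intro s hs
        have k1 := arithK f hff hfix s hs _ _ _ _ _ _ h0 h1
        rw [hl1] at k1
        exact hl0 (by linear_combination k1)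
      obtain ⟨a0, a1, d, z, p, t', -, -, -, k0, -, -⟩ :=
        arithL f hff hfix θ hθ0 hθ hns _ _ _ _ _ _ h0 h1 (fun h => hl0 h.1)
      unfold fN0 fl0 fl1 at k0
      have ht : t = n*((3*a0+17)/91) := by
        apply mul_left_cancel₀ hn
        linear_combination 12/91*k0
      refine ⟨n, (1+3*((3*a0+17)/91))/2, 2*((3*a0+17)/91), 3*((3*a0+17)/91), hn, ?_, ?_, ?_⟩
      · push_cast; rw [hx, ht]; ring
      · push_cast; rw [hy, ht]; ring
      · push_cast; rw [hz, ht]; ring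
  · obtain ⟨hq, m0, m1, h0, h1, hS⟩ := (h.smul B⁻¹).nbt (n/B) 1 (t/B) (by rw [hx]; field_simp)
      (by rw [hy]; field_simp) (by rw [hz]; field_simp)
    obtain ⟨u, v, hu, hv⟩ := coreB f hff hfix θ hθ0 hθ (n/B) (t/B) m0 m1 (by linear_combination hq) h0 h1
      (by rw [hS]; ring)
    have hu' : n = B*u := by rw [← hu]; field_simp
    have hv' : t = B*v := by rw [← hv]; field_simp
    refine ⟨B, (u+3*v)/2, 2*v-1, 3*v-1, hB, ?_, ?_, ?_⟩
    · push_cast; rw [hx, hu', hv']; ring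
    · push_cast; rw [hy, hv']; ring
    · push_cast; rw [hz, hv']; ring

theorem XP.final {K : Type*} [Field K] [Algebra ℚ K] (hK : Module.finrank ℚ K = 2) (σ : K ≃ₐ[ℚ] K)
    (hσ : σ ≠ AlgEquiv.refl) {x1 x2 x3 x4 x5 x6 x7 x8 : K} (h : XP x1 x2 x3 x4 x5 x6 x7 x8)
    (hx : ¬ (x1 = 0 ∧ x2 = 0 ∧ x3 = 0 ∧ x4 = 0 ∧ x5 = 0 ∧ x6 = 0 ∧ x7 = 0 ∧ x8 = 0))
    (hexc : ¬ ∃ μ : K, σ x1 = μ*x1 ∧ σ x2 = μ*x2 ∧ σ x3 = μ*x3 ∧ σ x4 = μ*x4 ∧ σ x5 = μ*x5 ∧ σ x6 = μ*x6 ∧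
      σ x7 = μ*x7 ∧ σ x8 = μ*x8) :
    ∃ l : K, l ≠ 0 ∧ σ x1 = l*x1 ∧ σ x2 = l*x2 ∧ σ x3 = l*x3 ∧ σ x4 = -(l*x4) ∧ σ x5 = -(l*x5) ∧
      σ x6 = -(l*x6) ∧ σ x7 = -(l*x7) ∧ σ x8 = -(l*x8) := by
  have cz : CharZero K := algebraRat.charZero K
  obtain ⟨hσσ, hfix, θ, hθ0, hθ⟩ := quad_setup hK σ hσ
  by_cases hu : x1 = 0 ∧ x2 = 0 ∧ x3 = 0
  · obtain ⟨rfl, rfl, rfl⟩ := hu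
    have := h.u0 (fun y hy => nosext σ hσσ hfix y hy)
    exact (hx (by tauto)).elim
  obtain ⟨k, p, q, r, hk, e1, e2, e3⟩ := h.prop (σ : K →+* K) hσσ hfix θ hθ0 hθ hu
  have hne : ¬ (p = 0 ∧ q = 0 ∧ r = 0) := by
    rintro ⟨rfl, rfl, rfl⟩
    apply hu
    rw [e1, e2, e3]
    simp
  have h' := h.smul k⁻¹
  have g1 : k⁻¹*x1 = p := by rw [e1]; field_simp
  have g2 : k⁻¹*x2 = q := by rw [e2]; field_simp
  have g3 : k⁻¹*x3 = r := by rw [e3]; field_simp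
  rw [g1, g2, g3] at h'
  obtain ⟨μ, hμ, f4, f5, f6, f7, f8⟩ := h'.rat (σ : K →+* K) p q r hne
  have hσk : σ k ≠ 0 := by simpa using hk
  have tr : ∀ v : K, (σ : K →+* K) (k⁻¹*v) = μ*(k⁻¹*v) → σ v = μ*(σ k/k)*v := by
    intro v hv
    have hv' : (σ k)⁻¹ * σ v = μ*(k⁻¹*v) := by simpa using hv
    have : σ v = σ k*((σ k)⁻¹ * σ v) := by field_simp
    rw [this, hv']
    field_simp
  have tq : ∀ (v : K) (w : ℚ), v = k*w → σ v = (σ k/k)*v := by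
    intro v w hv
    rw [hv, map_mul, map_ratCast]
    field_simp
  rcases hμ with rfl | rfl
  · exfalso
    apply hexc
    refine ⟨σ k/k, tq _ _ e1, tq _ _ e2, tq _ _ e3, ?_, ?_, ?_, ?_, ?_⟩
    · simpa using tr _ f4
    · simpa using tr _ f5
    · simpa using tr _ f6
    · simpa using tr _ f7
    · simpa using tr _ f8
  · refine ⟨σ k/k, div_ne_zero hσk hk, tq _ _ e1, tq _ _ e2, tq _ _ e3, ?_, ?_, ?_, ?_, ?_⟩
    · simpa using tr _ f4
    · simpa using tr _ f5
    · simpa using tr _ f6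
    · simpa using tr _ f7
    · simpa using tr _ f8
end


/-- **Main theorem for p = 13.** Let `K` be a quadratic field and `σ` its
nontrivial `ℚ`-algebra automorphism. Let `(x₁, …, x₈) ∈ K⁸`, not all zero,
satisfy the 15 quadratic equations cutting out the model of the genus 8
modular curve `X_ns(13)` in `ℙ⁷`, and suppose that the conjugate tuple
`(σx₁, …, σx₈)` is not a `K`-scalar multiple of `(x₁, …, x₈)` (so the
corresponding projective point is a genuine quadratic point). Then there is a
nonzero `λ ∈ K` with `σxᵢ = λxᵢ` for `i = 1,2,3` and `σxᵢ = -λxᵢ` for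
`i = 4,…,8`: the Galois conjugate of every quadratic point on `X_ns(13)`
equals its image under the modular involution
`w₁₃ : (x₁ : ⋯ : x₈) ↦ (x₁ : x₂ : x₃ : -x₄ : -x₅ : -x₆ : -x₇ : -x₈)`, i.e.
`X_ns(13)` has no exceptional quadratic points. -/
theorem no_exceptional_quadratic_points_Xns13
    (K : Type*) [Field K] [Algebra ℚ K] (hK : Module.finrank ℚ K = 2)
    (σ : K ≃ₐ[ℚ] K) (hσ : σ ≠ AlgEquiv.refl)
    (x1 x2 x3 x4 x5 x6 x7 x8 : K)
    (hx : ¬ (x1 = 0 ∧ x2 = 0 ∧ x3 = 0 ∧ x4 = 0 ∧ x5 = 0 ∧ x6 = 0 ∧ x7 = 0 ∧ x8 = 0))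
    (e1 : -2*x1^2 + x1*x2 - 3*x1*x3 + x1*x4 - 4*x1*x5 - x1*x7 + 3*x2^2 + 2*x2*x3
      - x2*x4 + 3*x2*x5 + x2*x7 - x2*x8 - x3^2 - 2*x3*x4 + 2*x3*x7 + 5*x3*x8
      - x4*x5 + x4*x7 - x4*x8 - x7^2 - x7*x8 + 2*x8^2 = 0)
    (e2 : -3*x1*x2 + 2*x1*x3 - 4*x1*x4 + x1*x5 + 2*x1*x6 - x1*x7 + 2*x1*x8
      - 3*x2^2 - x2*x3 + 3*x2*x4 + x2*x5 + 2*x2*x6 + 2*x2*x7 - x2*x8 + 2*x3^2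
      + x3*x5 + 2*x3*x6 - 3*x3*x7 + 4*x3*x8 - x4^2 - 3*x4*x6 + 2*x4*x8 + x5*x6
      - x5*x7 + 3*x5*x8 - x6*x7 + x7^2 - x7*x8 - 2*x8^2 = 0)
    (e3 : -2*x1^2 - 2*x1*x2 - x1*x3 + 3*x1*x4 + x1*x5 + 2*x1*x7 - 2*x1*x8
      + x2*x3 - 4*x2*x4 + x2*x5 + 5*x2*x6 + 4*x2*x8 + x3^2 - x3*x4 + x3*x5
      + x3*x6 - x3*x7 + 7*x3*x8 - x4^2 - 2*x4*x6 + x4*x7 + x4*x8 + x5*x6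
      - x5*x7 + x5*x8 - 2*x7*x8 = 0)
    (e4 : 2*x1^2 - 2*x1*x2 - 5*x1*x3 + x1*x4 + x1*x6 + x1*x7 + x2*x3 - x2*x4
      + x2*x6 - x2*x7 + 2*x2*x8 + 2*x3^2 - 2*x3*x4 + x3*x6 - 2*x3*x7 + 3*x3*x8
      - x4^2 - x4*x5 + x4*x7 + x4*x8 - x5^2 + x5*x6 + 2*x5*x8 + 2*x6^2
      - 2*x6*x7 - x6*x8 + x7^2 - x7*x8 - 2*x8^2 = 0)
    (e5 : -3*x1^2 - 2*x1*x2 + x2^2 + 4*x2*x3 + 3*x3^2 - x4^2 + x4*x5 - x4*x6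
      + x4*x7 + 4*x4*x8 + x5^2 - x5*x6 + 2*x5*x8 + x6*x7 - 4*x6*x8 - 2*x7*x8
      - x8^2 = 0)
    (e6 : -x1^2 + x1*x3 - 4*x1*x4 + 2*x1*x5 - x1*x7 + x2^2 + 3*x2*x3 + 3*x2*x4
      - 3*x2*x5 + 2*x2*x7 - 2*x2*x8 + 2*x3^2 + x3*x5 - 3*x3*x7 - 3*x3*x8
      - x4*x6 + x5^2 - x5*x6 - x5*x7 + 2*x5*x8 + x6*x7 - 2*x6*x8 - x7*x8
      + x8^2 = 0)
    (e7 : -2*x1*x6 - 4*x1*x8 - 2*x2*x4 - 3*x2*x5 + 3*x2*x6 + 3*x2*x7 - 3*x3*x4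
      + 2*x3*x5 - x3*x6 - 2*x3*x7 + 2*x3*x8 - x4*x5 - x4*x6 + 2*x5*x8
      - x6*x7 = 0)
    (e8 : -2*x1^2 - 2*x1*x2 - x1*x3 - x1*x4 - x1*x5 + 2*x1*x6 + 2*x1*x8 + x2*x3
      + 2*x2*x4 - x2*x5 - 3*x2*x6 - 2*x2*x7 + x3^2 - 3*x3*x4 - x3*x5 + x3*x6
      - 3*x3*x7 - x3*x8 - x4^2 - 2*x4*x6 + x4*x7 + x4*x8 + x5*x6 - x5*x7
      + x5*x8 - 2*x7*x8 = 0)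
    (e9 : -x1^2 + x1*x2 - 4*x1*x3 + x1*x4 - 2*x1*x6 - 2*x1*x7 + 4*x1*x8
      + 2*x2^2 - x2*x3 + 2*x2*x4 - 2*x2*x5 - 2*x2*x6 - 3*x2*x7 - 3*x2*x8
      - 3*x3^2 - 4*x3*x4 - 3*x3*x5 - 2*x3*x6 + 3*x3*x7 - x4*x5 + x4*x6 + x4*x7
      - x4*x8 - x5^2 + x5*x6 + x5*x7 - 2*x5*x8 - x6*x7 + 2*x6*x8 - x7^2
      + x8^2 = 0)
    (e10 : -4*x1^2 - 4*x1*x2 - 2*x1*x3 + 2*x2*x3 + 2*x3^2 - 2*x4^2 + 2*x4*x5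
      - 2*x4*x6 + 2*x4*x7 + 2*x4*x8 + 2*x5*x6 - 2*x5*x7 - 2*x5*x8 + 2*x6*x7
      - 4*x7*x8 = 0)
    (e11 : 2*x1*x4 + 2*x1*x6 + 2*x1*x7 - 2*x2*x4 + 2*x2*x6 - 2*x2*x7 + 4*x2*x8
      - 4*x3*x4 + 2*x3*x6 - 4*x3*x7 + 6*x3*x8 = 0)
    (e12 : -x1^2 + x1*x2 - 4*x1*x3 + 3*x1*x4 + 2*x1*x5 + 2*x1*x7 + 2*x2^2
      - x2*x3 - 2*x2*x4 - 3*x2*x7 + 3*x2*x8 - 3*x3^2 + 2*x3*x4 - x3*x5 + x3*x7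
      - 2*x3*x8 - x4*x5 + x4*x6 + x4*x7 - x4*x8 - x5^2 + x5*x6 + x5*x7
      - 2*x5*x8 - x6*x7 + 2*x6*x8 - x7^2 + x8^2 = 0)
    (e13 : -2*x1*x4 - x1*x5 + x1*x6 - x1*x7 + 2*x1*x8 + 3*x2*x4 - x2*x5
      - 4*x2*x6 - x2*x7 - 2*x2*x8 - x3*x4 - x3*x5 - x3*x7 - 4*x3*x8 - 2*x4^2
      - x4*x5 + 2*x4*x6 + 2*x4*x7 - x5^2 + x5*x7 + x5*x8 - x6*x8 + 2*x7^2
      - 3*x7*x8 + 2*x8^2 = 0)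
    (e14 : x1^2 - x1*x2 + 4*x1*x3 + x1*x5 - 2*x1*x6 + x1*x7 - 6*x1*x8 + 4*x2^2
      + 6*x2*x3 - 3*x2*x4 - 2*x2*x5 + 3*x2*x6 + 4*x2*x7 + x2*x8 - 3*x3^2
      + 2*x3*x4 + 3*x3*x5 - x3*x6 - x3*x7 - 2*x3*x8 + 2*x4^2 + x4*x6 - 2*x4*x7
      + 3*x5^2 - 2*x5*x6 - x5*x7 + x5*x8 - 2*x6^2 - x6*x7 - 4*x6*x8 - x7^2
      - x7*x8 + x8^2 = 0)
    (e15 : -2*x1*x2 + 10*x1*x3 - 3*x1*x4 + 3*x1*x5 - 2*x1*x6 - x1*x7 - 2*x1*x8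
      + 3*x2^2 - 16*x2*x3 + x2*x4 - 2*x2*x5 + 3*x2*x6 + 4*x2*x7 - 2*x2*x8
      + 5*x3^2 + 3*x3*x4 + 2*x3*x5 - x3*x6 - 2*x3*x8 + x4^2 + x4*x5 - 2*x4*x7
      + x4*x8 + x5*x6 + 3*x5*x8 + 2*x6*x7 + 6*x6*x8 + x7^2 - x7*x8
      + 6*x8^2 = 0)
    (hexc : ¬ ∃ μ : K, σ x1 = μ * x1 ∧ σ x2 = μ * x2 ∧ σ x3 = μ * x3 ∧
      σ x4 = μ * x4 ∧ σ x5 = μ * x5 ∧ σ x6 = μ * x6 ∧ σ x7 = μ * x7 ∧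
      σ x8 = μ * x8) :
    ∃ l : K, l ≠ 0 ∧ σ x1 = l * x1 ∧ σ x2 = l * x2 ∧ σ x3 = l * x3 ∧
      σ x4 = -(l * x4) ∧ σ x5 = -(l * x5) ∧ σ x6 = -(l * x6) ∧
      σ x7 = -(l * x7) ∧ σ x8 = -(l * x8) := by
  have cz : CharZero K := algebraRat.charZero K
  have h : XP x1 x2 x3 x4 x5 x6 x7 x8 := by
    constructor
    · linear_combination (4)*e1 + (13/2)*e2 + (-1)*e3 + (5/2)*e6 + (7/2)*e7 + (-31/2)*e8 + (15/2)*e9 + (5)*e10 + (20)*e11 + (-5)*e12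
    · linear_combination (11/2)*e1 + (13)*e2 + (-3)*e3 + (15/2)*e6 + (4)*e7 + (-27)*e8 + (19/2)*e9 + (17/2)*e10 + (55/2)*e11 + (-2)*e12
    · linear_combination (8)*e1 + (13)*e2 + (-17/2)*e3 + (5)*e6 + (7)*e7 + (-49/2)*e8 + (17/2)*e9 + (10)*e10 + (67/2)*e11 + (-7/2)*e12
    · linear_combination (-12)*e1 + (-39/2)*e2 + (19/2)*e3 + (-15/2)*e6 + (-21/2)*e7 + (40)*e8 + (-16)*e9 + (-15)*e10 + (-47)*e11 + (17/2)*e12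
    · linear_combination (-35/2)*e1 + (-26)*e2 + (19)*e3 + (-17/2)*e6 + (-21)*e7 + (54)*e8 + (-25/2)*e9 + (-47/2)*e10 + (-123/2)*e11 + (4)*e12
    · linear_combination (1/2)*e1 + (3/2)*e3 + (-1/2)*e6 + (-2)*e7 + (1/2)*e8 + (-3/2)*e9 + (-1)*e10 + (-4)*e11 + (1)*e12
    · linear_combination (-7)*e1 + (-151/2)*e2 + (261/2)*e3 + (26)*e4 + (-151)*e5 + (135/2)*e6 + (-171/2)*e7 + (39)*e8 + (5)*e9 + (9)*e10 + (-109/2)*e11 + (-175/2)*e12 + (17)*e13 + (10)*e14 + (1)*e15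
    · linear_combination (8)*e1 + (-66)*e2 + (96)*e3 + (-13)*e4 + (-106)*e5 + (77)*e6 + (-49)*e7 + (13)*e8 + (-17/2)*e9 + (11/2)*e10 + (-25)*e11 + (-99/2)*e12 + (14)*e13 + (-17)*e14 + (-3)*e15
    · linear_combination (-15)*e1 + (-45/2)*e2 + (80)*e3 + (-26)*e4 + (-19)*e5 + (7/2)*e6 + (-73/2)*e7 + (65/2)*e8 + (7)*e9 + (-71/2)*e10 + (-23)*e11 + (-89/2)*e12 + (29)*e13 + (14)*e14 + (4)*e15
    · linear_combination (30)*e1 + (-261/2)*e2 + (217)*e3 + (26)*e4 + (-235)*e5 + (285/2)*e6 + (-309/2)*e7 + (143/2)*e8 + (12)*e9 + (51/2)*e10 + (-71)*e11 + (-225/2)*e12 + (33)*e13 + (24)*e14 + (18)*e15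
    · linear_combination (-7/2)*e1 + (-2)*e2 + (10)*e3 + (9)*e5 + (9/2)*e6 + (-7)*e7 + (5/2)*e9 + (-17/2)*e10 + (-9/2)*e11 + (-8)*e12 + (2)*e13 + (5)*e14 + (-6)*e15
    · linear_combination (-2)*e1 + (7/2)*e2 + (-24)*e3 + (13)*e4 + (59)*e5 + (-19/2)*e6 + (31/2)*e7 + (-13/2)*e8 + (-6)*e9 + (-45/2)*e10 + (3)*e11 + (15/2)*e12 + (-10)*e13 + (-12)*e14 + (4)*e15
    · linear_combination (3/2)*e2 + (-3)*e3 + (3)*e5 + (-3/2)*e6 + (3/2)*e7 + (-1/2)*e8 + (-1/2)*e10 + (1)*e11 + (3/2)*e12 + (-1)*e13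
    · linear_combination (-1/2)*e2 + (1/2)*e3 + (-1)*e5 + (1/2)*e6 + (-1/2)*e7 + (1/2)*e10 + (-1/2)*e12
    · linear_combination (1/2)*e2 + (-1)*e3 + (1)*e5 + (-1/2)*e6 + (1/2)*e7 + (-1/2)*e8 + (1/2)*e11 + (1/2)*e12
  exact h.final hK σ hσ hx hexc
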